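/- Let p be a prime and f ∈ ℤ[x₁,…,xₙ] a nonconstant polynomial. For each i ∈ ℤ_{≥1} let Nᵢ denote the number of a ∈ (ℤ/pⁱℤ)ⁿ with f(a) = 0 in ℤ/pⁱℤ. Then the formal power series P(T) = 1 + ∑_{i≥1} Nᵢ p^{-ni} Tⁱ ∈ ℚ⟦T⟧ is rational: there exist polynomials A, B ∈ ℚ[T] with B ≠ 0 such that B(T)·P(T) = A(T) as formal power series. -/

import Mathlib

open MvPolynomial

/-- The number `Nᵢ` of solutions of `f = 0` over `ℤ/pⁱℤ`. -/
noncomputable def zeroCount (p : ℕ) {n : ℕ} (f : MvPolynomial (Fin n) ℤ) (i : ℕ) : ℕ :=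
  Nat.card {a : Fin n → ZMod (p ^ i) //
    eval a (MvPolynomial.map (Int.castRingHom (ZMod (p ^ i))) f) = 0}

open scoped Classical in
/-- The Poincaré series `P(T) = 1 + ∑_{i ≥ 1} Nᵢ p^{-ni} Tⁱ ∈ ℚ⟦T⟧`. -/
noncomputable def poincareSeries (p : ℕ) {n : ℕ} (f : MvPolynomial (Fin n) ℤ) :
    PowerSeries ℚ :=
  PowerSeries.mk fun i =>
    if i = 0 then 1 else (zeroCount p f i : ℚ) * ((p : ℚ) ^ (n * i))⁻¹

namespace PIg
open Set

variable {p : ℕ} [hp : Fact p.Prime]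

/-- `y ≡ k p^σ` modulo `p^(σ+L)`. -/
def E (y : ℚ_[p]) (σ : ℤ) (L : ℕ) (k : ℤ) : Prop :=
  ‖y - k * (p : ℚ_[p]) ^ σ‖ ≤ (p : ℝ) ^ (-(σ + L))

lemma p_pos : (0 : ℝ) < p := by exact_mod_cast hp.1.pos
lemma one_lt_p : (1 : ℝ) < p := by exact_mod_cast hp.1.one_lt
lemma pK_ne : (p : ℚ_[p]) ≠ 0 := by exact_mod_cast hp.1.ne_zero

lemma zpow_pos' (n : ℤ) : (0 : ℝ) < (p : ℝ) ^ n := zpow_pos p_pos n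
lemma zpow_le' {m n : ℤ} : (p : ℝ) ^ m ≤ (p : ℝ) ^ n ↔ m ≤ n := zpow_le_zpow_iff_right₀ one_lt_p
lemma zpow_lt' {m n : ℤ} : (p : ℝ) ^ m < (p : ℝ) ^ n ↔ m < n := zpow_lt_zpow_iff_right₀ one_lt_p
lemma zpow_add' (m n : ℤ) : (p : ℝ) ^ (m + n) = (p : ℝ) ^ m * (p : ℝ) ^ n :=
  zpow_add₀ p_pos.ne' m n

lemma norm_zpow_p (n : ℤ) : ‖(p : ℚ_[p]) ^ n‖ = (p : ℝ) ^ (-n) := Padic.norm_p_zpow n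

lemma norm_add_le {x y : ℚ_[p]} {r : ℝ} (hx : ‖x‖ ≤ r) (hy : ‖y‖ ≤ r) : ‖x + y‖ ≤ r :=
  (Padic.nonarchimedean x y).trans (max_le hx hy)
lemma norm_sub_le {x y : ℚ_[p]} {r : ℝ} (hx : ‖x‖ ≤ r) (hy : ‖y‖ ≤ r) : ‖x - y‖ ≤ r := by
  rw [sub_eq_add_neg]; exact norm_add_le hx (by rwa [norm_neg])
lemma norm_sum_le {ι : Type*} {s : Finset ι} {f : ι → ℚ_[p]} {r : ℝ} (hr : 0 ≤ r)
    (h : ∀ i ∈ s, ‖f i‖ ≤ r) : ‖∑ i ∈ s, f i‖ ≤ r := by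
  classical
  induction s using Finset.induction_on with
  | empty => simpa using hr
  | insert a s ha ih =>
    rw [Finset.sum_insert ha]
    exact norm_add_le (h a (by simp)) (ih fun i hi => h i (by simp [hi]))

lemma norm_le_congr {x y : ℚ_[p]} {r : ℝ} (h : ‖x - y‖ ≤ r) : ‖x‖ ≤ r ↔ ‖y‖ ≤ r := by
  constructor
  · intro hx
    have := norm_sub_le hx h
    simpa using this
  · intro hy
    have := norm_add_le h hy
    simpa using this

lemma norm_eq_of_lt {x y : ℚ_[p]} (h : ‖x - y‖ < ‖y‖) : ‖x‖ = ‖y‖ := by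
  apply le_antisymm
  · have := norm_add_le h.le le_rfl (x := x - y) (y := y)
    simpa using this
  · by_contra hlt
    push Not at hlt
    have : ‖y‖ ≤ max ‖x - y‖ ‖x‖ := by
      have := norm_sub_le (le_max_right ‖x - y‖ ‖x‖) (le_max_left ‖x - y‖ ‖x‖)
      simpa using this
    exact absurd this (not_le.2 (max_lt h hlt))

lemma exists_norm_eq {y : ℚ_[p]} (hy : y ≠ 0) : ∃ n : ℤ, ‖y‖ = (p : ℝ) ^ (-n) :=
  ⟨_, Padic.norm_eq_zpow_neg_valuation hy⟩ 

lemma norm_le_iff_lt {y : ℚ_[p]} {n : ℤ} : ‖y‖ ≤ (p : ℝ) ^ (-(n + 1)) ↔ ‖y‖ < (p : ℝ) ^ (-n) := by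
  by_cases hy : y = 0
  · subst hy; simp [zpow_pos', (zpow_pos' _).le]
  · obtain ⟨m, hm⟩ := exists_norm_eq hy
    rw [hm, zpow_le', zpow_lt']; omega

lemma norm_int_le (k : ℤ) : ‖(k : ℚ_[p])‖ ≤ 1 := Padic.norm_int_le_one k

lemma norm_int_le_iff (k : ℤ) (n : ℕ) : ‖(k : ℚ_[p])‖ ≤ (p : ℝ) ^ (-(n : ℤ)) ↔ (p ^ n : ℤ) ∣ k := by
  rw [Padic.norm_int_le_pow_iff_dvd]

lemma norm_int_eq_one {k : ℤ} (h : ¬ (p : ℤ) ∣ k) : ‖(k : ℚ_[p])‖ = 1 := by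
  have h1 := norm_int_le (p := p) k
  have := norm_int_le_iff (p := p) k 1
  rcases h1.lt_or_eq with h2 | h2
  · exfalso; apply h
    have h3 := (norm_le_iff_lt (y := (k : ℚ_[p])) (n := 0)).2 (by simpa using h2)
    simpa using this.1 (by simpa using h3)
  · exact h2

lemma not_dvd_of_norm {k : ℤ} (h : ‖(k : ℚ_[p])‖ = 1) : ¬ (p : ℤ) ∣ k := by
  intro hd
  have := (norm_int_le_iff (p := p) k 1).2 (by simpa using hd)
  rw [h] at this
  have h2 : (p : ℝ) ^ (-((1:ℕ) : ℤ)) < 1 := by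
    have := (zpow_lt' (p := p) (m := -1) (n := 0)).2 (by norm_num)
    simpa using this
  linarith

lemma norm_term (k : ℤ) (σ : ℤ) : ‖(k : ℚ_[p]) * (p : ℚ_[p]) ^ σ‖ ≤ (p : ℝ) ^ (-σ) := by
  rw [norm_mul, norm_zpow_p]
  have := norm_int_le (p := p) k
  nlinarith [zpow_pos' (p := p) (-σ)]

lemma norm_term_le_iff (k : ℤ) (σ : ℤ) (L : ℕ) :
    ‖(k : ℚ_[p]) * (p : ℚ_[p]) ^ σ‖ ≤ (p : ℝ) ^ (-(σ + L)) ↔ (p ^ L : ℤ) ∣ k := by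
  rw [norm_mul, norm_zpow_p, ← norm_int_le_iff, neg_add, add_comm, zpow_add']
  exact mul_le_mul_iff_left₀ (zpow_pos' _)

lemma E_zero_iff {y : ℚ_[p]} {σ : ℤ} {k : ℤ} : E y σ 0 k ↔ ‖y‖ ≤ (p : ℝ) ^ (-σ) := by
  unfold E
  simp only [Nat.cast_zero, add_zero]
  apply norm_le_congr
  have : y - k * (p : ℚ_[p]) ^ σ - y = -(k * (p : ℚ_[p]) ^ σ) := by ring
  rw [this, norm_neg]; exact norm_term k σ

lemma E_congr {y y' : ℚ_[p]} {σ : ℤ} {L : ℕ} {k : ℤ} (h : ‖y - y'‖ ≤ (p : ℝ) ^ (-(σ + L))) :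
    E y σ L k ↔ E y' σ L k := by
  unfold E
  apply norm_le_congr
  convert h using 2; ring

lemma E.mono {y : ℚ_[p]} {σ : ℤ} {L L' : ℕ} {k : ℤ} (h : E y σ L k) (hL : L' ≤ L) : E y σ L' k := by
  unfold E at *
  refine h.trans (zpow_le'.2 (by omega))

lemma E.le {y : ℚ_[p]} {σ : ℤ} {L : ℕ} {k : ℤ} (h : E y σ L k) : ‖y‖ ≤ (p : ℝ) ^ (-σ) :=
  E_zero_iff.1 (h.mono (Nat.zero_le _))

lemma E_dvd {y : ℚ_[p]} {σ : ℤ} {L : ℕ} {k k' : ℤ} (h : (p ^ L : ℤ) ∣ k - k') :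
    E y σ L k ↔ E y σ L k' := by
  unfold E
  apply norm_le_congr
  have : y - k * (p : ℚ_[p]) ^ σ - (y - k' * (p : ℚ_[p]) ^ σ) =
    -(((k - k' : ℤ) : ℚ_[p]) * (p : ℚ_[p]) ^ σ) := by push_cast; ring
  rw [this, norm_neg]; exact (norm_term_le_iff _ _ _).2 h

lemma E.unique {y : ℚ_[p]} {σ : ℤ} {L : ℕ} {k k' : ℤ} (h : E y σ L k) (h' : E y σ L k') :
    (p ^ L : ℤ) ∣ k - k' := by
  rw [← norm_term_le_iff (k - k') σ L]
  have := norm_sub_le h' h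
  convert this using 2
  push_cast; ring

lemma E_scale {y : ℚ_[p]} {σ τ : ℤ} {L : ℕ} {k : ℤ} :
    E (y * (p : ℚ_[p]) ^ τ) (σ + τ) L k ↔ E y σ L k := by
  unfold E
  have : y * (p : ℚ_[p]) ^ τ - k * (p : ℚ_[p]) ^ (σ + τ) = (y - k * (p : ℚ_[p]) ^ σ) * (p : ℚ_[p]) ^ τ := by
    rw [zpow_add₀ pK_ne]; ring
  rw [this, norm_mul, norm_zpow_p, show (-(σ + τ + L) : ℤ) = -(σ + L) + -τ by ring, zpow_add']
  exact mul_le_mul_iff_left₀ (zpow_pos' _)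

lemma E_shift {y : ℚ_[p]} {σ : ℤ} {L i : ℕ} {k : ℤ} :
    E y σ (L + i) (k * p ^ i) ↔ E y (σ + i) L k := by
  unfold E
  rw [zpow_add₀ pK_ne]
  push_cast
  rw [show (-(σ + (L + i)) : ℤ) = -(σ + i + L) by ring, zpow_natCast,
    show (k : ℚ_[p]) * p ^ i * p ^ σ = k * (p ^ σ * p ^ i) by ring]

lemma E.norm_eq {y : ℚ_[p]} {σ : ℤ} {L : ℕ} {k : ℤ} (hL : 1 ≤ L) (hk : ¬ (p : ℤ) ∣ k)
    (h : E y σ L k) : ‖y‖ = (p : ℝ) ^ (-σ) := by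
  have h1 : ‖(k : ℚ_[p]) * (p : ℚ_[p]) ^ σ‖ = (p : ℝ) ^ (-σ) := by
    rw [norm_mul, norm_zpow_p, norm_int_eq_one hk, one_mul]
  rw [← h1]
  apply norm_eq_of_lt
  rw [h1]
  refine lt_of_le_of_lt h (zpow_lt'.2 (by omega))

lemma E_exists {y : ℚ_[p]} {σ : ℤ} (L : ℕ) (h : ‖y‖ ≤ (p : ℝ) ^ (-σ)) :
    ∃ k : ℕ, k < p ^ L ∧ E y σ L k := by
  have hu : ‖y * (p : ℚ_[p]) ^ (-σ)‖ ≤ 1 := by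
    rw [norm_mul, norm_zpow_p]
    calc _ ≤ (p : ℝ) ^ (-σ) * (p : ℝ) ^ (- -σ) := by
          gcongr
      _ = 1 := by rw [← zpow_add']; simp
  let u : ℤ_[p] := ⟨_, hu⟩
  refine ⟨u.appr L, PadicInt.appr_lt u L, ?_⟩
  have h2 := (PadicInt.norm_le_pow_iff_mem_span_pow _ _).2 (PadicInt.appr_spec L u)
  rw [← E_scale (τ := -σ), add_neg_cancel]
  unfold E
  rw [zpow_zero, mul_one, zero_add]
  rw [PadicInt.norm_def, PadicInt.coe_sub] at h2
  exact_mod_cast h2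

lemma E_exists_unit {y : ℚ_[p]} (hy : y ≠ 0) {L : ℕ} (hL : 1 ≤ L) :
    ∃ (σ : ℤ) (k : ℕ), k < p ^ L ∧ ¬ (p : ℤ) ∣ k ∧ E y σ L k := by
  obtain ⟨σ, hσ⟩ := exists_norm_eq hy
  obtain ⟨k, hk, hE⟩ := E_exists L hσ.le
  refine ⟨σ, k, hk, fun hd => ?_, hE⟩
  have h1 : E y σ 1 0 := (E_dvd (by simpa using hd)).1 (hE.mono hL)
  have h2 : ‖y‖ ≤ (p : ℝ) ^ (-(σ + 1)) := by simpa [E] using h1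
  rw [hσ, zpow_le'] at h2
  omega

lemma norm_mul_le' {x y : ℚ_[p]} {a b : ℤ} (hx : ‖x‖ ≤ (p : ℝ) ^ a) (hy : ‖y‖ ≤ (p : ℝ) ^ b) :
    ‖x * y‖ ≤ (p : ℝ) ^ (a + b) := by
  rw [norm_mul, zpow_add']
  exact mul_le_mul hx hy (norm_nonneg _) (zpow_pos' _).le

lemma E.add {y y' : ℚ_[p]} {σ : ℤ} {L : ℕ} {k k' : ℤ} (h : E y σ L k) (h' : E y' σ L k') :
    E (y + y') σ L (k + k') := by
  have := norm_add_le h h'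
  unfold E; convert this using 2; push_cast; ring

lemma E.neg {y : ℚ_[p]} {σ : ℤ} {L : ℕ} {k : ℤ} (h : E y σ L k) : E (-y) σ L (-k) := by
  unfold E at *
  rw [show -y - ((-k : ℤ) : ℚ_[p]) * (p : ℚ_[p]) ^ σ = -(y - k * (p : ℚ_[p]) ^ σ) by
    push_cast; ring, norm_neg]
  exact h

lemma E_neg_iff {y : ℚ_[p]} {σ : ℤ} {L : ℕ} {k : ℤ} : E (-y) σ L (-k) ↔ E y σ L k :=
  ⟨fun h => by simpa using h.neg, E.neg⟩

lemma E.mul {y y' : ℚ_[p]} {σ σ' : ℤ} {L : ℕ} {k k' : ℤ} (h : E y σ L k) (h' : E y' σ' L k') :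
    E (y * y') (σ + σ') L (k * k') := by
  have h1 := norm_mul_le' h h'.le
  have h2 := norm_mul_le' (norm_term (p := p) k σ) h'
  rw [show -(σ + (L:ℤ)) + -σ' = -(σ + σ' + L) by ring] at h1
  rw [show -σ + -(σ' + (L:ℤ)) = -(σ + σ' + L) by ring] at h2
  have := norm_add_le h1 h2
  unfold E; convert this using 2; push_cast; rw [zpow_add₀ pK_ne]; ring

lemma E_mul_unit {y y' : ℚ_[p]} {z w : ℤ} {L L' : ℕ} {k a : ℤ} (hL : L ≤ L') (hL' : 1 ≤ L')
    (ha : ¬ (p : ℤ) ∣ a) (h : E y' w L' a) : E (y * y') (z + w) L (k * a) ↔ E y z L k := by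
  have hn := h.norm_eq hL' ha
  have h1 : ‖y * y' - (k * a : ℤ) * (p : ℚ_[p]) ^ (z + w) - (y - k * (p : ℚ_[p]) ^ z) * y'‖
      ≤ (p : ℝ) ^ (-(z + w + L)) := by
    have h2 := norm_mul_le' (norm_term (p := p) k z) (h.mono hL)
    rw [show -z + -(w + (L:ℤ)) = -(z + w + L) by ring] at h2
    convert h2 using 2; push_cast; rw [zpow_add₀ pK_ne]; ring
  unfold E
  rw [norm_le_congr h1, norm_mul, hn, show -(z + w + (L : ℤ)) = -(z + L) + -w by ring, zpow_add']
  exact mul_le_mul_iff_left₀ (zpow_pos' _)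

lemma E_close {y y' : ℚ_[p]} {N L : ℕ} {z k : ℤ} (hN : 1 ≤ N) (hL : L ≤ N)
    (h : ‖y - y'‖ ≤ (p : ℝ) ^ (-(N : ℤ)) * ‖y'‖) : E y z L k ↔ E y' z L k := by
  by_cases hy' : y' = 0
  · subst hy'
    have : y = 0 := by simpa using h
    rw [this]
  obtain ⟨σ, hσ⟩ := exists_norm_eq hy'
  rw [hσ, ← zpow_add'] at h
  have hn : ‖y‖ = ‖y'‖ := by
    apply norm_eq_of_lt
    rw [hσ]; exact h.trans_lt (zpow_lt'.2 (by omega))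
  by_cases hz : z ≤ σ
  · exact E_congr (h.trans (zpow_le'.2 (by omega)))
  · constructor
    · intro h2; exfalso
      have := h2.le; rw [hn, hσ, zpow_le'] at this; omega
    · intro h2; exfalso
      have := h2.le; rw [hσ, zpow_le'] at this; omega

lemma E_zero_left {σ k : ℤ} {L : ℕ} : E (0 : ℚ_[p]) σ L k ↔ (p ^ L : ℤ) ∣ k := by
  unfold E
  rw [zero_sub, norm_neg, norm_term_le_iff]

lemma E_zero_right {y : ℚ_[p]} {σ : ℤ} {L : ℕ} : E y σ L 0 ↔ ‖y‖ ≤ (p : ℝ) ^ (-(σ + L)) := by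
  simp [E]

/-- `y` is zero iff it is divisible by all powers. -/
lemma eq_zero_iff_E {y : ℚ_[p]} : y = 0 ↔ ∀ σ : ℤ, E y σ 0 0 := by
  constructor
  · rintro rfl σ; simp [E_zero_left]
  · intro h
    by_contra hy
    obtain ⟨σ, hσ⟩ := exists_norm_eq hy
    have := (h (σ + 1)).le
    rw [hσ, zpow_le'] at this
    omega

end PIg

namespace PIg
open Set

variable {p : ℕ} [hp : Fact p.Prime]

/-- Affine-linear integer terms generated by `𝓛`. -/
def Lin {Γ : Type} (𝓛 : Set (Γ → ℤ)) (ℓ : Γ → ℤ) : Prop :=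
  ℓ ∈ AddSubgroup.closure (insert 1 𝓛)

/-- Add one more integer variable to the context. -/
def lift {Γ : Type} (𝓛 : Set (Γ → ℤ)) : Set (Γ × ℤ → ℤ) :=
  insert Prod.snd ((fun ℓ : Γ → ℤ => ℓ ∘ Prod.fst) '' 𝓛)

namespace Lin
variable {Γ Δ : Type} {𝓛 : Set (Γ → ℤ)} {ℓ ℓ' : Γ → ℤ}

lemma of_mem (h : ℓ ∈ 𝓛) : Lin 𝓛 ℓ := AddSubgroup.subset_closure (mem_insert_of_mem _ h)
lemma const (c : ℤ) : Lin 𝓛 (fun _ => c) := by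
  have h1 : (1 : Γ → ℤ) ∈ AddSubgroup.closure (insert 1 𝓛) :=
    AddSubgroup.subset_closure (mem_insert _ _)
  have := AddSubgroup.zsmul_mem _ h1 c
  have h2 : c • (1 : Γ → ℤ) = fun _ => c := by ext; simp
  rwa [h2] at this
lemma add (h : Lin 𝓛 ℓ) (h' : Lin 𝓛 ℓ') : Lin 𝓛 (fun g => ℓ g + ℓ' g) :=
  AddSubgroup.add_mem _ h h'
lemma sub (h : Lin 𝓛 ℓ) (h' : Lin 𝓛 ℓ') : Lin 𝓛 (fun g => ℓ g - ℓ' g) :=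
  AddSubgroup.sub_mem _ h h'
lemma neg (h : Lin 𝓛 ℓ) : Lin 𝓛 (fun g => - ℓ g) :=
  AddSubgroup.neg_mem _ h
lemma cmul (c : ℤ) (h : Lin 𝓛 ℓ) : Lin 𝓛 (fun g => c * ℓ g) := by
  have := AddSubgroup.zsmul_mem _ h c
  have h2 : c • ℓ = fun g => c * ℓ g := by ext; simp
  rwa [h2] at this

lemma comap {𝓛' : Set (Δ → ℤ)} {φ : Δ → Γ} (hφ : ∀ ℓ ∈ 𝓛, Lin 𝓛' (ℓ ∘ φ)) (h : Lin 𝓛 ℓ) :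
    Lin 𝓛' (fun d => ℓ (φ d)) := by
  unfold Lin at h
  induction h using AddSubgroup.closure_induction with
  | mem x hx =>
    rcases hx with rfl | hx
    · exact const 1
    · exact hφ _ hx
  | zero => exact const 0
  | add x y _ _ hx hy => exact hx.add hy
  | neg x _ hx => exact hx.neg

lemma snd : Lin (lift 𝓛) (fun q : Γ × ℤ => q.2) := of_mem (mem_insert _ _)
lemma fst (h : Lin 𝓛 ℓ) : Lin (lift 𝓛) (fun q : Γ × ℤ => ℓ q.1) :=
  h.comap (φ := Prod.fst) fun ℓ hℓ => of_mem (mem_insert_of_mem _ ⟨ℓ, hℓ, rfl⟩)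

lemma lift_comap {𝓛' : Set (Δ → ℤ)} {φ : Δ → Γ} (hφ : ∀ ℓ ∈ 𝓛, Lin 𝓛' (ℓ ∘ φ)) :
    ∀ ℓ ∈ lift 𝓛, Lin (lift 𝓛') (ℓ ∘ fun q : Δ × ℤ => (φ q.1, q.2)) := by
  rintro ℓ (rfl | ⟨ℓ, hℓ, rfl⟩)
  · exact snd
  · exact (hφ ℓ hℓ).fst

/-- comap into a lifted context -/
lemma into_lift {𝓛' : Set (Δ → ℤ)} {φ : Δ → Γ} {m : Δ → ℤ} (hφ : ∀ ℓ ∈ 𝓛, Lin 𝓛' (ℓ ∘ φ))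
    (hm : Lin 𝓛' m) :
    ∀ ℓ ∈ lift 𝓛, Lin 𝓛' (ℓ ∘ fun d : Δ => (φ d, m d)) := by
  rintro ℓ (rfl | ⟨ℓ, hℓ, rfl⟩)
  · exact hm
  · exact hφ ℓ hℓ
end Lin

/-- Tame predicates. -/
inductive Tame {X : Type} (𝓡 : Set (X → ℚ_[p])) :
    ∀ {Γ : Type}, (Γ → X) → Set (Γ → ℤ) → (Γ → Prop) → Prop
  | le0 {Γ : Type} {ρ : Γ → X} {𝓛 : Set (Γ → ℤ)} {ℓ : Γ → ℤ} (h : Lin 𝓛 ℓ) :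
      Tame 𝓡 ρ 𝓛 (fun g => 0 ≤ ℓ g)
  | atom {Γ : Type} {ρ : Γ → X} {𝓛 : Set (Γ → ℤ)} {r : X → ℚ_[p]} {ℓ : Γ → ℤ} (L : ℕ) (k : ℤ)
      (hr : r ∈ 𝓡) (h : Lin 𝓛 ℓ) : Tame 𝓡 ρ 𝓛 (fun g => E (r (ρ g)) (ℓ g) L k)
  | not {Γ : Type} {ρ : Γ → X} {𝓛 : Set (Γ → ℤ)} {R : Γ → Prop} (h : Tame 𝓡 ρ 𝓛 R) :
      Tame 𝓡 ρ 𝓛 (fun g => ¬ R g)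
  | and {Γ : Type} {ρ : Γ → X} {𝓛 : Set (Γ → ℤ)} {R R' : Γ → Prop} (h : Tame 𝓡 ρ 𝓛 R)
      (h' : Tame 𝓡 ρ 𝓛 R') : Tame 𝓡 ρ 𝓛 (fun g => R g ∧ R' g)
  | ex {Γ : Type} {ρ : Γ → X} {𝓛 : Set (Γ → ℤ)} {R : Γ → ℤ → Prop}
      (h : Tame 𝓡 (fun q : Γ × ℤ => ρ q.1) (lift 𝓛) (fun q => R q.1 q.2)) :
      Tame 𝓡 ρ 𝓛 (fun g => ∃ z, R g z)

namespace Tame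
variable {X X' : Type} {𝓡 : Set (X → ℚ_[p])} {𝓡' : Set (X' → ℚ_[p])}
  {Γ Δ : Type} {ρ : Γ → X} {𝓛 : Set (Γ → ℤ)}
  {R R' : Γ → Prop} {ℓ ℓ' : Γ → ℤ}

lemma congr (h : Tame 𝓡 ρ 𝓛 R) (hR : ∀ g, R' g ↔ R g) : Tame 𝓡 ρ 𝓛 R' := by
  have : R' = R := funext fun g => propext (hR g)
  rwa [this]

lemma or (h : Tame 𝓡 ρ 𝓛 R) (h' : Tame 𝓡 ρ 𝓛 R') : Tame 𝓡 ρ 𝓛 (fun g => R g ∨ R' g) :=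
  (h.not.and h'.not).not.congr fun g => by tauto
lemma imp (h : Tame 𝓡 ρ 𝓛 R) (h' : Tame 𝓡 ρ 𝓛 R') : Tame 𝓡 ρ 𝓛 (fun g => R g → R' g) :=
  (h.and h'.not).not.congr fun g => by tauto
lemma iff (h : Tame 𝓡 ρ 𝓛 R) (h' : Tame 𝓡 ρ 𝓛 R') : Tame 𝓡 ρ 𝓛 (fun g => R g ↔ R' g) :=
  ((h.imp h').and (h'.imp h)).congr fun g => by tauto
lemma all {R : Γ → ℤ → Prop}
    (h : Tame 𝓡 (fun q : Γ × ℤ => ρ q.1) (lift 𝓛) (fun q => R q.1 q.2)) :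
    Tame 𝓡 ρ 𝓛 (fun g => ∀ z, R g z) :=
  (ex (R := fun g z => ¬ R g z) h.not).not.congr fun g => by simp
lemma le (h : Lin 𝓛 ℓ) (h' : Lin 𝓛 ℓ') : Tame 𝓡 ρ 𝓛 (fun g => ℓ g ≤ ℓ' g) :=
  (le0 (h'.sub h)).congr fun g => by omega
lemma lt (h : Lin 𝓛 ℓ) (h' : Lin 𝓛 ℓ') : Tame 𝓡 ρ 𝓛 (fun g => ℓ g < ℓ' g) :=
  (le h' h).not.congr fun g => by omega
lemma eq (h : Lin 𝓛 ℓ) (h' : Lin 𝓛 ℓ') : Tame 𝓡 ρ 𝓛 (fun g => ℓ g = ℓ' g) :=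
  ((le h h').and (le h' h)).congr fun g => by omega
lemma triv : Tame 𝓡 ρ 𝓛 (fun _ => True) := (le (Lin.const 0) (Lin.const 0)).congr fun g => by simp
lemma const (P : Prop) : Tame 𝓡 ρ 𝓛 (fun _ => P) := by
  by_cases hP : P
  · exact triv.congr fun g => by simp [hP]
  · exact triv.not.congr fun g => by simp [hP]

lemma bex {ι : Type*} (s : Finset ι) {R : ι → Γ → Prop} (h : ∀ i ∈ s, Tame 𝓡 ρ 𝓛 (R i)) :
    Tame 𝓡 ρ 𝓛 (fun g => ∃ i ∈ s, R i g) := by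
  classical
  induction s using Finset.induction_on with
  | empty => exact (const False).congr fun g => by simp
  | insert a s ha ih =>
    exact ((h a (by simp)).or (ih fun i hi => h i (by simp [hi]))).congr fun g => by simp
lemma ball {ι : Type*} (s : Finset ι) {R : ι → Γ → Prop} (h : ∀ i ∈ s, Tame 𝓡 ρ 𝓛 (R i)) :
    Tame 𝓡 ρ 𝓛 (fun g => ∀ i ∈ s, R i g) :=
  (bex s (R := fun i g => ¬ R i g) fun i hi => (h i hi).not).not.congr fun g => by simp
lemma exf {ι : Type*} [Finite ι] {R : ι → Γ → Prop} (h : ∀ i, Tame 𝓡 ρ 𝓛 (R i)) :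
    Tame 𝓡 ρ 𝓛 (fun g => ∃ i, R i g) := by
  have := Fintype.ofFinite ι
  exact (bex Finset.univ (R := R) fun i _ => h i).congr fun g => by simp
lemma allf {ι : Type*} [Finite ι] {R : ι → Γ → Prop} (h : ∀ i, Tame 𝓡 ρ 𝓛 (R i)) :
    Tame 𝓡 ρ 𝓛 (fun g => ∀ i, R i g) := by
  have := Fintype.ofFinite ι
  exact (ball Finset.univ (R := R) fun i _ => h i).congr fun g => by simp

/-- finite-case definitions -/
lemma cover {ι : Type*} [Finite ι] {S R : ι → Γ → Prop} {R₀ : Γ → Prop}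
    (hS : ∀ i, Tame 𝓡 ρ 𝓛 (S i)) (hR : ∀ i, Tame 𝓡 ρ 𝓛 (R i))
    (hc : ∀ g, ∃ i, S i g) (he : ∀ i g, S i g → (R₀ g ↔ R i g)) : Tame 𝓡 ρ 𝓛 R₀ := by
  refine (exf (R := fun i g => S i g ∧ R i g) fun i => (hS i).and (hR i)).congr fun g => ?_
  constructor
  · intro h; obtain ⟨i, hi⟩ := hc g; exact ⟨i, hi, (he i g hi).1 h⟩
  · rintro ⟨i, hi, h⟩; exact (he i g hi).2 h

lemma comap (h : Tame 𝓡 ρ 𝓛 R) {𝓛' : Set (Δ → ℤ)} (φ : Δ → Γ)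
    (hφ : ∀ ℓ ∈ 𝓛, Lin 𝓛' (ℓ ∘ φ)) : Tame 𝓡 (fun d => ρ (φ d)) 𝓛' (fun d => R (φ d)) := by
  induction h generalizing Δ with
  | le0 h => exact le0 (h.comap hφ)
  | atom L k hr h => exact atom L k hr (h.comap hφ)
  | not h ih => exact (ih φ hφ).not
  | and h h' ih ih' => exact (ih φ hφ).and (ih' φ hφ)
  | ex h ih => exact ex (ih (fun q : Δ × ℤ => (φ q.1, q.2)) (Lin.lift_comap hφ))

lemma subst {ρ' : Γ → X'} (h : Tame 𝓡' ρ' 𝓛 R)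
    (H : ∀ r ∈ 𝓡', ∀ L k, Tame 𝓡 (fun q : Γ × ℤ => ρ q.1) (lift 𝓛)
      (fun q => E (r (ρ' q.1)) q.2 L k)) : Tame 𝓡 ρ 𝓛 R := by
  induction h with
  | le0 h => exact le0 h
  | atom L k hr h =>
    exact (H _ hr L k).comap (fun g => (g, _)) (Lin.into_lift (φ := fun g => g)
      (fun ℓ hℓ => Lin.of_mem hℓ) h)
  | not h ih => exact (ih H).not
  | and h h' ih ih' => exact (ih H).and (ih' H)
  | @ex Γ ρ' 𝓛 R h ih =>
    refine ex (ih fun r hr L k => ?_)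
    refine (H r hr L k).comap (fun q : (Γ × ℤ) × ℤ => (q.1.1, q.2)) (Lin.into_lift ?_ Lin.snd)
    intro ℓ hℓ
    exact (Lin.of_mem hℓ).fst.fst

lemma mono {𝓡₂ : Set (X → ℚ_[p])} (h : Tame 𝓡 ρ 𝓛 R) (hs : 𝓡 ⊆ 𝓡₂) : Tame 𝓡₂ ρ 𝓛 R :=
  h.subst fun _ hr L k => atom L k (hs hr) Lin.snd

end Tame

end PIg

namespace PIg
open Set

variable {p : ℕ} [hp : Fact p.Prime]
set_option linter.unusedVariables false

lemma Lin.var {X : Type} : Lin {fun d : X × ℤ => d.2} (fun d : X × ℤ => d.2) :=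
  Lin.of_mem (mem_singleton _)

/-- Functions whose `E`-predicates are tame. -/
def Good {X : Type} (𝓡 : Set (X → ℚ_[p])) (r : X → ℚ_[p]) : Prop :=
  ∀ L k, Tame 𝓡 (fun d : X × ℤ => d.1) {fun d => d.2} (fun d => E (r d.1) d.2 L k)

section
variable {X X' : Type} {𝓡 : Set (X → ℚ_[p])} 
  {Γ Δ : Type} {ρ : Γ → X} {𝓛 : Set (Γ → ℤ)} {R R' : Γ → Prop} {ℓ ℓ' : Γ → ℤ}
  {r r' : X → ℚ_[p]}

lemma Good.tame (h : Good 𝓡 r) (hl : Lin 𝓛 ℓ) (L : ℕ) (k : ℤ) :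
    Tame 𝓡 ρ 𝓛 (fun g => E (r (ρ g)) (ℓ g) L k) :=
  (h L k).comap (fun g => (ρ g, ℓ g)) (by rintro _ rfl; exact hl)

lemma Good.of_mem (h : r ∈ 𝓡) : Good 𝓡 r := fun L k => Tame.atom L k h (Lin.of_mem rfl)

lemma Good.tame_le (h : Good 𝓡 r) (hl : Lin 𝓛 ℓ) :
    Tame 𝓡 ρ 𝓛 (fun g => ‖r (ρ g)‖ ≤ (p : ℝ) ^ (-(ℓ g))) :=
  (h.tame hl 0 0).congr fun g => by rw [E_zero_iff]

lemma norm_eq_iff {y : ℚ_[p]} {n : ℤ} :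
    ‖y‖ = (p : ℝ) ^ (-n) ↔ ‖y‖ ≤ (p : ℝ) ^ (-n) ∧ ¬ ‖y‖ ≤ (p : ℝ) ^ (-(n + 1)) := by
  rw [norm_le_iff_lt, not_lt, le_antisymm_iff]

lemma Good.tame_eq (h : Good 𝓡 r) (hl : Lin 𝓛 ℓ) :
    Tame 𝓡 ρ 𝓛 (fun g => ‖r (ρ g)‖ = (p : ℝ) ^ (-(ℓ g))) :=
  ((h.tame_le hl).and (h.tame_le (hl.add (Lin.const 1))).not).congr fun g => norm_eq_iff

lemma Good.tame_zero (h : Good 𝓡 r) : Tame 𝓡 ρ 𝓛 (fun g => r (ρ g) = 0) :=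
  (Tame.all (R := fun g z => E (r (ρ g)) z 0 0) (h.tame (ρ := fun q : Γ × ℤ => ρ q.1) Lin.snd 0 0)).congr
    fun g => eq_zero_iff_E

lemma Tame.trans {𝓡₂ : Set (X → ℚ_[p])} (h : Tame 𝓡₂ ρ 𝓛 R) (hs : ∀ r ∈ 𝓡₂, Good 𝓡 r) :
    Tame 𝓡 ρ 𝓛 R :=
  h.subst fun r hr L k => (hs r hr).tame (ρ := fun q : Γ × ℤ => ρ q.1) Lin.snd L k

lemma Good.trans {𝓡₂ : Set (X → ℚ_[p])} (h : Good 𝓡₂ r) (hs : ∀ r ∈ 𝓡₂, Good 𝓡 r) :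
    Good 𝓡 r := fun L k => (h L k).trans hs

lemma Tame.ite {P : Γ → Prop} (hP : Tame 𝓡 ρ 𝓛 P) (h : Tame 𝓡 ρ 𝓛 R) (h' : Tame 𝓡 ρ 𝓛 R')
    {R₀ : Γ → Prop} (h1 : ∀ g, P g → (R₀ g ↔ R g)) (h2 : ∀ g, ¬ P g → (R₀ g ↔ R' g)) :
    Tame 𝓡 ρ 𝓛 R₀ := by
  refine ((hP.and h).or (hP.not.and h')).congr fun g => ?_
  by_cases hg : P g
  · simp [hg, h1 g hg]
  · simp [hg, h2 g hg]

lemma Tame.base {P : X → Prop} (hP : Tame 𝓡 (fun x => x) ∅ P) : Tame 𝓡 ρ 𝓛 (fun g => P (ρ g)) :=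
  hP.comap ρ (by simp)

lemma Good.ite {P : X → Prop} (hP : Tame 𝓡 (fun x => x) ∅ P) (h : Good 𝓡 r) (h' : Good 𝓡 r')
    {r₀ : X → ℚ_[p]} (h1 : ∀ x, P x → r₀ x = r x) (h2 : ∀ x, ¬ P x → r₀ x = r' x) :
    Good 𝓡 r₀ := fun L k =>
  Tame.ite (hP.base (ρ := fun d : X × ℤ => d.1)) (h L k) (h' L k)
    (fun g hg => by rw [h1 _ hg]) (fun g hg => by rw [h2 _ hg])

lemma Good.div (h : Good 𝓡 r) (h' : Good 𝓡 r') : Good 𝓡 (fun x => r x / r' x) := by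
  intro L k
  refine Tame.ite (h'.tame_zero (ρ := fun d : X × ℤ => d.1)) (Tame.const ((p ^ L : ℤ) ∣ k))
    (R' := fun d => ∃ w : ℤ, ∃ a ∈ (Finset.range (p ^ (L + 1))).filter (fun a : ℕ => ¬ (p : ℤ) ∣ a),
      E (r' d.1) w (L + 1) a ∧ E (r d.1) (d.2 + w) L (k * a)) ?_ ?_ ?_
  · refine Tame.ex (Tame.bex _ fun a _ => (h'.tame (ρ := fun d : (X × ℤ) × ℤ => d.1.1) Lin.snd _ _).and
      (h.tame (ρ := fun d : (X × ℤ) × ℤ => d.1.1) (Lin.add Lin.var.fst Lin.snd) L _))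
  · intro g hg
    beta_reduce
    rw [show r' g.1 = 0 from hg, div_zero, E_zero_left]
  · intro g hg
    constructor
    · intro hE
      obtain ⟨w, a, ha, hpa, hw⟩ := E_exists_unit hg (L := L + 1) (by omega)
      refine ⟨w, a, by simp [ha, hpa], hw, ?_⟩
      have := (E_mul_unit (y := r g.1 / r' g.1) (z := g.2) (k := k) (L := L) (by omega) (by omega) hpa hw).2 hE
      rwa [div_mul_cancel₀ _ hg] at this
    · rintro ⟨w, a, ha, hw, hE⟩
      have hpa : ¬ (p : ℤ) ∣ a := (Finset.mem_filter.1 ha).2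
      rw [← E_mul_unit (by omega : L ≤ L + 1) (by omega) hpa hw, div_mul_cancel₀ _ hg]
      exact hE

end

/-- the evaluation of coefficients at a point -/
noncomputable def evx {X : Type} {𝓡 : Subring (X → ℚ_[p])} (x : X) : 𝓡 →+* ℚ_[p] :=
  (Pi.evalRingHom _ x).comp 𝓡.subtype

/-- Specialisation of a polynomial with coefficients in `𝓡`. -/
noncomputable def sp {X : Type} {𝓡 : Subring (X → ℚ_[p])} (q : Polynomial 𝓡) (x : X) : Polynomial ℚ_[p] :=
  q.map (evx x)

lemma sp_coeff {X : Type} {𝓡 : Subring (X → ℚ_[p])} (q : Polynomial 𝓡) (x : X) (i : ℕ) :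
    (sp q x).coeff i = (q.coeff i : X → ℚ_[p]) x := by
  simp [sp, evx]

lemma aeval_apply {X : Type} {𝓡 : Subring (X → ℚ_[p])} (q : Polynomial 𝓡) (c : X → ℚ_[p]) (x : X) :
    (Polynomial.aeval c q : X → ℚ_[p]) x = (sp q x).eval (c x) := by
  have : (Polynomial.aeval c q : X → ℚ_[p]) x = (Pi.evalRingHom (fun _ : X => ℚ_[p]) x) (Polynomial.aeval c q) := rfl
  rw [this, Polynomial.aeval_def, Polynomial.hom_eval₂, sp, Polynomial.eval_map]
  rfl

/-- Closed rings of functions. -/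
def Closed {X : Type} (𝓡 : Subring (X → ℚ_[p])) : Prop :=
  ∀ c : X → ℚ_[p], (∀ q : Polynomial 𝓡, Good (𝓡 : Set (X → ℚ_[p])) (fun x => (sp q x).eval (c x))) → c ∈ 𝓡

theorem exists_closed {X : Type} (𝓡₀ : Subring (X → ℚ_[p])) :
    ∃ 𝓡 : Subring (X → ℚ_[p]), 𝓡₀ ≤ 𝓡 ∧ Closed 𝓡 ∧ ∀ r ∈ 𝓡, Good (𝓡₀ : Set (X → ℚ_[p])) r := by
  let 𝓢 : Set (Subring (X → ℚ_[p])) :=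
    {S | 𝓡₀ ≤ S ∧ ∀ r ∈ S, Good (𝓡₀ : Set (X → ℚ_[p])) r}
  obtain ⟨M, h0M, hM⟩ := zorn_le_nonempty₀ 𝓢 (by
    intro c hc hch y hy
    refine ⟨sSup c, ⟨(hc hy).1.trans (le_sSup hy), ?_⟩, fun z hz => le_sSup hz⟩
    intro r hr
    rw [Subring.mem_sSup_of_directedOn ⟨y, hy⟩ hch.directedOn] at hr
    obtain ⟨s, hs, hrs⟩ := hr
    exact (hc hs).2 r hrs) 𝓡₀ ⟨le_rfl, fun r hr => Good.of_mem hr⟩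
  refine ⟨M, h0M, ?_, hM.prop.2⟩
  intro c hc
  have hS : (Algebra.adjoin M {c}).toSubring ∈ 𝓢 := by
    constructor
    · intro r hr
      exact (Algebra.adjoin M {c}).algebraMap_mem ⟨r, h0M hr⟩
    · intro r hr
      have hr' : r ∈ Algebra.adjoin M {c} := hr
      rw [Algebra.adjoin_singleton_eq_range_aeval] at hr'
      obtain ⟨q, rfl⟩ := hr'
      have := (hc q).trans hM.prop.2
      convert this using 1
      ext x
      exact aeval_apply q c x
  have hle := hM.le_of_ge hS (fun r hr => (Algebra.adjoin M {c}).algebraMap_mem ⟨r, hr⟩)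
  exact hle (Algebra.self_mem_adjoin_singleton M c)

section
variable {X : Type} {𝓡 : Subring (X → ℚ_[p])}

lemma good_eval (q : Polynomial 𝓡) {c : X → ℚ_[p]} (hc : c ∈ 𝓡) :
    (fun x => (sp q x).eval (c x)) ∈ 𝓡 := by
  have : (fun x => (sp q x).eval (c x)) = ((q.eval ⟨c, hc⟩ : 𝓡) : X → ℚ_[p]) := by
    ext x
    have h1 : ((q.eval ⟨c, hc⟩ : 𝓡) : X → ℚ_[p]) x = evx x (q.eval ⟨c, hc⟩) := rfl
    rw [h1, ← Polynomial.eval₂_at_apply, sp, Polynomial.eval_map]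
    rfl
  rw [this]; exact Subtype.prop _

lemma Closed.ite (h𝓡 : Closed 𝓡) {P : X → Prop} (hP : Tame (𝓡 : Set (X → ℚ_[p])) (fun x => x) ∅ P)
    {r r' r₀ : X → ℚ_[p]} (h : r ∈ 𝓡) (h' : r' ∈ 𝓡)
    (h1 : ∀ x, P x → r₀ x = r x) (h2 : ∀ x, ¬ P x → r₀ x = r' x) : r₀ ∈ 𝓡 := by
  refine h𝓡 _ fun q => Good.ite hP (Good.of_mem (good_eval q h)) (Good.of_mem (good_eval q h')) ?_ ?_
  · intro x hx; rw [h1 x hx]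
  · intro x hx; rw [h2 x hx]

lemma Closed.inv (h𝓡 : Closed 𝓡) {r : X → ℚ_[p]} (h : r ∈ 𝓡) : (fun x => (r x)⁻¹) ∈ 𝓡 := by
  refine h𝓡 _ fun q => ?_
  refine Good.ite (P := fun x => r x = 0) (r := q.coeff 0)
    (r' := fun x => (sp q.reverse x).eval (r x) / r x ^ q.natDegree)
    ((Good.of_mem h).tame_zero (ρ := fun x => x)) (Good.of_mem (q.coeff 0).2) ?_ ?_ ?_
  · refine Good.div (Good.of_mem (good_eval _ h)) (Good.of_mem (r := fun x => r x ^ q.natDegree) ?_)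
    exact Subring.pow_mem _ h _
  · intro x hx
    have hx' : r x = 0 := hx
    rw [hx', inv_zero, ← Polynomial.coeff_zero_eq_eval_zero, sp_coeff]
  · intro x hx
    have hx' : r x ≠ 0 := hx
    let _ := invertibleOfNonzero (inv_ne_zero hx')
    have := Polynomial.eval₂_reverse_mul_pow (evx x) ((r x)⁻¹) q
    rw [sp, sp, Polynomial.eval_map, Polynomial.eval_map, ← this]
    rw [eq_div_iff (pow_ne_zero _ hx')]
    rw [mul_assoc, ← mul_pow, inv_mul_cancel₀ hx', one_pow, mul_one]
    simp

end
end PIg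

namespace PIg
open Set

variable {p : ℕ} [hp : Fact p.Prime]
set_option linter.unusedVariables false

/-- right-hand side of the comparison lemma -/
def E3 (e : ℚ_[p]) (γ : ℤ) (a : ℤ) (m : ℕ) (z : ℤ) (L : ℕ) (k : ℤ) : Prop :=
  (z + L ≤ γ ∧ E e z L (-k)) ∨
  (∃ i ∈ Finset.range L, γ = z + (i : ℕ) ∧ E e z L (a * p ^ i - k)) ∨
  (∃ i ∈ Finset.range (m + 1), z = γ + (i : ℕ) ∧ E e γ (L + i) (a - k * p ^ i))

lemma E_sub_iff {y e : ℚ_[p]} {γ a z k : ℤ} {M L m : ℕ} (h : E y γ M a) (hM : L + m ≤ M)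
    (hz : z ≤ γ + m) : E (y - e) z L k ↔ E3 e γ a m z L k := by
  have key1 : z + L ≤ γ → (E (y - e) z L k ↔ E e z L (-k)) := by
    intro hzl
    rw [← E_neg_iff (y := e), neg_neg]
    apply E_congr
    rw [sub_neg_eq_add, sub_add_cancel]
    exact h.le.trans (zpow_le'.2 (by omega))
  have key2 : ∀ i : ℕ, γ = z + i → (E (y - e) z L k ↔ E e z L (a * p ^ i - k)) := by
    intro i hi
    have h1 : E (y - e) z L k ↔ E ((a : ℚ_[p]) * (p : ℚ_[p]) ^ γ - e) z L k := by
      apply E_congr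
      rw [sub_sub_sub_cancel_right]
      refine le_trans h (zpow_le'.2 (by omega))
    rw [h1, ← E_neg_iff (y := e)]
    unfold E
    rw [hi, zpow_add₀ pK_ne]
    apply iff_of_eq; congr 2
    push_cast [zpow_natCast]; ring
  have key3 : ∀ i : ℕ, i ≤ m → z = γ + i → (E (y - e) z L k ↔ E e γ (L + i) (a - k * p ^ i)) := by
    intro i him hi
    rw [hi, ← E_shift]
    have h1 : E (y - e) γ (L + i) (k * p ^ i) ↔ E ((a : ℚ_[p]) * (p : ℚ_[p]) ^ γ - e) γ (L + i) (k * p ^ i) := by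
      apply E_congr
      rw [sub_sub_sub_cancel_right]
      refine le_trans h (zpow_le'.2 (by omega))
    rw [h1, ← E_neg_iff (y := e)]
    unfold E
    apply iff_of_eq; congr 2
    push_cast; ring
  unfold E3
  constructor
  · intro hE
    by_cases c1 : z + L ≤ γ
    · exact Or.inl ⟨c1, (key1 c1).1 hE⟩
    by_cases c2 : z ≤ γ
    · obtain ⟨i, hi⟩ := Int.le.dest c2
      exact Or.inr (Or.inl ⟨i, Finset.mem_range.2 (by omega), hi.symm, (key2 i hi.symm).1 hE⟩)
    · obtain ⟨i, hi⟩ := Int.le.dest (le_of_not_ge c2)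
      exact Or.inr (Or.inr ⟨i, Finset.mem_range.2 (by omega), hi.symm, (key3 i (by omega) hi.symm).1 hE⟩)
  · rintro (⟨h1, h2⟩ | ⟨i, hi, h1, h2⟩ | ⟨i, hi, h1, h2⟩)
    · exact (key1 h1).2 h2
    · exact (key2 i h1).2 h2
    · exact (key3 i (by simpa [Nat.lt_succ_iff] using hi) h1).2 h2

lemma Good.tame_E3 {X Γ : Type} {𝓡 : Set (X → ℚ_[p])} {ρ : Γ → X} {𝓛 : Set (Γ → ℤ)}
    {r : X → ℚ_[p]} (h : Good 𝓡 r) {ℓ ℓ' : Γ → ℤ} (hl : Lin 𝓛 ℓ) (hl' : Lin 𝓛 ℓ')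
    (a : ℤ) (m : ℕ) (L : ℕ) (k : ℤ) :
    Tame 𝓡 ρ 𝓛 (fun g => E3 (r (ρ g)) (ℓ g) a m (ℓ' g) L k) := by
  unfold E3
  refine Tame.or (Tame.and (Tame.le (hl'.add (Lin.const _)) hl) (h.tame hl' _ _))
    (Tame.or (Tame.bex _ fun i _ => Tame.and (Tame.eq hl (hl'.add (Lin.const _))) (h.tame hl' _ _))
      (Tame.bex _ fun i _ => Tame.and (Tame.eq hl' (hl.add (Lin.const _))) (h.tame hl _ _)))

/-- The functions linear in the last variable. -/
def lin {X : Type} (𝓡 : Subring (X → ℚ_[p])) : Set (X × ℚ_[p] → ℚ_[p]) :=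
  {f | ∃ r ∈ 𝓡, f = fun q => r q.1} ∪ {f | ∃ c ∈ 𝓡, f = fun q => q.2 - c q.1}

theorem SCR {X Δ : Type} {𝓡 : Subring (X → ℚ_[p])} {ρ : Δ → X × ℚ_[p]} {𝓛 : Set (Δ → ℤ)}
    {R : Δ → Prop} (h : Tame (lin 𝓡) ρ 𝓛 R) :
    ∀ {Γ : Type} (σ : Γ → X) (𝓛' : Set (Γ → ℤ)) (φ : Γ → ℚ_[p] → Δ)
      (_ : ∀ g t, ρ (φ g t) = (σ g, t)) (_ : ∀ ℓ ∈ 𝓛, ∃ ℓ₀, Lin 𝓛' ℓ₀ ∧ ∀ g t, ℓ (φ g t) = ℓ₀ g),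
    ∃ C : Finset (X → ℚ_[p]), (∀ c ∈ C, c ∈ 𝓡) ∧ ∃ L₀ : ℕ, ∀ c ∈ 𝓡, ∀ L ≥ L₀, ∀ a : ℤ, ¬ (p : ℤ) ∣ a →
      ∃ S : Γ → ℤ → Prop, Tame (𝓡 : Set (X → ℚ_[p])) (fun q : Γ × ℤ => σ q.1) (lift 𝓛')
        (fun q => S q.1 q.2) ∧
        ∀ g γ t, E (t - c (σ g)) γ L a → (∀ c' ∈ C, ‖t - c (σ g)‖ ≤ ‖t - c' (σ g)‖) →
          (R (φ g t) ↔ S g γ) := by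
  classical
  have hLin : ∀ {Γ Δ : Type} {𝓛 : Set (Δ → ℤ)} {𝓛' : Set (Γ → ℤ)} {φ : Γ → ℚ_[p] → Δ}
      (_ : ∀ ℓ ∈ 𝓛, ∃ ℓ₀, Lin 𝓛' ℓ₀ ∧ ∀ g t, ℓ (φ g t) = ℓ₀ g) {ℓ} (_ : Lin 𝓛 ℓ),
      ∃ ℓ₀, Lin 𝓛' ℓ₀ ∧ ∀ g t, ℓ (φ g t) = ℓ₀ g := by
    intro Γ Δ 𝓛 𝓛' φ H ℓ h
    unfold Lin at h
    induction h using AddSubgroup.closure_induction with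
    | mem x hx =>
      rcases hx with rfl | hx
      · exact ⟨_, Lin.const 1, fun _ _ => rfl⟩
      · exact H _ hx
    | zero => exact ⟨_, Lin.const 0, fun _ _ => rfl⟩
    | add x y _ _ hx hy =>
      obtain ⟨x', hx', h1⟩ := hx
      obtain ⟨y', hy', h2⟩ := hy
      exact ⟨_, hx'.add hy', fun g t => by simp [h1, h2]⟩
    | neg x _ hx =>
      obtain ⟨x', hx', h1⟩ := hx
      exact ⟨_, hx'.neg, fun g t => by simp [h1]⟩
  induction h with
  | le0 h =>
    intro Γ σ 𝓛' φ hρ h𝓛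
    obtain ⟨ℓ₀, hl, he⟩ := hLin h𝓛 h
    refine ⟨∅, by simp, 0, fun c hc L hL a ha => ⟨fun g _ => 0 ≤ ℓ₀ g, Tame.le0 hl.fst, ?_⟩⟩
    intro g γ t _ _
    beta_reduce; rw [he]
  | @atom Δ ρ 𝓛 r ℓ L' k hr h =>
    intro Γ σ 𝓛' φ hρ h𝓛
    obtain ⟨ℓ₀, hl, he⟩ := hLin h𝓛 h
    rcases hr with ⟨r, hr, rfl⟩ | ⟨c', hc', rfl⟩
    · refine ⟨∅, by simp, 0, fun c hc L hL a ha => ⟨fun g _ => E (r (σ g)) (ℓ₀ g) L' k,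
        Tame.atom L' k hr hl.fst, ?_⟩⟩
      intro g γ t _ _
      beta_reduce; rw [he, hρ]
    · refine ⟨{c'}, by simpa using hc', L' + 1, fun c hc L hL a ha =>
        ⟨fun g γ => ℓ₀ g ≤ γ ∧ E3 ((c' - c) (σ g)) γ a 0 (ℓ₀ g) L' k,
          Tame.and (Tame.le hl.fst Lin.snd) ((Good.of_mem (Subring.sub_mem _ hc' hc)).tame_E3
            (ρ := fun q : Γ × ℤ => σ q.1) Lin.snd hl.fst a 0 L' k), ?_⟩⟩
      intro g γ t hE hC
      beta_reduce; rw [he, hρ]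
      have hn := hE.norm_eq (by omega) ha
      have hC' := hC c' (by simp)
      by_cases hz : ℓ₀ g ≤ γ
      · have h2 : t - c' (σ g) = (t - c (σ g)) - (c' - c) (σ g) := by simp
        simp only [hz, true_and]
        rw [h2]
        exact E_sub_iff hE (by omega) (by omega)
      · simp only [hz, false_and, iff_false]
        intro h3
        have := hC'.trans h3.le
        rw [hn, zpow_le'] at this
        omega
  | not h ih =>
    intro Γ σ 𝓛' φ hρ h𝓛
    obtain ⟨C, hC, L₀, H⟩ := ih σ 𝓛' φ hρ h𝓛
    refine ⟨C, hC, L₀, fun c hc L hL a ha => ?_⟩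
    obtain ⟨S, hS, HS⟩ := H c hc L hL a ha
    exact ⟨_, hS.not, fun g γ t h1 h2 => not_congr (HS g γ t h1 h2)⟩
  | and h h' ih ih' =>
    intro Γ σ 𝓛' φ hρ h𝓛
    obtain ⟨C, hC, L₀, H⟩ := ih σ 𝓛' φ hρ h𝓛
    obtain ⟨C', hC', L₀', H'⟩ := ih' σ 𝓛' φ hρ h𝓛
    refine ⟨C ∪ C', ?_, max L₀ L₀', fun c hc L hL a ha => ?_⟩
    · intro c hc
      rcases Finset.mem_union.1 hc with hc | hc
      · exact hC c hc
      · exact hC' c hc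
    obtain ⟨S, hS, HS⟩ := H c hc L (le_of_max_le_left hL) a ha
    obtain ⟨S', hS', HS'⟩ := H' c hc L (le_of_max_le_right hL) a ha
    refine ⟨_, hS.and hS', fun g γ t h1 h2 => and_congr (HS g γ t h1 fun c' hc' => h2 c' ?_)
      (HS' g γ t h1 fun c' hc' => h2 c' ?_)⟩
    · simp [hc']
    · simp [hc']
  | @ex Δ ρ 𝓛 R h ih =>
    intro Γ σ 𝓛' φ hρ h𝓛
    obtain ⟨C, hC, L₀, H⟩ := ih (Γ := Γ × ℤ) (fun q => σ q.1) (lift 𝓛') (fun q t => (φ q.1 t, q.2))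
      (fun q t => hρ q.1 t) (by
        rintro ℓ (rfl | ⟨ℓ, hℓ, rfl⟩)
        · exact ⟨_, Lin.snd, fun _ _ => rfl⟩
        · obtain ⟨ℓ₀, h1, h2⟩ := h𝓛 ℓ hℓ
          exact ⟨_, h1.fst, fun q t => h2 _ _⟩)
    refine ⟨C, hC, L₀, fun c hc L hL a ha => ?_⟩
    obtain ⟨S, hS, HS⟩ := H c hc L hL a ha
    refine ⟨fun g γ => ∃ z, S (g, z) γ, Tame.ex ?_, fun g γ t h1 h2 => exists_congr fun z =>
      HS (g, z) γ t h1 h2⟩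
    refine hS.comap (fun q : (Γ × ℤ) × ℤ => ((q.1.1, q.2), q.1.2)) ?_
    refine Lin.into_lift (φ := fun q : (Γ × ℤ) × ℤ => (q.1.1, q.2)) (Lin.into_lift ?_ Lin.snd) Lin.snd.fst
    intro ℓ hℓ
    exact (Lin.of_mem hℓ).fst.fst

end PIg

namespace PIg
open Set

variable {p : ℕ} [hp : Fact p.Prime]
set_option linter.unusedVariables false

lemma exists_coeff_bound (d L : ℕ) (a : ℤ) : ∃ κ : ℕ, ∀ P : Polynomial ℚ_[p], P.degree < d →
    (∀ w : ℚ_[p], ‖w - a‖ ≤ (p : ℝ) ^ (-(L : ℤ)) → ‖P.eval w‖ ≤ 1) → ∀ i, ‖P.coeff i‖ ≤ (p : ℝ) ^ κ := by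
  classical
  let node : ℕ → ℚ_[p] := fun j => a + p ^ L * j
  have hnode : Function.Injective node := by
    intro i j hij
    have : (p : ℚ_[p]) ^ L * i = p ^ L * j := by simpa [node] using hij
    have h2 := mul_left_cancel₀ (pow_ne_zero L pK_ne) this
    exact_mod_cast h2
  let s : Finset ℚ_[p] := (Finset.range d).image node
  have hs : s.card = d := by
    rw [Finset.card_image_of_injective _ hnode, Finset.card_range]
  have hnw : ∀ w ∈ s, ‖w - a‖ ≤ (p : ℝ) ^ (-(L : ℤ)) := by
    intro w hw
    obtain ⟨j, _, rfl⟩ := Finset.mem_image.1 hw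
    simp only [node, add_sub_cancel_left]
    have h2 := norm_term (p := p) (j : ℤ) (L : ℤ)
    rw [mul_comm]
    simpa using h2
  let e := Lagrange.funEquivDegreeLT (F := ℚ_[p]) (s := s) (v := fun x => x) (fun _ _ _ _ h => h)
  have hb : ∀ i : ℕ, ∃ κ : ℕ, ∀ v : s → ℚ_[p], ‖v‖ ≤ 1 → ‖((e.symm v : Polynomial.degreeLT ℚ_[p] s.card) : Polynomial ℚ_[p]).coeff i‖ ≤ (p : ℝ) ^ κ := by
    intro i
    let lam : (s → ℚ_[p]) →ₗ[ℚ_[p]] ℚ_[p] := (Polynomial.lcoeff ℚ_[p] i) ∘ₗ (Submodule.subtype _) ∘ₗ e.symm.toLinearMap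
    let lamc := LinearMap.toContinuousLinearMap lam
    obtain ⟨κ, hκ⟩ := pow_unbounded_of_one_lt (‖lamc‖) (one_lt_p (p := p))
    refine ⟨κ, fun v hv => ?_⟩
    have h1 := lamc.le_opNorm v
    have h2 : ‖lamc‖ * ‖v‖ ≤ ‖lamc‖ := mul_le_of_le_one_right (norm_nonneg _) hv
    exact (h1.trans h2).trans hκ.le
  choose κ hκ using hb
  refine ⟨∑ i ∈ Finset.range d, κ i, fun P hP hw i => ?_⟩
  by_cases hi : i < d
  · have hP' : P ∈ Polynomial.degreeLT ℚ_[p] s.card := by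
      rw [Polynomial.mem_degreeLT, hs]; exact hP
    have h1 := hκ i (e ⟨P, hP'⟩) (by
      rw [pi_norm_le_iff_of_nonneg zero_le_one]
      intro w
      exact hw _ (hnw w w.2))
    rw [LinearEquiv.symm_apply_apply] at h1
    refine h1.trans (pow_le_pow_right₀ one_lt_p.le ?_)
    exact Finset.single_le_sum (f := κ) (fun _ _ => Nat.zero_le _) (Finset.mem_range.2 hi)
  · rw [Polynomial.coeff_eq_zero_of_degree_lt (lt_of_lt_of_le hP (by exact_mod_cast not_lt.1 hi))]
    simp

lemma exists_coeff_bound' (d L : ℕ) (a : ℤ) : ∃ κ : ℕ, ∀ S : Polynomial ℚ_[p], S.natDegree ≤ d →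
    (∀ w : ℚ_[p], ‖w - a‖ ≤ (p : ℝ) ^ (-(L : ℤ)) → ‖S.derivative.eval w‖ ≤ 1) →
    ∀ i, 1 ≤ i → ‖S.coeff i‖ ≤ (p : ℝ) ^ κ := by
  obtain ⟨κ, hκ⟩ := exists_coeff_bound (p := p) (d + 1) L a
  have hb : ∀ i : ℕ, ∃ n : ℕ, ‖((i : ℚ_[p]))⁻¹‖ ≤ (p : ℝ) ^ n := fun i =>
    (pow_unbounded_of_one_lt _ (one_lt_p (p := p))).imp fun _ h => h.le
  choose n hn using hb
  refine ⟨κ + ∑ i ∈ Finset.range (d + 1), n i, fun S hS hw i hi => ?_⟩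
  by_cases hid : i ≤ d
  · obtain ⟨j, rfl⟩ : ∃ j, i = j + 1 := ⟨i - 1, by omega⟩
    have h1 := hκ S.derivative (by
      refine lt_of_le_of_lt Polynomial.degree_le_natDegree ?_
      have := Polynomial.natDegree_derivative_le S
      exact_mod_cast (by omega : S.derivative.natDegree < d + 1)) hw j
    rw [Polynomial.coeff_derivative] at h1
    have h0 : ((j + 1 : ℕ) : ℚ_[p]) ≠ 0 := by exact_mod_cast Nat.succ_ne_zero j
    have h2 : S.coeff (j + 1) = (S.coeff (j + 1) * ((j : ℚ_[p]) + 1)) * ((j + 1 : ℕ) : ℚ_[p])⁻¹ := by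
      push_cast at h0 ⊢
      field_simp
    rw [h2, norm_mul, pow_add]
    refine mul_le_mul h1 ((hn _).trans (pow_le_pow_right₀ one_lt_p.le ?_)) (norm_nonneg _) (by positivity)
    exact Finset.single_le_sum (f := n) (fun _ _ => Nat.zero_le _) (Finset.mem_range.2 (by omega))
  · rw [Polynomial.coeff_eq_zero_of_natDegree_lt (by omega)]
    simp

lemma norm_pow_taylor {w s : ℚ_[p]} (hw : ‖w‖ ≤ 1) (hs : ‖s‖ ≤ 1) (i : ℕ) :
    ‖(w + s) ^ i - w ^ i - i * w ^ (i - 1) * s‖ ≤ ‖s‖ ^ 2 := by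
  induction i with
  | zero => simp
  | succ i ih =>
    have h1 : (w + s) ^ (i + 1) - w ^ (i + 1) - ((i + 1 : ℕ) : ℚ_[p]) * w ^ (i + 1 - 1) * s =
        (w + s) * ((w + s) ^ i - w ^ i - i * w ^ (i - 1) * s) + i * w ^ (i - 1) * s ^ 2 := by
      rcases i with _ | i
      · simp
      · simp only [Nat.add_sub_cancel]; push_cast; ring
    rw [h1]
    apply norm_add_le
    · rw [norm_mul]
      exact (mul_le_of_le_one_left (norm_nonneg _) (norm_add_le hw hs)).trans ih
    · rw [norm_mul, norm_mul, norm_pow, norm_pow]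
      refine mul_le_of_le_one_left (by positivity) ?_
      refine mul_le_one₀ ?_ (by positivity) (pow_le_one₀ (norm_nonneg _) hw)
      exact_mod_cast norm_int_le (p := p) i

lemma poly_taylor {S : Polynomial ℚ_[p]} {κ N : ℕ} (hS : ∀ i, 1 ≤ i → ‖S.coeff i‖ ≤ (p : ℝ) ^ κ)
    {w s : ℚ_[p]} (hw : ‖w‖ ≤ 1) (hs : ‖s‖ ≤ (p : ℝ) ^ (-((κ : ℤ) + N))) :
    ‖S.eval (w + s) - S.eval w - S.derivative.eval w * s‖ ≤ (p : ℝ) ^ (-(N : ℤ)) * ‖s‖ := by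
  have hs1 : ‖s‖ ≤ 1 := hs.trans (by
    have := (zpow_le' (p := p) (m := -((κ : ℤ) + N)) (n := 0)).2 (by omega)
    simpa using this)
  have h1 : S.eval (w + s) - S.eval w - S.derivative.eval w * s =
      ∑ i ∈ S.support, S.coeff i * ((w + s) ^ i - w ^ i - i * w ^ (i - 1) * s) := by
    rw [Polynomial.eval_eq_sum, Polynomial.eval_eq_sum, Polynomial.derivative_eval]
    simp only [Polynomial.sum, Finset.sum_mul, ← Finset.sum_sub_distrib]
    refine Finset.sum_congr rfl fun i _ => by ring
  rw [h1]
  refine norm_sum_le (by positivity) fun i _ => ?_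
  rcases Nat.eq_zero_or_pos i with rfl | hi
  · simp; positivity
  rw [norm_mul]
  calc _ ≤ (p : ℝ) ^ κ * ‖s‖ ^ 2 :=
        mul_le_mul (hS i hi) (norm_pow_taylor hw hs1 i) (norm_nonneg _) (by positivity)
    _ = ((p : ℝ) ^ (κ : ℤ) * ‖s‖) * ‖s‖ := by rw [zpow_natCast]; ring
    _ ≤ ((p : ℝ) ^ (κ : ℤ) * (p : ℝ) ^ (-((κ : ℤ) + N))) * ‖s‖ := by gcongr
    _ = _ := by rw [← zpow_add']; congr 2; ring

/-- Scaling data -/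
theorem ball_analysis (d L : ℕ) (a : ℤ) : ∃ κ : ℕ, ∀ (q : Polynomial ℚ_[p]) (c : ℚ_[p]) (γ δ : ℤ),
    q.natDegree ≤ d →
    (∀ t, E (t - c) γ L a → ‖q.derivative.eval t‖ = (p : ℝ) ^ (-δ)) →
    (∀ i : ℕ, 1 ≤ i → ‖(Polynomial.taylor c q).coeff i‖ ≤ (p : ℝ) ^ (-(δ + γ - κ - i * γ))) ∧
    (∀ (N : ℕ) (t t' : ℚ_[p]), E (t - c) γ L a → ‖t' - t‖ ≤ (p : ℝ) ^ (-(γ + κ + N)) →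
      ‖q.eval t' - q.eval t - q.derivative.eval t * (t' - t)‖ ≤ (p : ℝ) ^ (-(N + δ)) * ‖t' - t‖) := by
  obtain ⟨κ, hκ⟩ := exists_coeff_bound' (p := p) d L a
  refine ⟨κ, fun q c γ δ hq hδ => ?_⟩
  let S : Polynomial ℚ_[p] := Polynomial.C ((p : ℚ_[p]) ^ (-(δ + γ))) *
    (Polynomial.taylor c q).comp (Polynomial.C ((p : ℚ_[p]) ^ γ) * Polynomial.X)
  have hSe : ∀ w, S.eval w = (p : ℚ_[p]) ^ (-(δ + γ)) * q.eval (c + p ^ γ * w) := by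
    intro w
    simp [S, Polynomial.taylor_eval, add_comm]
  have hSd : ∀ w, S.derivative.eval w = (p : ℚ_[p]) ^ (-δ) * q.derivative.eval (c + p ^ γ * w) := by
    intro w
    have h1 : S = Polynomial.C ((p : ℚ_[p]) ^ (-(δ + γ))) *
      q.comp (Polynomial.C ((p : ℚ_[p]) ^ γ) * Polynomial.X + Polynomial.C c) := by
      simp only [S, Polynomial.taylor_apply, Polynomial.comp_assoc]
      simp
    rw [h1]
    simp only [Polynomial.derivative_mul, Polynomial.derivative_C, zero_mul, zero_add,
      Polynomial.derivative_comp, Polynomial.derivative_add, Polynomial.derivative_X, add_zero,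
      Polynomial.eval_mul, Polynomial.eval_C, Polynomial.eval_comp, Polynomial.eval_add, Polynomial.eval_X,
      mul_one, neg_add, zpow_add₀ (pK_ne (p := p)), zpow_neg]
    rw [add_comm c]
    have := zpow_ne_zero γ (pK_ne (p := p))
    field_simp
  have hball : ∀ w : ℚ_[p], ‖w - a‖ ≤ (p : ℝ) ^ (-(L : ℤ)) → E (c + (p : ℚ_[p]) ^ γ * w - c) γ L a := by
    intro w hw
    have h1 : E w 0 L a := by unfold E; simpa using hw
    have h2 := (E_scale (τ := γ)).2 h1
    rwa [zero_add, show w * (p : ℚ_[p]) ^ γ = c + (p : ℚ_[p]) ^ γ * w - c by ring] at h2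
  have hSdeg : S.natDegree ≤ d := by
    refine (Polynomial.natDegree_C_mul_le _ _).trans ?_
    refine Polynomial.natDegree_comp_le.trans ?_
    rw [Polynomial.natDegree_taylor]
    have := (Polynomial.natDegree_C_mul_le ((p : ℚ_[p]) ^ γ) Polynomial.X).trans Polynomial.natDegree_X_le
    nlinarith
  have hSn : ∀ w : ℚ_[p], ‖w - a‖ ≤ (p : ℝ) ^ (-(L : ℤ)) → ‖S.derivative.eval w‖ = 1 := by
    intro w hw
    rw [hSd, norm_mul, hδ _ (hball w hw), norm_zpow_p, ← zpow_add']
    simp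
  have hSc := hκ S hSdeg (fun w hw => (hSn w hw).le)
  constructor
  · intro i hi
    have h1 := hSc i hi
    have h2 : S.coeff i = (Polynomial.taylor c q).coeff i * (p : ℚ_[p]) ^ (-(δ + γ) + i * γ) := by
      simp only [S, Polynomial.coeff_C_mul, Polynomial.comp_C_mul_X_coeff]
      rw [zpow_add₀ pK_ne, mul_comm (i : ℤ) γ, zpow_mul, zpow_natCast]
      ring
    rw [h2, norm_mul, norm_zpow_p, ← le_div_iff₀ (zpow_pos' _)] at h1
    refine h1.trans_eq ?_
    rw [div_eq_mul_inv, ← zpow_neg, ← zpow_natCast, ← zpow_add']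
    congr 1; ring
  · intro N t t' ht htt
    have hp0 := zpow_ne_zero γ (pK_ne (p := p))
    let w := (t - c) * (p : ℚ_[p]) ^ (-γ)
    let s := (t' - t) * (p : ℚ_[p]) ^ (-γ)
    have hw : ‖w - a‖ ≤ (p : ℝ) ^ (-(L : ℤ)) := by
      have := (E_scale (τ := -γ)).2 ht
      rw [add_neg_cancel] at this
      unfold E at this
      simpa [w] using this
    have hw1 : ‖w‖ ≤ 1 := by
      have h1 : E w 0 L a := by unfold E; simpa using hw
      simpa using h1.le
    have hs : ‖s‖ ≤ (p : ℝ) ^ (-((κ : ℤ) + N)) := by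
      have := norm_mul_le' htt (norm_zpow_p (p := p) (-γ)).le
      refine this.trans (zpow_le'.2 (by omega))
    have h1 := poly_taylor hSc hw1 hs
    have e1 : c + (p : ℚ_[p]) ^ γ * w = t := by
      simp only [w, zpow_neg]; field_simp; ring
    have e2 : c + (p : ℚ_[p]) ^ γ * (w + s) = t' := by
      simp only [w, s, zpow_neg]; field_simp; ring
    rw [hSe, hSe, hSd, e1, e2] at h1
    have e3 : (p : ℚ_[p]) ^ (-(δ + γ)) * q.eval t' - (p : ℚ_[p]) ^ (-(δ + γ)) * q.eval t -
        (p : ℚ_[p]) ^ (-δ) * q.derivative.eval t * s =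
        (p : ℚ_[p]) ^ (-(δ + γ)) * (q.eval t' - q.eval t - q.derivative.eval t * (t' - t)) := by
      simp only [s, neg_add, zpow_add₀ (pK_ne (p := p))]; ring
    rw [e3, norm_mul, norm_zpow_p, mul_comm, ← le_div_iff₀ (zpow_pos' _)] at h1
    refine h1.trans_eq ?_
    simp only [s, norm_mul, norm_zpow_p]
    rw [div_eq_mul_inv, ← zpow_neg]
    have : (p : ℝ) ^ (-((N : ℤ) + δ)) = (p : ℝ) ^ (-(N : ℤ)) * (p : ℝ) ^ (- -γ) * (p : ℝ) ^ (- - -(δ + γ)) := by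
      rw [← zpow_add', ← zpow_add']; congr 1; ring
    rw [this]; ring

/-- The hypotheses on a ball. -/
structure NiceBall (q : Polynomial ℚ_[p]) (c : ℚ_[p]) (γ δ : ℤ) (L κ : ℕ) (a : ℤ) : Prop where
  der : ∀ t, E (t - c) γ L a → ‖q.derivative.eval t‖ = (p : ℝ) ^ (-δ)
  coef : ∀ i : ℕ, 1 ≤ i → ‖(Polynomial.taylor c q).coeff i‖ ≤ (p : ℝ) ^ (-(δ + γ - κ - i * γ))
  tay : ∀ (N : ℕ) (t t' : ℚ_[p]), E (t - c) γ L a → ‖t' - t‖ ≤ (p : ℝ) ^ (-(γ + κ + N)) →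
      ‖q.eval t' - q.eval t - q.derivative.eval t * (t' - t)‖ ≤ (p : ℝ) ^ (-(N + δ)) * ‖t' - t‖

theorem exists_niceBall (d L : ℕ) (a : ℤ) : ∃ κ : ℕ, ∀ (q : Polynomial ℚ_[p]) (c : ℚ_[p]) (γ δ : ℤ),
    q.natDegree ≤ d →
    (∀ t, E (t - c) γ L a → ‖q.derivative.eval t‖ = (p : ℝ) ^ (-δ)) → NiceBall q c γ δ L κ a := by
  obtain ⟨κ, h⟩ := ball_analysis (p := p) d L a
  exact ⟨κ, fun q c γ δ hq hd => ⟨hd, (h q c γ δ hq hd).1, (h q c γ δ hq hd).2⟩⟩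

namespace NiceBall
variable {q : Polynomial ℚ_[p]} {c : ℚ_[p]} {γ δ : ℤ} {L κ : ℕ} {a : ℤ}

lemma move {t t' : ℚ_[p]} {m : ℕ} (ht : E (t - c) γ L a) (hm : L ≤ m)
    (h : ‖t' - t‖ ≤ (p : ℝ) ^ (-(γ + m))) : E (t' - c) γ L a := by
  rw [← E_congr (y := t - c)]
  · exact ht
  · rw [sub_sub_sub_cancel_right, norm_sub_rev]
    exact h.trans (zpow_le'.2 (by omega))

lemma exists_root (hb : NiceBall q c γ δ L κ a) {m : ℕ} (hm : κ + 1 ≤ m) (hmL : L ≤ m) {t : ℚ_[p]}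
    (ht : E (t - c) γ L a) (hq : ‖q.eval t‖ ≤ (p : ℝ) ^ (-(δ + γ + m))) :
    ∃ r, q.eval r = 0 ∧ ‖r - t‖ ≤ (p : ℝ) ^ (-(γ + m)) := by
  have hne : (Metric.closedBall t ((p : ℝ) ^ (-(γ + m)))).Nonempty :=
    ⟨t, Metric.mem_closedBall_self (zpow_pos' _).le⟩
  obtain ⟨r, hr, hmin⟩ := (isCompact_closedBall t ((p : ℝ) ^ (-(γ + m)))).exists_isMinOn hne
    (f := fun x => ‖q.eval x‖) (q.continuous.norm.continuousOn)
  rw [mem_closedBall_iff_norm] at hr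
  refine ⟨r, ?_, hr⟩
  by_contra h0
  have hrE := move ht hmL hr
  have hd := hb.der r hrE
  have hd0 : q.derivative.eval r ≠ 0 := by
    intro h; rw [h, norm_zero] at hd; exact (zpow_pos' _).ne hd
  have hle : ‖q.eval r‖ ≤ (p : ℝ) ^ (-(δ + γ + m)) :=
    (hmin (Metric.mem_closedBall_self (zpow_pos' _).le)).trans hq
  let s := - q.eval r / q.derivative.eval r
  have hs : ‖s‖ = ‖q.eval r‖ * (p : ℝ) ^ δ := by
    simp only [s, norm_div, norm_neg, hd, zpow_neg, div_inv_eq_mul]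
  have hs2 : ‖s‖ ≤ (p : ℝ) ^ (-(γ + m)) := by
    rw [hs]
    calc _ ≤ (p : ℝ) ^ (-(δ + γ + m)) * (p : ℝ) ^ δ := by gcongr
      _ = _ := by rw [← zpow_add']; congr 1; ring
  have h1 := hb.tay 1 r (r + s) hrE (by
    rw [add_sub_cancel_left]; exact hs2.trans (zpow_le'.2 (by push_cast; omega)))
  rw [add_sub_cancel_left, show q.derivative.eval r * s = - q.eval r by simp only [s]; field_simp,
    sub_neg_eq_add, sub_add_cancel, hs] at h1
  have h2 : ‖q.eval r‖ ≤ ‖q.eval (r + s)‖ := hmin (by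
    rw [mem_closedBall_iff_norm, show r + s - t = s + (r - t) by ring]
    exact norm_add_le hs2 hr)
  have h3 : (p : ℝ) ^ (-((1 : ℕ) + δ : ℤ)) * (‖q.eval r‖ * (p : ℝ) ^ δ) = (p : ℝ) ^ (-1 : ℤ) * ‖q.eval r‖ := by
    rw [show (-1 : ℤ) = -((1 : ℕ) + δ : ℤ) + δ by push_cast; ring, zpow_add']; ring
  rw [h3] at h1
  have h4 : (p : ℝ) ^ (-1 : ℤ) < 1 := by
    have := (zpow_lt' (p := p) (m := -1) (n := 0)).2 (by norm_num)
    simpa using this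
  have h5 : 0 < ‖q.eval r‖ := norm_pos_iff.2 h0
  nlinarith

lemma close (hb : NiceBall q c γ δ L κ a) {N : ℕ} {t r : ℚ_[p]} (hr : q.eval r = 0)
    (ht : E (t - c) γ L a) (htr : ‖r - t‖ ≤ (p : ℝ) ^ (-(γ + κ + N))) :
    ‖q.eval t - q.derivative.eval t * (t - r)‖ ≤
      (p : ℝ) ^ (-(N : ℤ)) * ‖q.derivative.eval t * (t - r)‖ := by
  have h1 := hb.tay N t r ht htr
  rw [hr, ← norm_neg] at h1
  rw [norm_mul, hb.der t ht, norm_sub_rev t r, ← mul_assoc, ← zpow_add']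
  rw [show -((N : ℤ)) + -δ = -(N + δ) by ring]
  have e : q.eval t - q.derivative.eval t * (t - r) =
      -(0 - q.eval t - q.derivative.eval t * (r - t)) := by ring
  rw [e]; exact h1

lemma norm_eval (hb : NiceBall q c γ δ L κ a) {N : ℕ} (hN : 1 ≤ N) {t r : ℚ_[p]} (hr : q.eval r = 0)
    (ht : E (t - c) γ L a) (htr : ‖r - t‖ ≤ (p : ℝ) ^ (-(γ + κ + N))) :
    ‖q.eval t‖ = (p : ℝ) ^ (-δ) * ‖r - t‖ := by
  by_cases h : t - r = 0
  · have : t = r := by rwa [sub_eq_zero] at h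
    subst this; simp [hr]
  have h1 := hb.close hr ht htr
  have h2 : ‖q.derivative.eval t * (t - r)‖ = (p : ℝ) ^ (-δ) * ‖r - t‖ := by
    rw [norm_mul, hb.der t ht, norm_sub_rev t r]
  rw [← h2]
  apply norm_eq_of_lt
  refine h1.trans_lt ?_
  have h4 : (p : ℝ) ^ (-(N : ℤ)) < 1 := by
    have := (zpow_lt' (p := p) (m := -(N : ℤ)) (n := 0)).2 (by omega)
    simpa using this
  have h5 : 0 < ‖q.derivative.eval t * (t - r)‖ := by
    rw [h2]; exact mul_pos (zpow_pos' _) (norm_pos_iff.2 (by rwa [← neg_ne_zero, neg_sub]))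
  nlinarith

lemma unique (hb : NiceBall q c γ δ L κ a) {m : ℕ} (hm : κ + 1 ≤ m) {t r : ℚ_[p]} (hr : q.eval r = 0)
    (ht : E (t - c) γ L a) (ht0 : q.eval t = 0) (htr : ‖r - t‖ ≤ (p : ℝ) ^ (-(γ + m))) : r = t := by
  have := hb.norm_eval (N := 1) le_rfl hr ht (htr.trans (zpow_le'.2 (by push_cast; omega)))
  rw [ht0, norm_zero] at this
  rcases mul_eq_zero.1 this.symm with h | h
  · exact absurd h (zpow_pos' _).ne'
  · rwa [norm_eq_zero, sub_eq_zero] at h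

lemma root_iff (hb : NiceBall q c γ δ L κ a) {m : ℕ} (hm : κ + 1 ≤ m) (hmL : L ≤ m) {t : ℚ_[p]}
    (ht : E (t - c) γ L a) : ‖q.eval t‖ ≤ (p : ℝ) ^ (-(δ + γ + m)) ↔
    ∃ r, q.eval r = 0 ∧ ‖r - t‖ ≤ (p : ℝ) ^ (-(γ + m)) := by
  refine ⟨hb.exists_root hm hmL ht, ?_⟩
  rintro ⟨r, hr, hrt⟩
  rw [hb.norm_eval (N := 1) le_rfl hr ht (hrt.trans (zpow_le'.2 (by push_cast; omega)))]
  calc _ ≤ (p : ℝ) ^ (-δ) * (p : ℝ) ^ (-(γ + m)) := by gcongr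
    _ = _ := by rw [← zpow_add']; congr 1; ring

end NiceBall

end PIg

namespace PIg
open Set

variable {p : ℕ} [hp : Fact p.Prime]
set_option linter.unusedVariables false

section
variable {X : Type} {𝓡 : Set (X → ℚ_[p])} {Γ : Type} {ρ : Γ → X} {𝓛 : Set (Γ → ℤ)}
  {ℓ₁ ℓ₂ ℓ₃ : Γ → ℤ}

/-- tame predicates with one integer parameter -/
def T1 (𝓡 : Set (X → ℚ_[p])) (H : X → ℤ → Prop) : Prop :=
  Tame 𝓡 (fun d : X × ℤ => d.1) {fun d => d.2} (fun d => H d.1 d.2)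
/-- tame predicates with two integer parameters -/
def T2 (𝓡 : Set (X → ℚ_[p])) (H : X → ℤ → ℤ → Prop) : Prop :=
  Tame 𝓡 (fun d : (X × ℤ) × ℤ => d.1.1) (lift {fun d => d.2}) (fun d => H d.1.1 d.1.2 d.2)
/-- tame predicates with three integer parameters -/
def T3 (𝓡 : Set (X → ℚ_[p])) (H : X → ℤ → ℤ → ℤ → Prop) : Prop :=
  Tame 𝓡 (fun d : ((X × ℤ) × ℤ) × ℤ => d.1.1.1) (lift (lift {fun d => d.2}))
    (fun d => H d.1.1.1 d.1.1.2 d.1.2 d.2)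

lemma T1.app {H : X → ℤ → Prop} (h : T1 𝓡 H) (h1 : Lin 𝓛 ℓ₁) :
    Tame 𝓡 ρ 𝓛 (fun g => H (ρ g) (ℓ₁ g)) :=
  Tame.comap h (fun g => (ρ g, ℓ₁ g)) (by rintro _ rfl; exact h1)
lemma T2.app {H : X → ℤ → ℤ → Prop} (h : T2 𝓡 H) (h1 : Lin 𝓛 ℓ₁) (h2 : Lin 𝓛 ℓ₂) :
    Tame 𝓡 ρ 𝓛 (fun g => H (ρ g) (ℓ₁ g) (ℓ₂ g)) :=
  Tame.comap h (fun g => ((ρ g, ℓ₁ g), ℓ₂ g)) (Lin.into_lift (φ := fun g => (ρ g, ℓ₁ g))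
    (by rintro _ rfl; exact h1) h2)
lemma T3.app {H : X → ℤ → ℤ → ℤ → Prop} (h : T3 𝓡 H) (h1 : Lin 𝓛 ℓ₁) (h2 : Lin 𝓛 ℓ₂)
    (h3 : Lin 𝓛 ℓ₃) : Tame 𝓡 ρ 𝓛 (fun g => H (ρ g) (ℓ₁ g) (ℓ₂ g) (ℓ₃ g)) :=
  Tame.comap h (fun g => (((ρ g, ℓ₁ g), ℓ₂ g), ℓ₃ g))
    (Lin.into_lift (φ := fun g => ((ρ g, ℓ₁ g), ℓ₂ g)) (Lin.into_lift (φ := fun g => (ρ g, ℓ₁ g))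
    (by rintro _ rfl; exact h1) h2) h3)

end

lemma E.pow {y : ℚ_[p]} {σ : ℤ} {L : ℕ} {k : ℤ} (h : E y σ L k) (i : ℕ) :
    E (y ^ i) (i * σ) L (k ^ i) := by
  induction i with
  | zero => simp [E]
  | succ i ih =>
    have := ih.mul h
    rw [pow_succ, pow_succ]
    convert this using 1
    push_cast; ring

lemma E.sum {ι : Type*} {s : Finset ι} {y : ι → ℚ_[p]} {σ : ℤ} {L : ℕ} {k : ι → ℤ}
    (h : ∀ i ∈ s, E (y i) σ L (k i)) : E (∑ i ∈ s, y i) σ L (∑ i ∈ s, k i) := by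
  classical
  induction s using Finset.induction_on with
  | empty => simp [E, (zpow_pos' _).le]
  | insert a s ha ih =>
    rw [Finset.sum_insert ha, Finset.sum_insert ha]
    exact (h a (by simp)).add (ih fun i hi => h i (by simp [hi]))

section
variable {X : Type} {𝓡 : Subring (X → ℚ_[p])}

lemma sp_taylor (q : Polynomial 𝓡) (c : 𝓡) (x : X) :
    sp (Polynomial.taylor c q) x = Polynomial.taylor ((c : X → ℚ_[p]) x) (sp q x) := by
  unfold sp
  rw [Polynomial.map_taylor]
  rfl

lemma sp_derivative (q : Polynomial 𝓡) (x : X) :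
    sp (Polynomial.derivative q) x = Polynomial.derivative (sp q x) := by
  unfold sp
  rw [Polynomial.derivative_map]

lemma sp_natDegree_le (q : Polynomial 𝓡) (x : X) : (sp q x).natDegree ≤ q.natDegree :=
  Polynomial.natDegree_map_le

lemma polyE (q : Polynomial 𝓡) {c : X → ℚ_[p]} (hc : c ∈ 𝓡) (κ m L' : ℕ) (k' a' : ℤ) :
    ∃ W : X → ℤ → ℤ → ℤ → Prop, T3 (𝓡 : Set (X → ℚ_[p])) W ∧ ∀ (x : X) (γ δ z : ℤ) (t : ℚ_[p]),
      (∀ i : ℕ, 1 ≤ i → ‖(Polynomial.taylor (c x) (sp q x)).coeff i‖ ≤ (p : ℝ) ^ (-(δ + γ - κ - i * γ))) →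
      E (t - c x) γ (L' + m) a' → z ≤ δ + γ - κ + m →
      (E ((sp q x).eval t) z L' k' ↔ W x γ δ z) := by
  let b : ℕ → 𝓡 := fun i => (Polynomial.taylor (⟨c, hc⟩ : 𝓡) q).coeff i
  have hb : ∀ i x, (b i : X → ℚ_[p]) x = (Polynomial.taylor (c x) (sp q x)).coeff i := by
    intro i x
    rw [← sp_coeff, sp_taylor]
  let n := q.natDegree
  let M := L' + m
  let W : X → ℤ → ℤ → ℤ → Prop := fun x γ δ z => ∃ kk : Fin n → Fin (p ^ M),
    (∀ i : Fin n, E ((b (i + 1) : X → ℚ_[p]) x) (δ + γ - κ - ((i + 1 : ℕ) : ℤ) * γ) M (kk i : ℕ)) ∧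
      E3 ((-b 0 : 𝓡).1 x) (δ + γ - κ) (∑ i : Fin n, ((kk i : ℕ) : ℤ) * a' ^ ((i : ℕ) + 1)) m z L' k'
  refine ⟨W, ?_, ?_⟩
  · have l1 : Lin (lift (lift {fun d : X × ℤ => d.2})) (fun d : ((X × ℤ) × ℤ) × ℤ => d.1.2 + d.1.1.2 - κ) :=
      (Lin.snd.fst.add Lin.var.fst.fst).sub (Lin.const _)
    refine Tame.exf fun kk => Tame.and (Tame.allf fun i => ?_) ?_
    · exact Tame.atom _ _ (b (i + 1)).2 (l1.sub (Lin.cmul _ Lin.var.fst.fst))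
    · exact (Good.of_mem (-b 0 : 𝓡).2).tame_E3 (ρ := fun d : ((X × ℤ) × ℤ) × ℤ => d.1.1.1) l1 Lin.snd _ _ _ _
  · intro x γ δ z t hco ht hz
    have hval : (sp q x).eval t = (∑ i : Fin n, (b (i + 1) : X → ℚ_[p]) x * (t - c x) ^ ((i : ℕ) + 1)) -
        (-b 0 : 𝓡).1 x := by
      rw [← Polynomial.taylor_eval_sub (c x), Polynomial.eval_eq_sum_range' (n := n + 1)
        (by rw [Polynomial.natDegree_taylor]; exact Nat.lt_succ_of_le (sp_natDegree_le q x)),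
        Finset.sum_range_succ', Fin.sum_univ_eq_sum_range (fun i => (b (i + 1) : X → ℚ_[p]) x * (t - c x) ^ (i + 1))]
      have h0 : (-b 0 : 𝓡).1 x = - (Polynomial.taylor (c x) (sp q x)).coeff 0 := by
        rw [← hb]; rfl
      rw [h0, sub_neg_eq_add, pow_zero, mul_one]
      congr 1
      exact Finset.sum_congr rfl fun i _ => by rw [hb]
    have key : ∀ kk : Fin n → Fin (p ^ M),
        (∀ i : Fin n, E ((b (i + 1) : X → ℚ_[p]) x) (δ + γ - κ - ((i + 1 : ℕ) : ℤ) * γ) M (kk i : ℕ)) →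
        E (∑ i : Fin n, (b (i + 1) : X → ℚ_[p]) x * (t - c x) ^ ((i : ℕ) + 1)) (δ + γ - κ) M
          (∑ i : Fin n, ((kk i : ℕ) : ℤ) * a' ^ ((i : ℕ) + 1)) := by
      intro kk hkk
      refine E.sum fun i _ => ?_
      have := (hkk i).mul (ht.pow ((i : ℕ) + 1))
      rwa [sub_add_cancel] at this
    rw [hval]
    constructor
    · intro hE
      have h1 : ∀ i : Fin n, ∃ k : Fin (p ^ M),
          E ((b (i + 1) : X → ℚ_[p]) x) (δ + γ - κ - ((i + 1 : ℕ) : ℤ) * γ) M (k : ℕ) := by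
        intro i
        have := hco (i + 1) (by omega)
        rw [← hb] at this
        obtain ⟨k, hk, hEk⟩ := E_exists M this
        exact ⟨⟨k, hk⟩, hEk⟩
      choose kk hkk using h1
      exact ⟨kk, hkk, (E_sub_iff (key kk hkk) le_rfl hz).1 hE⟩
    · rintro ⟨kk, hkk, h3⟩
      exact (E_sub_iff (key kk hkk) le_rfl hz).2 h3

lemma rootAt (q : Polynomial 𝓡) {c : X → ℚ_[p]} (hc : c ∈ 𝓡) {κ L M : ℕ} {a a₂ : ℤ}
    (hM : κ + 1 ≤ M) (hML : L ≤ M) (ha : (p ^ L : ℤ) ∣ a₂ - a) :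
    ∃ W : X → ℤ → ℤ → Prop, T2 (𝓡 : Set (X → ℚ_[p])) W ∧ ∀ (x : X) (γ δ : ℤ),
      NiceBall (sp q x) (c x) γ δ L κ a →
      (W x γ δ ↔ ∃ r, (sp q x).eval r = 0 ∧ E (r - c x) γ M a₂) := by
  obtain ⟨W, hW, HW⟩ := polyE q hc κ (κ + M) 0 0 a₂
  refine ⟨fun x γ δ => W x γ δ (δ + γ + M), ?_, ?_⟩
  · exact hW.app (ρ := fun d : (X × ℤ) × ℤ => d.1.1) Lin.var.fst Lin.snd
      ((Lin.snd.add Lin.var.fst).add (Lin.const _))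
  · intro x γ δ hb
    have ht : ∀ N, E (c x + (a₂ : ℚ_[p]) * (p : ℚ_[p]) ^ γ - c x) γ N a₂ := by
      intro N; unfold E; simp [(zpow_pos' _).le]
    beta_reduce
    rw [← HW x γ δ (δ + γ + M) (c x + (a₂ : ℚ_[p]) * (p : ℚ_[p]) ^ γ) hb.coef (ht _) (by push_cast; omega),
      E_zero_iff, hb.root_iff hM hML ((E_dvd ha).1 (ht L))]
    refine exists_congr fun r => and_congr_right fun _ => ?_
    unfold E
    rw [sub_sub]

end
end PIg

namespace PIg
open Set

variable {p : ℕ} [hp : Fact p.Prime]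
set_option linter.unusedVariables false

lemma Good.const_one {X : Type} {𝓡 : Subring (X → ℚ_[p])} : Good (lin 𝓡) (fun _ => (1 : ℚ_[p])) :=
  Good.of_mem (Or.inl ⟨1, Subring.one_mem _, rfl⟩)

lemma Good.mul_lin {X : Type} {𝓡 : Subring (X → ℚ_[p])} {r r' : X × ℚ_[p] → ℚ_[p]}
    (h : Good (lin 𝓡) r) (h' : Good (lin 𝓡) r') : Good (lin 𝓡) (fun x => r x * r' x) := by
  have := h.div (Good.const_one.div h')
  convert this using 2
  simp

lemma lift_lin {X Γ : Type} {𝓡 : Subring (X → ℚ_[p])} {ρ : Γ → X × ℚ_[p]} {𝓛 : Set (Γ → ℤ)}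
    {R : Γ → Prop} (h : Tame (𝓡 : Set (X → ℚ_[p])) (fun g => (ρ g).1) 𝓛 R) : Tame (lin 𝓡) ρ 𝓛 R :=
  h.subst fun r hr L k => Tame.atom (r := fun q : X × ℚ_[p] => r q.1) (ρ := fun q : Γ × ℤ => ρ q.1)
    L k (Or.inl ⟨r, hr, rfl⟩) Lin.snd

/-- the induction hypothesis -/
def CellIH {X : Type} (𝓡 : Subring (X → ℚ_[p])) (d : ℕ) : Prop :=
  ∀ q : Polynomial 𝓡, q.natDegree ≤ d → Good (lin 𝓡) (fun w => (sp q w.1).eval w.2)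

/-- nonnegative residues that are units -/
def units (p L : ℕ) : Finset ℕ := (Finset.range (p ^ L)).filter (fun a : ℕ => ¬ (p : ℤ) ∣ a)

/-- nearest iff -/
lemma near_iff {t c c' : ℚ_[p]} {γ a : ℤ} {L : ℕ} (hL : 1 ≤ L) (ha : ¬ (p : ℤ) ∣ a)
    (h : E (t - c) γ L a) : ‖t - c‖ ≤ ‖t - c'‖ ↔ ¬ E (c' - c) γ 1 a := by
  rw [h.norm_eq hL ha, ← not_lt, not_iff_not, ← norm_le_iff_lt]
  have h1 := h.mono hL
  unfold E at h1 ⊢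
  push_cast
  have e : c' - c - a * (p : ℚ_[p]) ^ γ = (t - c - a * (p : ℚ_[p]) ^ γ) - (t - c') := by ring
  push_cast at h1
  constructor
  · intro h2
    rw [e]; exact norm_sub_le h1 h2
  · intro h2
    have : t - c' = (t - c - a * (p : ℚ_[p]) ^ γ) - (c' - c - a * (p : ℚ_[p]) ^ γ) := by ring
    rw [this]; exact norm_sub_le h1 h2

lemma exists_decomp {X : Type} {𝓡 : Subring (X → ℚ_[p])} {d : ℕ} (IH : CellIH 𝓡 d)
    {q : Polynomial 𝓡} (hq : q.Monic) (hd : q.natDegree = d + 1) :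
    ∃ C : Finset (X → ℚ_[p]), (∀ c ∈ C, c ∈ 𝓡) ∧ ∃ L : ℕ, 1 ≤ L ∧ ∃ κ : ℤ → ℕ,
      ∃ Cell : (X → ℚ_[p]) → ℤ → X → ℤ → ℤ → Prop,
      (∀ c ∈ C, ∀ a ∈ units p L, T2 (𝓡 : Set (X → ℚ_[p])) (Cell c a)) ∧
      (∀ c ∈ C, ∀ a ∈ units p L, ∀ x γ δ, Cell c a x γ δ → NiceBall (sp q x) (c x) γ δ L (κ a) a) ∧
      (∀ x t, (∃ c ∈ C, t = c x) ∨ ∃ c ∈ C, ∃ a ∈ units p L, ∃ γ δ, E (t - c x) γ L a ∧ Cell c a x γ δ) := by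
  classical
  have hder : Good (lin 𝓡) (fun w => (sp (Polynomial.derivative q) w.1).eval w.2) :=
    IH _ ((Polynomial.natDegree_derivative_le q).trans (by omega))
  have hR := hder.tame_eq (ρ := fun d : (X × ℚ_[p]) × ℤ => d.1) (Lin.var)
  obtain ⟨C₀, hC₀, L₀, H⟩ := SCR hR (Γ := X × ℤ) (fun g => g.1) {fun g => g.2} (fun g t => ((g.1, t), g.2))
    (fun _ _ => rfl) (by rintro _ rfl; exact ⟨_, Lin.var, fun _ _ => rfl⟩)
  let C := insert 0 C₀
  have hC : ∀ c ∈ C, c ∈ 𝓡 := by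
    intro c hc
    rcases Finset.mem_insert.1 hc with rfl | hc
    · exact Subring.zero_mem _
    · exact hC₀ c hc
  let L := L₀ + 1
  have H' : ∀ (c : X → ℚ_[p]) (a : ℤ), ∃ S : X × ℤ → ℤ → Prop, c ∈ C → ¬ (p : ℤ) ∣ a →
      Tame (𝓡 : Set (X → ℚ_[p])) (fun q : (X × ℤ) × ℤ => q.1.1) (lift {fun g => g.2}) (fun q => S q.1 q.2) ∧
        ∀ (g : X × ℤ) γ t, E (t - c g.1) γ L a → (∀ c' ∈ C₀, ‖t - c g.1‖ ≤ ‖t - c' g.1‖) →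
          (‖(sp (Polynomial.derivative q) g.1).eval t‖ = (p : ℝ) ^ (-g.2) ↔ S g γ) := by
    intro c a
    by_cases h : c ∈ C ∧ ¬ (p : ℤ) ∣ a
    · obtain ⟨S, hS⟩ := H c (hC c h.1) L (by omega) a h.2
      exact ⟨S, fun _ _ => hS⟩
    · exact ⟨fun _ _ => True, fun h1 h2 => absurd ⟨h1, h2⟩ h⟩
  choose S hS using H'
  choose κ hκ using exists_niceBall (p := p) (d + 1) L
  refine ⟨C, hC, L, by omega, κ, fun c a x γ δ => (∀ c' ∈ C, ¬ E (c' x - c x) γ 1 a) ∧ S c a (x, δ) γ, ?_, ?_, ?_⟩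
  · intro c hc a ha
    have ha' : ¬ (p : ℤ) ∣ a := (Finset.mem_filter.1 ha).2
    refine Tame.and (Tame.ball _ fun c' hc' => ?_) ?_
    · exact (Tame.atom (r := c' - c) (ρ := fun d : (X × ℤ) × ℤ => d.1.1) 1 a
        (Subring.sub_mem _ (hC c' hc') (hC c hc)) Lin.var.fst).not
    · exact T2.app (H := fun x δ γ => S c a (x, δ) γ) (ρ := fun d : (X × ℤ) × ℤ => d.1.1) (hS c a hc ha').1 Lin.snd Lin.var.fst
  · rintro c hc a ha x γ δ ⟨h1, h2⟩
    have ha' : ¬ (p : ℤ) ∣ a := (Finset.mem_filter.1 ha).2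
    refine hκ _ _ _ _ _ ((sp_natDegree_le q x).trans hd.le) fun t ht => ?_
    rw [← sp_derivative]
    refine ((hS c a hc ha').2 (x, δ) γ t ht fun c' hc' => ?_).2 h2
    exact (near_iff (by omega) ha' ht).2 (h1 c' (Finset.mem_insert_of_mem hc'))
  · intro x t
    by_cases hx : ∃ c ∈ C, t = c x
    · exact Or.inl hx
    right
    obtain ⟨c, hc, hmin⟩ := Finset.exists_min_image C (fun c => ‖t - c x‖) ⟨0, by simp [C]⟩
    have hne : t - c x ≠ 0 := fun h => hx ⟨c, hc, sub_eq_zero.1 h⟩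
    obtain ⟨γ, a, ha, hpa, hE⟩ := E_exists_unit hne (L := L) (by omega)
    have hN : ∀ c' ∈ C, ¬ E (c' x - c x) γ 1 a := fun c' hc' => (near_iff (by omega) hpa hE).1 (hmin c' hc')
    have key : ∀ t', E (t' - c x) γ L a → ∀ δ, (‖(sp (Polynomial.derivative q) x).eval t'‖ = (p : ℝ) ^ (-δ) ↔ S c a (x, δ) γ) := by
      intro t' ht' δ
      exact (hS c a hc hpa).2 (x, δ) γ t' ht' fun c' hc' => (near_iff (by omega) hpa ht').2 (hN c' (Finset.mem_insert_of_mem hc'))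
    have hex : ∃ δ, S c a (x, δ) γ := by
      by_contra hcon
      push Not at hcon
      have hz : ∀ t', E (t' - c x) γ L a → (sp (Polynomial.derivative q) x).eval t' = 0 := by
        intro t' ht'
        by_contra h0
        obtain ⟨δ, hδ⟩ := exists_norm_eq h0
        exact hcon δ ((key t' ht' δ).1 hδ)
      have hinf : sp (Polynomial.derivative q) x = 0 := by
        apply Polynomial.eq_zero_of_infinite_isRoot
        refine Set.infinite_of_injective_forall_mem (f := fun n : ℕ => t + n * (p : ℚ_[p]) ^ (γ + L)) ?_ ?_
        · intro i j hij
          have h1 : (i : ℚ_[p]) * (p : ℚ_[p]) ^ (γ + L) = j * (p : ℚ_[p]) ^ (γ + L) := by simpa using hij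
          exact_mod_cast mul_right_cancel₀ (zpow_ne_zero _ pK_ne) h1
        · intro i
          refine hz _ (NiceBall.move hE le_rfl ?_)
          rw [add_sub_cancel_left, norm_mul, norm_zpow_p]
          exact mul_le_of_le_one_left (zpow_pos' _).le (by simpa using norm_int_le (p := p) i)
      rw [sp_derivative] at hinf
      have h0 := Polynomial.derivative_eq_zero.1 hinf
      have hm : (sp q x).natDegree = q.natDegree := hq.natDegree_map _
      omega
    obtain ⟨δ, hδ⟩ := hex
    exact ⟨c, hc, a, by simp [units, ha, hpa], γ, δ, hE, hN, hδ⟩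

end PIg

namespace PIg
open Set

variable {p : ℕ} [hp : Fact p.Prime]
set_option linter.unusedVariables false

section
variable {X : Type} {𝓡 : Subring (X → ℚ_[p])} {d : ℕ} {q : Polynomial 𝓡}
  {c : X → ℚ_[p]} {L κ m0 : ℕ} {a a0 : ℤ} {G : X → ℤ → ℤ → Prop} {ρ : X → ℚ_[p]}

lemma E_dist {y c r : ℚ_[p]} {γ a : ℤ} {M : ℕ} (h : E (y - c) γ M a) (h' : E (r - c) γ M a) :
    ‖y - r‖ ≤ (p : ℝ) ^ (-(γ + M)) := by
  have := norm_sub_le h h'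
  convert this using 2; ring

lemma root_ball (hc : c ∈ 𝓡) (hm : κ + 1 ≤ m0) (hL : L ≤ m0) (ha : (p ^ L : ℤ) ∣ a0 - a)
    (hN : ∀ x γ δ, G x γ δ → NiceBall (sp q x) (c x) γ δ L κ a)
    (hρ : ∀ x γ δ, G x γ δ → (sp q x).eval (ρ x) = 0 ∧ E (ρ x - c x) γ m0 a0)
    {M : ℕ} (hM : m0 ≤ M) {a2 : ℤ} (ha2 : (p ^ m0 : ℤ) ∣ a2 - a0) :
    ∃ W : X → ℤ → ℤ → Prop, T2 (𝓡 : Set (X → ℚ_[p])) W ∧ ∀ (x : X) (γ δ : ℤ), G x γ δ →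
      (W x γ δ ↔ E (ρ x - c x) γ M a2) := by
  have ha3 : (p ^ L : ℤ) ∣ a2 - a := by
    have := dvd_add ((pow_dvd_pow (p : ℤ) hL).trans ha2) ha
    simpa using this
  obtain ⟨W, hW, H⟩ := rootAt q hc (hm.trans hM) (hL.trans hM) ha3
  refine ⟨W, hW, fun x γ δ hG => ?_⟩
  rw [H x γ δ (hN x γ δ hG)]
  obtain ⟨h0, hE⟩ := hρ x γ δ hG
  constructor
  · rintro ⟨r, hr, hrE⟩
    have hr0 : E (r - c x) γ m0 a0 := (E_dvd ha2).1 (hrE.mono hM)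
    have hrL : E (ρ x - c x) γ L a := (E_dvd ha).1 (hE.mono hL)
    have := (hN x γ δ hG).unique hm hr hrL h0 (E_dist hr0 hE)
    rwa [← this]
  · intro h
    exact ⟨_, h0, h⟩

lemma root_sub_good (hc : c ∈ 𝓡) (hG : T2 (𝓡 : Set (X → ℚ_[p])) G) (hm : κ + 1 ≤ m0) (hL : L ≤ m0)
    (ha : (p ^ L : ℤ) ∣ a0 - a)
    (hN : ∀ x γ δ, G x γ δ → NiceBall (sp q x) (c x) γ δ L κ a)
    (hρ : ∀ x γ δ, G x γ δ → (sp q x).eval (ρ x) = 0 ∧ E (ρ x - c x) γ m0 a0)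
    (hρ0 : ∀ x, (¬ ∃ γ δ, G x γ δ) → ρ x = 0) {e : X → ℚ_[p]} (he : e ∈ 𝓡) :
    Good (𝓡 : Set (X → ℚ_[p])) (fun x => ρ x - e x) := by
  classical
  intro N k
  let m2 := max m0 (κ + N + 1)
  let M := N + m2
  have hm2 : m0 ≤ m2 := le_max_left _ _
  have hm3 : κ + N + 1 ≤ m2 := le_max_right _ _
  have hM : m0 ≤ M := hm2.trans (by omega)
  have hW : ∀ (M : ℕ) (a2 : ℕ), ∃ W : X → ℤ → ℤ → Prop, m0 ≤ M → (p ^ m0 : ℤ) ∣ (a2 : ℤ) - a0 →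
    T2 (𝓡 : Set (X → ℚ_[p])) W ∧ ∀ (x : X) (γ δ : ℤ), G x γ δ →
      (W x γ δ ↔ E (ρ x - c x) γ M a2) := by
    intro M a2
    by_cases h : m0 ≤ M ∧ (p ^ m0 : ℤ) ∣ (a2 : ℤ) - a0
    · obtain ⟨W, h1⟩ := root_ball hc hm hL ha hN hρ h.1 h.2
      exact ⟨W, fun _ _ => h1⟩
    · exact ⟨fun _ _ _ => True, fun h1 h2 => absurd ⟨h1, h2⟩ h⟩
  choose W hW using hW
  let A : ℕ → Finset ℕ := fun M => (Finset.range (p ^ M)).filter (fun a2 : ℕ => (p ^ m0 : ℤ) ∣ (a2 : ℤ) - a0)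
  have hA : ∀ {M a2}, a2 ∈ A M → (p ^ m0 : ℤ) ∣ (a2 : ℤ) - a0 := fun h => (Finset.mem_filter.1 h).2
  have hex : ∀ {M} {x γ δ}, m0 ≤ M → G x γ δ → ∃ a2 ∈ A M, E (ρ x - c x) γ M a2 := by
    intro M x γ δ hM hG
    have h1 := (hρ x γ δ hG).2
    obtain ⟨a2, h2, h3⟩ := E_exists M h1.le
    exact ⟨a2, by simp only [A, Finset.mem_filter, Finset.mem_range]; exact ⟨h2, (h3.mono hM).unique h1⟩, h3⟩
  let qe : X → ℚ_[p] := fun x => -(sp q x).eval (e x) / (sp (Polynomial.derivative q) x).eval (e x)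
  have hqe : Good (𝓡 : Set (X → ℚ_[p])) qe :=
    (Good.of_mem (r := fun x => -(sp q x).eval (e x)) (Subring.neg_mem _ (good_eval q he))).div (Good.of_mem (good_eval _ he))
  let V : X → ℤ → ℤ → ℤ → Prop := fun x z γ δ =>
    (z ≤ γ + m2 ∧ ∃ a2 ∈ A M, W M a2 x γ δ ∧ E3 ((e - c) x) γ a2 m2 z N k) ∨
    (γ + m2 < z ∧ ∃ a1 ∈ A m2, W m2 a1 x γ δ ∧ E ((e - c) x) γ m2 a1 ∧ E (qe x) z N k)
  have hV : ∀ x z γ δ, G x γ δ → (V x z γ δ ↔ E (ρ x - e x) z N k) := by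
    intro x z γ δ hG
    have e1 : ρ x - e x = (ρ x - c x) - (e - c) x := by simp
    have hNB := hN x γ δ hG
    obtain ⟨h0, hE0⟩ := hρ x γ δ hG
    have key : ∀ a1 : ℕ, a1 ∈ A m2 → E (ρ x - c x) γ m2 a1 → E (e x - c x) γ m2 a1 →
        (E (qe x) z N k ↔ E (ρ x - e x) z N k) := by
      intro a1 ha1 h1 h2
      have h3 : E (e x - c x) γ L a := by
        refine (E_dvd ha).1 ?_
        exact ((E_dvd (hA ha1)).1 (h2.mono hm2)).mono hL
      have h4 := hNB.close (N := N + 1) h0 h3 ((E_dist h1 h2).trans (zpow_le'.2 (by push_cast; omega)))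
      have h5 : (sp (Polynomial.derivative q) x).eval (e x) ≠ 0 := by
        rw [sp_derivative]
        intro h
        have := hNB.der _ h3
        rw [h, norm_zero] at this
        exact (zpow_pos' _).ne this
      rw [← sp_derivative] at h4
      refine E_close (N := N + 1) (by omega) (by omega) ?_
      have h6 : qe x - (ρ x - e x) = -((sp q x).eval (e x) - (sp (Polynomial.derivative q) x).eval (e x) * (e x - ρ x)) /
          (sp (Polynomial.derivative q) x).eval (e x) := by
        simp only [qe]; field_simp; ring
      rw [h6, norm_div, norm_neg, div_le_iff₀ (norm_pos_iff.2 h5)]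
      refine h4.trans_eq ?_
      rw [norm_mul, norm_sub_rev (e x)]; ring
    constructor
    · rintro (⟨hz, a2, h2, hW2, h3⟩ | ⟨hz, a1, h1, hW1, h2, h3⟩)
      · have := ((hW M a2 hM (hA h2)).2 x γ δ hG).1 hW2
        rw [e1]
        exact (E_sub_iff this le_rfl hz).2 h3
      · have h4 := ((hW m2 a1 hm2 (hA h1)).2 x γ δ hG).1 hW1
        exact (key a1 h1 h4 h2).1 h3
    · intro hE
      by_cases hz : z ≤ γ + m2
      · obtain ⟨a2, h2, h3⟩ := hex (M := M) hM hG
        refine Or.inl ⟨hz, a2, h2, ((hW M a2 hM (hA h2)).2 x γ δ hG).2 h3, ?_⟩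
        rw [e1] at hE
        exact (E_sub_iff h3 le_rfl hz).1 hE
      · push Not at hz
        obtain ⟨a1, h1, h2⟩ := hex (M := m2) hm2 hG
        have h3 : E (e x - c x) γ m2 a1 := by
          refine (E_congr ?_).1 h2
          rw [sub_sub_sub_cancel_right]
          exact hE.le.trans (zpow_le'.2 (by omega))
        exact Or.inr ⟨hz, a1, h1, ((hW m2 a1 hm2 (hA h1)).2 x γ δ hG).2 h2, h3, (key a1 h1 h2 h3).2 hE⟩
  refine Tame.congr (R := fun d => (¬ (∃ γ δ, G d.1 γ δ) ∧ E ((-e) d.1) d.2 N k) ∨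
    ∃ γ δ, G d.1 γ δ ∧ V d.1 d.2 γ δ) ?_ ?_
  · refine Tame.or (Tame.and (Tame.not (Tame.ex (Tame.ex ?_))) ?_) (Tame.ex (Tame.ex (Tame.and ?_ (Tame.or ?_ ?_))))
    · exact hG.app (ρ := fun d : ((X × ℤ) × ℤ) × ℤ => d.1.1.1) Lin.snd.fst Lin.snd
    · exact Tame.atom (r := -e) _ _ (Subring.neg_mem _ he) Lin.var
    · exact hG.app (ρ := fun d : ((X × ℤ) × ℤ) × ℤ => d.1.1.1) Lin.snd.fst Lin.snd
    · refine Tame.and (Tame.le Lin.var.fst.fst (Lin.snd.fst.add (Lin.const _))) (Tame.bex _ fun a2 h2 => Tame.and ?_ ?_)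
      · exact (hW M a2 hM (hA h2)).1.app (ρ := fun d : ((X × ℤ) × ℤ) × ℤ => d.1.1.1) Lin.snd.fst Lin.snd
      · exact (Good.of_mem (Subring.sub_mem _ he hc)).tame_E3 (ρ := fun d : ((X × ℤ) × ℤ) × ℤ => d.1.1.1) Lin.snd.fst Lin.var.fst.fst _ _ _ _
    · refine Tame.and (Tame.lt (Lin.snd.fst.add (Lin.const _)) Lin.var.fst.fst) (Tame.bex _ fun a2 h2 => Tame.and ?_ (Tame.and ?_ ?_))
      · exact (hW m2 a2 hm2 (hA h2)).1.app (ρ := fun d : ((X × ℤ) × ℤ) × ℤ => d.1.1.1) Lin.snd.fst Lin.snd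
      · exact (Good.of_mem (Subring.sub_mem _ he hc)).tame (ρ := fun d : ((X × ℤ) × ℤ) × ℤ => d.1.1.1) Lin.snd.fst _ _
      · exact hqe.tame (ρ := fun d : ((X × ℤ) × ℤ) × ℤ => d.1.1.1) Lin.var.fst.fst _ _
  · rintro ⟨x, z⟩
    dsimp only
    by_cases hP : ∃ γ δ, G x γ δ
    · obtain ⟨γ, δ, hg⟩ := hP
      constructor
      · intro h
        exact Or.inr ⟨γ, δ, hg, (hV x z γ δ hg).2 h⟩
      · rintro (⟨h, _⟩ | ⟨γ', δ', hg', h⟩)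
        · exact absurd ⟨γ, δ, hg⟩ h
        · exact (hV x z γ' δ' hg').1 h
    · rw [hρ0 x hP, zero_sub]
      constructor
      · intro h; exact Or.inl ⟨hP, h⟩
      · rintro (⟨_, h⟩ | ⟨γ', δ', hg', h⟩)
        · exact h
        · exact absurd ⟨γ', δ', hg'⟩ hP

lemma root_mem (h𝓡 : Closed 𝓡) (IH : CellIH 𝓡 d) (hq : q.Monic) (hd : q.natDegree = d + 1)
    (hc : c ∈ 𝓡) (hG : T2 (𝓡 : Set (X → ℚ_[p])) G) (hm : κ + 1 ≤ m0) (hL : L ≤ m0)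
    (ha : (p ^ L : ℤ) ∣ a0 - a)
    (hN : ∀ x γ δ, G x γ δ → NiceBall (sp q x) (c x) γ δ L κ a)
    (hρ : ∀ x γ δ, G x γ δ → (sp q x).eval (ρ x) = 0 ∧ E (ρ x - c x) γ m0 a0)
    (hρ0 : ∀ x, (¬ ∃ γ δ, G x γ δ) → ρ x = 0) : ρ ∈ 𝓡 := by
  refine h𝓡 ρ fun s => ?_
  refine Good.ite (P := fun x => ∃ γ δ, G x γ δ) (r := fun x => (sp (s %ₘ q) x).eval (ρ x))
    (r' := fun x => (sp s x).eval 0) ?_ ?_ ?_ ?_ ?_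
  · exact Tame.ex (Tame.ex (hG.app (ρ := fun d : (X × ℤ) × ℤ => d.1.1) Lin.snd.fst Lin.snd))
  · intro N k
    have hdeg : (s %ₘ q).natDegree ≤ d := by
      have := Polynomial.natDegree_modByMonic_lt s hq (by rintro rfl; simp at hd)
      omega
    have h1 := (IH _ hdeg N k).comap (fun w : X × ℤ => ((w.1, ρ w.1), w.2)) (𝓛' := {fun w => w.2})
      (by rintro _ rfl; exact Lin.var)
    refine h1.subst (ρ := fun w : X × ℤ => w.1) ?_
    rintro r (⟨r, hr, rfl⟩ | ⟨e, he, rfl⟩) L' k'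
    · exact Tame.atom _ _ hr Lin.snd
    · exact (root_sub_good hc hG hm hL ha hN hρ hρ0 he).tame (ρ := fun w : (X × ℤ) × ℤ => w.1.1) Lin.snd _ _
  · exact Good.of_mem (good_eval s (c := 0) (Subring.zero_mem _))
  · rintro x ⟨γ, δ, hg⟩
    have h0 := (hρ x γ δ hg).1
    conv_lhs => rw [← Polynomial.modByMonic_add_div s q]
    unfold sp at h0 ⊢
    rw [Polynomial.map_add, Polynomial.map_mul, Polynomial.eval_add, Polynomial.eval_mul, h0, zero_mul, add_zero]
  · intro x hx
    rw [hρ0 x hx]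

lemma exists_roots (h𝓡 : Closed 𝓡) (IH : CellIH 𝓡 d) (hq : q.Monic) (hd : q.natDegree = d + 1)
    (hc : c ∈ 𝓡) (hm : κ + 1 ≤ m0) (hL : L ≤ m0)
    (ha : (p ^ L : ℤ) ∣ a0 - a) (n : ℕ) : ∀ G : X → ℤ → ℤ → Prop, T2 (𝓡 : Set (X → ℚ_[p])) G →
    (∀ x γ δ, G x γ δ → NiceBall (sp q x) (c x) γ δ L κ a) →
    (∀ x γ δ, G x γ δ → ∃ r, (sp q x).eval r = 0 ∧ E (r - c x) γ m0 a0) →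
    (∀ x, ∀ s : Finset ℤ, (∀ γ ∈ s, ∃ δ, G x γ δ) → s.card ≤ n) →
    ∃ F : Finset (X → ℚ_[p]), (∀ r ∈ F, r ∈ 𝓡) ∧ ∀ x γ δ, G x γ δ → ∀ r, (sp q x).eval r = 0 →
      E (r - c x) γ m0 a0 → ∃ ρ ∈ F, ρ x = r := by
  classical
  induction n with
  | zero =>
    intro G hG hN hr hs
    refine ⟨∅, by simp, fun x γ δ hg => ?_⟩
    have := hs x {γ} (by simpa using ⟨δ, hg⟩)
    simp at this
  | succ n ih =>
    intro G hG hN hr hs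
    let G0 : X → ℤ → ℤ → Prop := fun x γ δ => G x γ δ ∧ ¬ ∃ γ' δ', γ' < γ ∧ G x γ' δ'
    let G1 : X → ℤ → ℤ → Prop := fun x γ δ => G x γ δ ∧ ∃ γ' δ', γ' < γ ∧ G x γ' δ'
    have hT : Tame (𝓡 : Set (X → ℚ_[p])) (fun d : (X × ℤ) × ℤ => d.1.1) (lift {fun d => d.2})
        (fun d => ∃ γ' δ', γ' < d.1.2 ∧ G d.1.1 γ' δ') := by
      refine Tame.ex (Tame.ex (Tame.and (Tame.lt Lin.snd.fst Lin.var.fst.fst.fst) ?_))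
      exact hG.app (ρ := fun d : (((X × ℤ) × ℤ) × ℤ) × ℤ => d.1.1.1.1) Lin.snd.fst Lin.snd
    have hG0 : T2 (𝓡 : Set (X → ℚ_[p])) G0 := Tame.and hG hT.not
    have hG1 : T2 (𝓡 : Set (X → ℚ_[p])) G1 := Tame.and hG hT
    obtain ⟨F, hF, HF⟩ := ih G1 hG1 (fun x γ δ h => hN x γ δ h.1) (fun x γ δ h => hr x γ δ h.1) (by
      intro x s hsG
      rcases s.eq_empty_or_nonempty with rfl | hne
      · simp
      obtain ⟨_, _, γ', δ', hlt, hg'⟩ := hsG _ (s.min'_mem hne)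
      have hni : γ' ∉ s := fun h => absurd (s.min'_le _ h) (by omega)
      have := hs x (insert γ' s) (by
        intro γ hγ
        rcases Finset.mem_insert.1 hγ with rfl | hγ
        · exact ⟨δ', hg'⟩
        · exact (hsG γ hγ).imp fun δ h => h.1)
      rw [Finset.card_insert_of_notMem hni] at this
      omega)
    have hex : ∀ x, ∃ y : ℚ_[p], (∀ γ δ, G0 x γ δ → (sp q x).eval y = 0 ∧ E (y - c x) γ m0 a0) ∧
        ((¬ ∃ γ δ, G0 x γ δ) → y = 0) := by
      intro x
      by_cases h : ∃ γ δ, G0 x γ δ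
      · obtain ⟨γ, δ, hg⟩ := h
        obtain ⟨r, hr⟩ := hr x γ δ hg.1
        refine ⟨r, fun γ' δ' hg' => ?_, fun h => absurd ⟨γ, δ, hg⟩ h⟩
        have : γ' = γ := by
          rcases lt_trichotomy γ' γ with h | h | h
          · exact absurd ⟨γ', δ', h, hg'.1⟩ hg.2
          · exact h
          · exact absurd ⟨γ, δ, h, hg.1⟩ hg'.2
        rw [this]; exact hr
      · exact ⟨0, fun γ δ hg => absurd ⟨γ, δ, hg⟩ h, fun _ => rfl⟩
    choose ρ hρ hρ0 using hex
    have hmem := root_mem h𝓡 IH hq hd hc hG0 hm hL ha (fun x γ δ h => hN x γ δ h.1) hρ hρ0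
    refine ⟨insert ρ F, ?_, ?_⟩
    · intro r hr
      rcases Finset.mem_insert.1 hr with rfl | hr
      · exact hmem
      · exact hF r hr
    · intro x γ δ hg r hr0 hE
      by_cases h : ∃ γ' δ', γ' < γ ∧ G x γ' δ'
      · obtain ⟨ρ', h1, h2⟩ := HF x γ δ ⟨hg, h⟩ r hr0 hE
        exact ⟨ρ', Finset.mem_insert_of_mem h1, h2⟩
      · refine ⟨ρ, Finset.mem_insert_self _ _, ?_⟩
        obtain ⟨h1, h2⟩ := hρ x γ δ ⟨hg, h⟩
        exact (hN x γ δ hg).unique hm h1 ((E_dvd ha).1 (hE.mono hL)) hr0 (E_dist h2 hE)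

lemma exists_roots' (h𝓡 : Closed 𝓡) (IH : CellIH 𝓡 d) (hq : q.Monic) (hd : q.natDegree = d + 1)
    (hc : c ∈ 𝓡) (hm : κ + 1 ≤ m0) (hL : L ≤ m0) (hL1 : 1 ≤ L) (hpa : ¬ (p : ℤ) ∣ a)
    (ha : (p ^ L : ℤ) ∣ a0 - a) (hG : T2 (𝓡 : Set (X → ℚ_[p])) G)
    (hN : ∀ x γ δ, G x γ δ → NiceBall (sp q x) (c x) γ δ L κ a) :
    ∃ F : Finset (X → ℚ_[p]), (∀ r ∈ F, r ∈ 𝓡) ∧ ∀ x γ δ, G x γ δ → ∀ r, (sp q x).eval r = 0 →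
      E (r - c x) γ m0 a0 → ∃ ρ ∈ F, ρ x = r := by
  classical
  obtain ⟨W, hW, HW⟩ := rootAt q hc hm hL ha
  obtain ⟨F, hF, H⟩ := exists_roots h𝓡 IH hq hd hc hm hL ha (d + 1) (fun x γ δ => G x γ δ ∧ W x γ δ)
    (Tame.and hG hW) (fun x γ δ h => hN x γ δ h.1) (fun x γ δ h => (HW x γ δ (hN x γ δ h.1)).1 h.2) (by
      intro x s hs
      choose! δ hδ using hs
      have : ∀ γ ∈ s, ∃ r, (sp q x).eval r = 0 ∧ E (r - c x) γ m0 a0 := fun γ hγ =>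
        (HW x γ _ (hN x γ _ (hδ γ hγ).1)).1 (hδ γ hγ).2
      choose! r hr0 hrE using this
      have hmon : (sp q x).Monic := hq.map _
      have hcard : s.card ≤ (sp q x).roots.toFinset.card := by
        refine Finset.card_le_card_of_injOn r ?_ ?_
        · intro γ hγ
          simp [hmon.ne_zero, hr0 γ hγ]
        · intro γ hγ γ' hγ' h
          have h1 := ((E_dvd ha).1 ((hrE γ hγ).mono hL)).norm_eq hL1 hpa
          have h2 := ((E_dvd ha).1 ((hrE γ' hγ').mono hL)).norm_eq hL1 hpa
          rw [h, h2] at h1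
          have := zpow_right_injective₀ p_pos one_lt_p.ne' h1
          simpa using this.symm
      calc s.card ≤ _ := hcard
        _ ≤ _ := Multiset.toFinset_card_le _
        _ ≤ _ := Polynomial.card_roots' _
        _ ≤ _ := sp_natDegree_le q x
        _ = _ := hd)
  exact ⟨F, hF, fun x γ δ hg r hr hE => H x γ δ ⟨hg, (HW x γ δ (hN x γ δ hg)).2 ⟨r, hr, hE⟩⟩ r hr hE⟩

end
end PIg

namespace PIg
open Set

variable {p : ℕ} [hp : Fact p.Prime]
set_option linter.unusedVariables false

section
variable {X : Type} {𝓡 : Subring (X → ℚ_[p])} {d : ℕ} {q : Polynomial 𝓡}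
  {c : X → ℚ_[p]} {L κ : ℕ} {a : ℤ} {G : X → ℤ → ℤ → Prop}

lemma good_sub (hc : c ∈ 𝓡) : Good (lin 𝓡) (fun w => w.2 - c w.1) :=
  Good.of_mem (Or.inr ⟨c, hc, rfl⟩)

lemma good_fst (hc : c ∈ 𝓡) : Good (lin 𝓡) (fun w => c w.1) :=
  Good.of_mem (Or.inl ⟨c, hc, rfl⟩)

lemma cell_one (h𝓡 : Closed 𝓡) (IH : CellIH 𝓡 d) (hq : q.Monic) (hd : q.natDegree = d + 1)
    (hc : c ∈ 𝓡) (hL1 : 1 ≤ L) (hpa : ¬ (p : ℤ) ∣ a) (hG : T2 (𝓡 : Set (X → ℚ_[p])) G)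
    (hN : ∀ x γ δ, G x γ δ → NiceBall (sp q x) (c x) γ δ L κ a) (L' : ℕ) (k' : ℤ) :
    ∃ T : X × ℚ_[p] → ℤ → ℤ → ℤ → Prop, T3 (lin 𝓡) T ∧ ∀ x t z γ δ, G x γ δ → E (t - c x) γ L a →
      (T (x, t) z γ δ ↔ E ((sp q x).eval t) z L' k') := by
  classical
  let m0 := max (κ + L' + 1) L
  have hm0 : κ + L' + 1 ≤ m0 := le_max_left _ _
  have hL0 : L ≤ m0 := le_max_right _ _
  let m := κ + m0
  choose W hW HW using fun a' : ℕ => polyE q hc κ m L' k' a'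
  let A : Finset ℕ := (Finset.range (p ^ m0)).filter (fun a0 : ℕ => (p ^ L : ℤ) ∣ (a0 : ℤ) - a)
  have hA : ∀ {a0}, a0 ∈ A → (p ^ L : ℤ) ∣ (a0 : ℤ) - a := fun h => (Finset.mem_filter.1 h).2
  have hF : ∀ a0 : ℕ, ∃ F : Finset (X → ℚ_[p]), a0 ∈ A → (∀ r ∈ F, r ∈ 𝓡) ∧ ∀ x γ δ, G x γ δ →
      ∀ r, (sp q x).eval r = 0 → E (r - c x) γ m0 a0 → ∃ ρ ∈ F, ρ x = r := by
    intro a0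
    by_cases h : a0 ∈ A
    · obtain ⟨F, h1⟩ := exists_roots' h𝓡 IH hq hd hc (m0 := m0) (by omega) hL0 hL1 hpa (hA h) hG hN
      exact ⟨F, fun _ => h1⟩
    · exact ⟨∅, fun h' => absurd h' h⟩
  choose F hF using hF
  refine ⟨fun w z γ δ =>
    (z ≤ δ + γ + m0 ∧ ∃ a' ∈ Finset.range (p ^ (L' + m)), E (w.2 - c w.1) γ (L' + m) (a' : ℕ) ∧ W a' w.1 γ δ z) ∨
    (δ + γ + m0 < z ∧ ∃ a0 ∈ A, E (w.2 - c w.1) γ m0 (a0 : ℕ) ∧ ∃ ρ ∈ F a0, E ((ρ - c) w.1) γ m0 (a0 : ℕ) ∧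
      (sp q w.1).eval (ρ w.1) = 0 ∧
      E ((sp (Polynomial.derivative q) w.1).eval w.2 * (w.2 - ρ w.1)) z L' k'), ?_, ?_⟩
  · have lz := Lin.var (X := X × ℚ_[p]) |>.fst.fst
    have lγ : Lin (lift (lift {fun d : (X × ℚ_[p]) × ℤ => d.2})) (fun d => d.1.2) := Lin.snd.fst
    have lδ : Lin (lift (lift {fun d : (X × ℚ_[p]) × ℤ => d.2})) (fun d => d.2) := Lin.snd
    have ls := (lδ.add lγ).add (Lin.const (m0 : ℤ))
    refine Tame.or (Tame.and (Tame.le lz ls) (Tame.bex _ fun a' _ => Tame.and ?_ ?_))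
      (Tame.and (Tame.lt ls lz) (Tame.bex _ fun a0 h0 => Tame.and ?_ (Tame.bex _ fun ρ hρ => ?_)))
    · exact (good_sub hc).tame (ρ := fun d : (((X × ℚ_[p]) × ℤ) × ℤ) × ℤ => d.1.1.1) lγ _ _
    · exact lift_lin ((hW a').app (ρ := fun d : (((X × ℚ_[p]) × ℤ) × ℤ) × ℤ => d.1.1.1.1) lγ lδ lz)
    · exact (good_sub hc).tame (ρ := fun d : (((X × ℚ_[p]) × ℤ) × ℤ) × ℤ => d.1.1.1) lγ _ _
    · have hρ' := (hF a0 h0).1 ρ hρ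
      refine Tame.and ?_ (Tame.and ?_ ?_)
      · exact (good_fst (Subring.sub_mem _ hρ' hc)).tame (ρ := fun d : (((X × ℚ_[p]) × ℤ) × ℤ) × ℤ => d.1.1.1) lγ _ _
      · exact (good_fst (good_eval q hρ')).tame_zero (ρ := fun d : (((X × ℚ_[p]) × ℤ) × ℤ) × ℤ => d.1.1.1)
      · have hder : Good (lin 𝓡) (fun w => (sp (Polynomial.derivative q) w.1).eval w.2) :=
          IH _ ((Polynomial.natDegree_derivative_le q).trans (by omega))
        exact (hder.mul_lin (good_sub hρ')).tame (ρ := fun d : (((X × ℚ_[p]) × ℤ) × ℤ) × ℤ => d.1.1.1) lz _ _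
  · intro x t z γ δ hg hE
    have hNB := hN x γ δ hg
    have key : ∀ ρ : ℚ_[p], (sp q x).eval ρ = 0 → ‖ρ - t‖ ≤ (p : ℝ) ^ (-(γ + m0)) →
        (E ((sp q x).eval t) z L' k' ↔ E ((sp (Polynomial.derivative q) x).eval t * (t - ρ)) z L' k') := by
      intro ρ h0 hρ
      rw [sp_derivative]
      exact E_close (N := L' + 1) (by omega) (by omega)
        (hNB.close h0 hE (hρ.trans (zpow_le'.2 (by push_cast; omega))))
    constructor
    · rintro (⟨hz, a', _, h1, h2⟩ | ⟨hz, a0, h0, h1, ρ, hρ, h2, h3, h4⟩)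
      · exact (HW a' x γ δ z t hNB.coef h1 (by simp only [m]; push_cast; omega)).2 h2
      · exact (key (ρ x) h3 (E_dist h2 h1)).2 h4
    · intro hE'
      by_cases hz : z ≤ δ + γ + m0
      · obtain ⟨a', h1, h2⟩ := E_exists (L' + m) hE.le
        exact Or.inl ⟨hz, a', Finset.mem_range.2 h1, h2,
          (HW a' x γ δ z t hNB.coef h2 (by simp only [m]; push_cast; omega)).1 hE'⟩
      · right
        refine ⟨by omega, ?_⟩
        obtain ⟨a0, h1, h2⟩ := E_exists m0 hE.le
        have h0 : a0 ∈ A := by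
          simp only [A, Finset.mem_filter, Finset.mem_range]
          exact ⟨h1, (h2.mono hL0).unique hE⟩
        obtain ⟨r, hr, hrt⟩ := hNB.exists_root (m := m0) (by omega) hL0 hE (hE'.le.trans (zpow_le'.2 (by omega)))
        have hrE : E (r - c x) γ m0 a0 := by
          refine (E_congr ?_).2 h2
          rwa [sub_sub_sub_cancel_right]
        obtain ⟨ρ, hρ, rfl⟩ := (hF a0 h0).2 x γ δ hg r hr hrE
        exact ⟨a0, h0, h2, ρ, hρ, hrE, hr, (key _ hr hrt).1 hE'⟩

lemma cell_monic (h𝓡 : Closed 𝓡) (IH : CellIH 𝓡 d) (hq : q.Monic) (hd : q.natDegree = d + 1) :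
    Good (lin 𝓡) (fun w => (sp q w.1).eval w.2) := by
  classical
  obtain ⟨C, hC, L, hL, κ, Cell, hCell, hNB, hcov⟩ := exists_decomp IH hq hd
  intro L' k'
  have hT : ∀ (c : X → ℚ_[p]) (a : ℕ), ∃ T : X × ℚ_[p] → ℤ → ℤ → ℤ → Prop, c ∈ C → a ∈ units p L →
      T3 (lin 𝓡) T ∧ ∀ x t z γ δ, Cell c a x γ δ → E (t - c x) γ L a →
      (T (x, t) z γ δ ↔ E ((sp q x).eval t) z L' k') := by
    intro c a
    by_cases h : c ∈ C ∧ a ∈ units p L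
    · obtain ⟨T, hT⟩ := cell_one h𝓡 IH hq hd (hC c h.1) hL (Finset.mem_filter.1 h.2).2
        (hCell c h.1 a h.2) (hNB c h.1 a h.2) L' k'
      exact ⟨T, fun _ _ => hT⟩
    · exact ⟨fun _ _ _ _ => True, fun h1 h2 => absurd ⟨h1, h2⟩ h⟩
  choose T hT using hT
  refine Tame.congr (R := fun d => (∃ c ∈ C, d.1.2 - c d.1.1 = 0 ∧ E ((sp q d.1.1).eval (c d.1.1)) d.2 L' k') ∨
    ∃ c ∈ C, ∃ a ∈ units p L, ∃ γ δ, E (d.1.2 - c d.1.1) γ L (a : ℕ) ∧ Cell c a d.1.1 γ δ ∧ T c a d.1 d.2 γ δ) ?_ ?_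
  · refine Tame.or (Tame.bex _ fun c hc => Tame.and ?_ ?_) (Tame.bex _ fun c hc => Tame.bex _ fun a ha =>
      Tame.ex (Tame.ex (Tame.and ?_ (Tame.and ?_ ?_))))
    · exact (good_sub (hC c hc)).tame_zero (ρ := fun d : (X × ℚ_[p]) × ℤ => d.1)
    · exact (good_fst (good_eval q (hC c hc))).tame (ρ := fun d : (X × ℚ_[p]) × ℤ => d.1) Lin.var _ _
    · exact (good_sub (hC c hc)).tame (ρ := fun d : (((X × ℚ_[p]) × ℤ) × ℤ) × ℤ => d.1.1.1) Lin.snd.fst _ _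
    · exact lift_lin ((hCell c hc a ha).app (ρ := fun d : (((X × ℚ_[p]) × ℤ) × ℤ) × ℤ => d.1.1.1.1) Lin.snd.fst Lin.snd)
    · exact (hT c a hc ha).1
  · rintro ⟨⟨x, t⟩, z⟩
    dsimp only
    constructor
    · intro hE
      rcases hcov x t with ⟨c, hc, rfl⟩ | ⟨c, hc, a, ha, γ, δ, h1, h2⟩
      · exact Or.inl ⟨c, hc, sub_self _, hE⟩
      · exact Or.inr ⟨c, hc, a, ha, γ, δ, h1, h2, ((hT c a hc ha).2 x t z γ δ h2 h1).2 hE⟩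
    · rintro (⟨c, hc, h0, hE⟩ | ⟨c, hc, a, ha, γ, δ, h1, h2, h3⟩)
      · rw [sub_eq_zero.1 h0]; exact hE
      · exact ((hT c a hc ha).2 x t z γ δ h2 h1).1 h3

theorem cellIH (h𝓡 : Closed 𝓡) (d : ℕ) : CellIH 𝓡 d := by
  induction d with
  | zero =>
    intro q hq
    have := good_fst (q.coeff 0).2
    convert this using 2 with w
    rw [Polynomial.eq_C_of_natDegree_le_zero ((sp_natDegree_le q w.1).trans hq), Polynomial.eval_C, sp_coeff]
  | succ d IH =>
    intro q hq
    rcases hq.lt_or_eq with hlt | heq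
    · exact IH q (by omega)
    let b : 𝓡 := q.leadingCoeff
    let bi : 𝓡 := ⟨_, h𝓡.inv b.2⟩
    let q1 : Polynomial 𝓡 := Polynomial.X ^ (d + 1) + Polynomial.C bi * q.eraseLead
    have hdeg : (Polynomial.C bi * q.eraseLead).degree < (d + 1 : ℕ) := by
      refine lt_of_le_of_lt (Polynomial.degree_le_natDegree) ?_
      have h1 : (Polynomial.C bi * q.eraseLead).natDegree ≤ d := by
        refine (Polynomial.natDegree_C_mul_le _ _).trans ?_
        have := Polynomial.eraseLead_natDegree_le q
        omega
      exact_mod_cast Nat.lt_succ_of_le h1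
    have hmon : q1.Monic := Polynomial.monic_X_pow_add hdeg
    have hnt : Nontrivial 𝓡 := by
      by_contra h
      rw [not_nontrivial_iff_subsingleton] at h
      have : q = 0 := Subsingleton.elim _ _
      simp [this] at heq
    have hnd : q1.natDegree = d + 1 := by
      rw [Polynomial.natDegree_add_eq_left_of_degree_lt, Polynomial.natDegree_X_pow]
      rwa [Polynomial.degree_X_pow]
    have hg1 := cell_monic h𝓡 IH hmon hnd
    have hge := IH q.eraseLead (by have := Polynomial.eraseLead_natDegree_le q; omega)
    have hsplit : ∀ x t, (sp q x).eval t = (b : X → ℚ_[p]) x * t ^ (d + 1) + (sp q.eraseLead x).eval t := by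
      intro x t
      conv_lhs => rw [← Polynomial.eraseLead_add_C_mul_X_pow q]
      unfold sp
      simp only [Polynomial.map_add, Polynomial.map_mul, Polynomial.map_pow, Polynomial.map_X, Polynomial.map_C,
        Polynomial.eval_add, Polynomial.eval_mul, Polynomial.eval_C, Polynomial.eval_pow, Polynomial.eval_X, heq]
      rw [add_comm]; rfl
    refine Good.ite (P := fun w : X × ℚ_[p] => (b : X → ℚ_[p]) w.1 = 0)
      ((good_fst b.2).tame_zero (ρ := fun w => w)) hge ((good_fst b.2).mul_lin hg1) ?_ ?_
    · rintro ⟨x, t⟩ hx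
      rw [hsplit, show (b : X → ℚ_[p]) x = 0 from hx, zero_mul, zero_add]
    · rintro ⟨x, t⟩ hx
      have hx' : (b : X → ℚ_[p]) x ≠ 0 := hx
      dsimp only
      rw [hsplit]
      have : (sp q1 x).eval t = t ^ (d + 1) + ((b : X → ℚ_[p]) x)⁻¹ * (sp q.eraseLead x).eval t := by
        simp only [q1]
        unfold sp
        simp only [Polynomial.map_add, Polynomial.map_mul, Polynomial.map_pow, Polynomial.map_X, Polynomial.map_C,
          Polynomial.eval_add, Polynomial.eval_mul, Polynomial.eval_C, Polynomial.eval_pow, Polynomial.eval_X]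
        rfl
      rw [this]
      field_simp

end
end PIg

namespace PIg
open Set MeasureTheory

variable {p : ℕ} [hp : Fact p.Prime]
set_option linter.unusedVariables false
set_option linter.unusedSectionVars false

noncomputable instance instMS : MeasurableSpace ℚ_[p] := borel _
instance instBS : BorelSpace ℚ_[p] := ⟨rfl⟩

/-- balls -/
def Bl (p : ℕ) [Fact p.Prime] (k : ℤ) (c : ℚ_[p]) : Set ℚ_[p] := {t | ‖t - c‖ ≤ (p : ℝ) ^ (-k)}

lemma Bl_eq (k : ℤ) (c : ℚ_[p]) : Bl p k c = Metric.closedBall c ((p : ℝ) ^ (-k)) := by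
  ext t; simp [Bl, dist_eq_norm]

lemma Bl_meas (k : ℤ) (c : ℚ_[p]) : MeasurableSet (Bl p k c) := by
  rw [Bl_eq]; exact Metric.isClosed_closedBall.measurableSet

/-- the unit ball as compact set -/
noncomputable def unitBall (p : ℕ) [Fact p.Prime] : TopologicalSpace.PositiveCompacts ℚ_[p] where
  carrier := Metric.closedBall 0 1
  isCompact' := isCompact_closedBall 0 1
  interior_nonempty' := ⟨0, mem_interior_iff_mem_nhds.2 (Metric.closedBall_mem_nhds _ one_pos)⟩

/-- normalized Haar measure -/
noncomputable def haar (p : ℕ) [Fact p.Prime] : Measure ℚ_[p] := Measure.addHaarMeasure (unitBall p)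

instance : (haar p).IsAddHaarMeasure := by unfold haar; infer_instance

lemma haar_Bl_zero : haar p (Bl p 0 0) = 1 := by
  have := Measure.addHaarMeasure_self (K₀ := unitBall p)
  have h0 : ((p : ℝ) ^ (-(0:ℤ))) = 1 := by simp
  rw [Bl_eq, h0]
  exact this

lemma haar_Bl_c (k : ℤ) (c : ℚ_[p]) : haar p (Bl p k c) = haar p (Bl p k 0) := by
  have : Bl p k 0 = (fun t => t + c) ⁻¹' Bl p k c := by
    ext t; simp [Bl]
  rw [this, measure_preimage_add_right]

lemma pE_ne : (p : ENNReal) ≠ 0 := by exact_mod_cast hp.1.ne_zero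
lemma pE_top : (p : ENNReal) ≠ ⊤ := ENNReal.natCast_ne_top p
lemma pE_add (m n : ℤ) : (p : ENNReal) ^ (m + n) = (p : ENNReal) ^ m * (p : ENNReal) ^ n :=
  ENNReal.zpow_add pE_ne pE_top m n
lemma pE_ne' (m : ℤ) : (p : ENNReal) ^ m ≠ 0 := (ENNReal.zpow_pos pE_ne pE_top m).ne'
lemma pE_top' (m : ℤ) : (p : ENNReal) ^ m ≠ ⊤ := (ENNReal.zpow_lt_top pE_ne pE_top m).ne

lemma mem_Bl_iff {y c : ℚ_[p]} {k : ℤ} {L : ℕ} {j : ℤ} : E (y - c) k L j ↔ y ∈ Bl p (k + L) (c + j * (p : ℚ_[p]) ^ k) := by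
  unfold E Bl
  rw [mem_ofPred_eq, sub_sub]

lemma Bl_union (k : ℤ) (c : ℚ_[p]) (L : ℕ) :
    Bl p k c = ⋃ j : Fin (p ^ L), Bl p (k + L) (c + ((j : ℕ) : ℤ) * (p : ℚ_[p]) ^ k) := by
  ext t
  rw [mem_iUnion]
  simp_rw [← mem_Bl_iff]
  constructor
  · intro h
    obtain ⟨j, hj, hE⟩ := E_exists L (y := t - c) (σ := k) h
    exact ⟨⟨j, hj⟩, hE⟩
  · rintro ⟨j, hj⟩
    exact hj.le

lemma Bl_disj (k : ℤ) (c : ℚ_[p]) (L : ℕ) :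
    Pairwise (Function.onFun Disjoint fun j : Fin (p ^ L) => Bl p (k + L) (c + ((j : ℕ) : ℤ) * (p : ℚ_[p]) ^ k)) := by
  intro i j hij
  rw [Function.onFun, Set.disjoint_left]
  intro t hi hj
  rw [← mem_Bl_iff] at hi hj
  have h := hi.unique hj
  apply hij
  have h2 : (i : ℕ) ≡ j [MOD p ^ L] := by
    rw [Nat.ModEq.comm, Nat.modEq_iff_dvd]
    exact_mod_cast h
  exact Fin.ext (Nat.ModEq.eq_of_lt_of_lt h2 i.2 j.2)

lemma haar_Bl_succ (k : ℤ) : haar p (Bl p k 0) = p * haar p (Bl p (k + 1) 0) := by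
  have h1 := Bl_union (p := p) k 0 1
  rw [h1, measure_iUnion (Bl_disj k 0 1) (fun _ => Bl_meas _ _), tsum_fintype]
  simp_rw [haar_Bl_c]
  simp

lemma haar_Bl (k : ℤ) (c : ℚ_[p]) : haar p (Bl p k c) = (p : ENNReal) ^ (-k) := by
  rw [haar_Bl_c]
  induction k using Int.induction_on with
  | zero => simp [haar_Bl_zero]
  | succ k ih =>
    rw [haar_Bl_succ] at ih
    have : (p : ENNReal) * haar p (Bl p (k + 1) 0) = p * (p : ENNReal) ^ (-((k : ℤ) + 1)) := by
      rw [ih]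
      nth_rewrite 2 [← zpow_one (p : ENNReal)]
      rw [← pE_add]; congr 1; ring
    exact (ENNReal.mul_right_inj pE_ne pE_top).1 this
  | pred k ih =>
    rw [haar_Bl_succ]
    simp only [sub_add_cancel]
    rw [ih]
    nth_rewrite 1 [← zpow_one (p : ENNReal)]
    rw [← pE_add]; congr 1; ring

instance : NullSingletonClass (haar p) := by
  constructor
  intro x
  have h : ∀ n : ℕ, haar p {x} ≤ (p : ENNReal) ^ (-(n : ℤ)) := by
    intro n
    rw [← haar_Bl (n : ℤ) x]
    apply measure_mono
    intro y hy
    rw [mem_singleton_iff.1 hy]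
    simp [Bl]
  by_contra h0
  have hlt : ((p : ENNReal)⁻¹) < 1 := by
    rw [ENNReal.inv_lt_one]; exact_mod_cast hp.1.one_lt
  obtain ⟨n, hn⟩ := ((ENNReal.tendsto_pow_atTop_nhds_zero_of_lt_one hlt).eventually_lt_const (pos_iff_ne_zero.2 h0)).exists
  have := h n
  rw [ENNReal.zpow_neg, zpow_natCast, ENNReal.inv_pow] at this
  exact absurd this (not_le.2 hn)

/-- integration over the unit ball -/
noncomputable def nu (p : ℕ) [Fact p.Prime] : Measure ℚ_[p] := (haar p).restrict (Bl p 0 0)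

end PIg

namespace PIg
open Set MeasureTheory

variable {p : ℕ} [hp : Fact p.Prime]
set_option linter.unusedVariables false
set_option linter.unusedSectionVars false

open scoped Classical in
theorem meas_tame {X Δ : Type} {𝓡 : Subring (X → ℚ_[p])} {ρ : Δ → X × ℚ_[p]} {𝓛 : Set (Δ → ℤ)}
    {R : Δ → Prop} (h : Tame (lin 𝓡) ρ 𝓛 R) {Γ : Type} (σ : Γ → X) (𝓛' : Set (Γ → ℤ))
    (φ : Γ → ℚ_[p] → Δ) (hρ : ∀ g t, ρ (φ g t) = (σ g, t))
    (h𝓛 : ∀ ℓ ∈ 𝓛, ∃ ℓ₀, Lin 𝓛' ℓ₀ ∧ ∀ g t, ℓ (φ g t) = ℓ₀ g) :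
    ∃ (ι : Type) (_ : Fintype ι) (L : ℕ) (S : ι → Γ → ℤ → Prop),
      (∀ i, Tame (𝓡 : Set (X → ℚ_[p])) (fun q : Γ × ℤ => σ q.1) (lift 𝓛') (fun q => S i q.1 q.2)) ∧
      ∀ g, MeasurableSet {t | R (φ g t)} ∧
        haar p {t | R (φ g t)} = ∑ i, ∑' γ : ℤ, if S i g γ then (p : ENNReal) ^ (-(γ + L)) else 0 := by
  obtain ⟨C₀, hC₀, L₀, H⟩ := SCR h σ 𝓛' φ hρ h𝓛
  let C := insert 0 C₀
  have hC : ∀ c ∈ C, c ∈ 𝓡 := by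
    intro c hc
    rcases Finset.mem_insert.1 hc with rfl | hc
    · exact Subring.zero_mem _
    · exact hC₀ c hc
  let e := C.equivFin
  let N := C.card
  let cc : Fin N → X → ℚ_[p] := fun i => (e.symm i : X → ℚ_[p])
  have hcc : ∀ i, cc i ∈ 𝓡 := fun i => hC _ (e.symm i).2
  have hcov : ∀ c ∈ C, ∃ i, cc i = c := fun c hc => ⟨e ⟨c, hc⟩, by simp [cc]⟩
  obtain ⟨i0, -⟩ := hcov 0 (Finset.mem_insert_self _ _)
  let L := L₀ + 1
  have hua : ∀ a : units p L, ¬ (p : ℤ) ∣ ((a : ℕ) : ℤ) := fun a => (Finset.mem_filter.1 a.2).2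
  choose S hS1 hS2 using fun (i : Fin N) (a : units p L) => H (cc i) (hcc i) L (by omega) ((a : ℕ) : ℤ) (hua a)
  let cond : Fin N → units p L → Γ → ℤ → Prop := fun i a g γ =>
    S i a g γ ∧ (∀ j, ¬ E (cc j (σ g) - cc i (σ g)) γ 1 ((a : ℕ) : ℤ)) ∧
      ∀ j, j < i → ¬ E (cc j (σ g) - cc i (σ g)) γ 0 0
  have hsub : ∀ i j, (fun x => cc j x - cc i x) ∈ 𝓡 := fun i j => Subring.sub_mem _ (hcc j) (hcc i)
  refine ⟨Fin N × units p L, inferInstance, L, fun i => cond i.1 i.2, ?_, ?_⟩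
  · rintro ⟨i, a⟩
    refine (hS1 i a).and (Tame.and (Tame.allf fun j => ?_) (Tame.allf fun j => ?_))
    · exact (Tame.atom (r := fun x => cc j x - cc i x) (ρ := fun q : Γ × ℤ => σ q.1) 1 _ (hsub i j) Lin.snd).not
    · exact (Tame.const _).imp (Tame.atom (r := fun x => cc j x - cc i x) (ρ := fun q : Γ × ℤ => σ q.1) 0 _ (hsub i j) Lin.snd).not
  · intro g
    let A := {t | R (φ g t)}
    let F : Set ℚ_[p] := Set.range (fun i => cc i (σ g))
    have hF : F.Finite := Set.finite_range _
    let B : (Fin N × units p L) × ℤ → Set ℚ_[p] := fun q =>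
      if cond q.1.1 q.1.2 g q.2 then Bl p (q.2 + L) (cc q.1.1 (σ g) + (((q.1.2 : ℕ) : ℤ) : ℚ_[p]) * (p : ℚ_[p]) ^ q.2) else ∅
    have hB : ∀ i a γ t, t ∈ B ((i, a), γ) ↔ cond i a g γ ∧ E (t - cc i (σ g)) γ L ((a : ℕ) : ℤ) := by
      intro i a γ t
      simp only [B]
      split_ifs with hc
      · simp only [hc, true_and]; rw [mem_Bl_iff]
      · simp [hc]
    have hnear : ∀ i a γ t, cond i a g γ → E (t - cc i (σ g)) γ L ((a : ℕ) : ℤ) →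
        (∀ j, ‖t - cc i (σ g)‖ ≤ ‖t - cc j (σ g)‖) ∧ (∀ j, j < i → ‖t - cc i (σ g)‖ < ‖t - cc j (σ g)‖) := by
      intro i a γ t hc hE
      refine ⟨fun j => (near_iff (by omega) (hua a) hE).2 (hc.2.1 j), fun j hj => ?_⟩
      have h1 := hc.2.2 j hj
      rw [E_zero_iff] at h1
      rw [hE.norm_eq (by omega) (hua a)]
      by_contra h2
      apply h1
      have e1 : cc j (σ g) - cc i (σ g) = (t - cc i (σ g)) - (t - cc j (σ g)) := by ring
      rw [e1]
      exact norm_sub_le (hE.norm_eq (by omega) (hua a)).le (not_lt.1 h2)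
    have hAB : A \ F = ⋃ q, B q := by
      ext t
      simp only [mem_iUnion, Prod.exists, hB]
      constructor
      · rintro ⟨hA, hF'⟩
        obtain ⟨m, -, hm⟩ := Finset.exists_min_image Finset.univ (fun j => ‖t - cc j (σ g)‖) ⟨i0, Finset.mem_univ _⟩
        let s := Finset.univ.filter (fun j => ‖t - cc j (σ g)‖ = ‖t - cc m (σ g)‖)
        have hs : s.Nonempty := ⟨m, by simp [s]⟩
        let i := s.min' hs
        have hi : ‖t - cc i (σ g)‖ = ‖t - cc m (σ g)‖ := (Finset.mem_filter.1 (s.min'_mem hs)).2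
        have hi1 : ∀ j, ‖t - cc i (σ g)‖ ≤ ‖t - cc j (σ g)‖ := fun j => hi ▸ hm j (Finset.mem_univ _)
        have hi2 : ∀ j, j < i → ‖t - cc i (σ g)‖ < ‖t - cc j (σ g)‖ := by
          intro j hj
          refine lt_of_le_of_ne (hi1 j) fun h => ?_
          exact absurd (s.min'_le j (by simp [s, ← h, hi])) (not_le.2 hj)
        have hne : t - cc i (σ g) ≠ 0 := by
          intro h0
          exact hF' ⟨i, (sub_eq_zero.1 h0).symm⟩
        obtain ⟨γ, a, ha, hpa, hE⟩ := E_exists_unit (L := L) hne (by omega)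
        have hau : a ∈ units p L := Finset.mem_filter.2 ⟨Finset.mem_range.2 ha, by exact_mod_cast hpa⟩
        refine ⟨i, ⟨a, hau⟩, γ, ⟨?_, ?_, ?_⟩, hE⟩
        · refine (hS2 i ⟨a, hau⟩ g γ t hE fun c hc => ?_).1 hA
          obtain ⟨j, hj⟩ := hcov c (Finset.mem_insert_of_mem hc)
          rw [← hj]; exact hi1 j
        · exact fun j => (near_iff (by omega) (hua ⟨a, hau⟩) hE).1 (hi1 j)
        · intro j hj h1
          rw [E_zero_iff] at h1
          have h2 := hi2 j hj
          have h3 := hE.norm_eq (by omega) (hua ⟨a, hau⟩)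
          have e1 : t - cc j (σ g) = (t - cc i (σ g)) - (cc j (σ g) - cc i (σ g)) := by ring
          have := norm_sub_le h3.le h1
          rw [← e1, ← h3] at this
          exact absurd this (not_le.2 h2)
      · rintro ⟨i, a, γ, hc, hE⟩
        obtain ⟨h1, h2⟩ := hnear i a γ t hc hE
        constructor
        · refine (hS2 i a g γ t hE fun c hc => ?_).2 hc.1
          obtain ⟨j, hj⟩ := hcov c (Finset.mem_insert_of_mem hc)
          rw [← hj]; exact h1 j
        · rintro ⟨j, hj⟩
          have h3 := h1 j
          dsimp only at hj
          rw [← hj, sub_self, norm_zero, hj, hE.norm_eq (by omega) (hua a)] at h3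
          exact absurd h3 (not_le.2 (zpow_pos' _))
    have hBm : ∀ q, MeasurableSet (B q) := by
      intro q
      simp only [B]
      split_ifs
      · exact Bl_meas _ _
      · exact MeasurableSet.empty
    have hdisj : Pairwise (Function.onFun Disjoint B) := by
      rintro ⟨⟨i, a⟩, γ⟩ ⟨⟨i', a'⟩, γ'⟩ hne
      rw [Function.onFun, Set.disjoint_left]
      intro t ht ht'
      rw [hB] at ht ht'
      obtain ⟨h1, h2⟩ := hnear _ _ _ _ ht.1 ht.2
      obtain ⟨h1', h2'⟩ := hnear _ _ _ _ ht'.1 ht'.2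
      have hii : i = i' := by
        rcases lt_trichotomy i i' with h | h | h
        · exact absurd (h1 i') (not_le.2 (h2' i h))
        · exact h
        · exact absurd (h1' i) (not_le.2 (h2 i' h))
      subst hii
      have e1 := ht.2.norm_eq (by omega) (hua a)
      have e2 := ht'.2.norm_eq (by omega) (hua a')
      have hγ : γ = γ' := by
        rw [e1] at e2
        have := zpow_right_injective₀ (p_pos (p := p)) (one_lt_p (p := p)).ne' e2
        omega
      subst hγ
      have hu := ht.2.unique ht'.2
      have h2 : (a : ℕ) ≡ (a' : ℕ) [MOD p ^ L] := by
        rw [Nat.ModEq.comm, Nat.modEq_iff_dvd]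
        exact_mod_cast hu
      have := Nat.ModEq.eq_of_lt_of_lt h2 (Finset.mem_range.1 (Finset.mem_filter.1 a.2).1)
        (Finset.mem_range.1 (Finset.mem_filter.1 a'.2).1)
      exact hne (by rw [Subtype.ext this])
    have hAm : MeasurableSet A := by
      have : A = (⋃ q, B q) ∪ (A ∩ F) := by rw [← hAB, Set.sdiff_union_inter]
      rw [this]
      exact (MeasurableSet.iUnion hBm).union (hF.subset inter_subset_right).measurableSet
    refine ⟨hAm, ?_⟩
    have hF0 : haar p F = 0 := hF.measure_zero _
    change haar p A = _
    rw [← measure_sdiff_null hF0, hAB, measure_iUnion hdisj hBm, ENNReal.tsum_prod', tsum_fintype]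
    refine Finset.sum_congr rfl fun i _ => tsum_congr fun γ => ?_
    simp only [B]
    split_ifs
    · rw [haar_Bl]
    · simp


/-- adjoining one more variable -/
def ext {X : Type} (𝓡 : Subring (X → ℚ_[p])) : Subring (X × ℚ_[p] → ℚ_[p]) where
  carrier := {f | ∃ q : Polynomial 𝓡, f = fun w => (sp q w.1).eval w.2}
  mul_mem' := by
    rintro _ _ ⟨q, rfl⟩ ⟨q', rfl⟩
    exact ⟨q * q', by ext w; simp [sp]⟩
  one_mem' := ⟨1, by ext w; simp [sp]⟩
  add_mem' := by
    rintro _ _ ⟨q, rfl⟩ ⟨q', rfl⟩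
    exact ⟨q + q', by ext w; simp [sp]⟩
  zero_mem' := ⟨0, by ext w; simp [sp]⟩
  neg_mem' := by
    rintro _ ⟨q, rfl⟩
    exact ⟨-q, by ext w; simp [sp]⟩

lemma ext_fst {X : Type} {𝓡 : Subring (X → ℚ_[p])} {r : X → ℚ_[p]} (h : r ∈ 𝓡) :
    (fun w : X × ℚ_[p] => r w.1) ∈ ext 𝓡 :=
  ⟨Polynomial.C ⟨r, h⟩, by ext w; simp [sp, evx]⟩

lemma ext_snd {X : Type} {𝓡 : Subring (X → ℚ_[p])} :
    (fun w : X × ℚ_[p] => w.2) ∈ ext 𝓡 :=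
  ⟨Polynomial.X, by ext w; simp [sp]⟩

lemma ext_good {X : Type} {𝓡 𝓡' : Subring (X → ℚ_[p])} (h : 𝓡 ≤ 𝓡') (hc : Closed 𝓡')
    {r : X × ℚ_[p] → ℚ_[p]} (hr : r ∈ ext 𝓡) : Good (lin 𝓡') r := by
  obtain ⟨q, rfl⟩ := hr
  have := cellIH hc _ (q.map (Subring.inclusion h)) le_rfl
  convert this using 3 with w
  unfold sp
  rw [Polynomial.map_map]
  rfl

open scoped Classical in
/-- constructible functions -/
inductive Constr {X : Type} (𝓡 : Set (X → ℚ_[p])) :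
    ∀ {Γ : Type}, (Γ → X) → Set (Γ → ℤ) → (Γ → ENNReal) → Prop
  | base {Γ : Type} {ρ : Γ → X} {𝓛 : Set (Γ → ℤ)} {R : Γ → Prop} {ℓ : Γ → ℤ} (h : Tame 𝓡 ρ 𝓛 R)
      (hl : Lin 𝓛 ℓ) : Constr 𝓡 ρ 𝓛 (fun g => if R g then (p : ENNReal) ^ (-(ℓ g)) else 0)
  | add {Γ : Type} {ρ : Γ → X} {𝓛 : Set (Γ → ℤ)} {Φ Ψ : Γ → ENNReal} (h : Constr 𝓡 ρ 𝓛 Φ)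
      (h' : Constr 𝓡 ρ 𝓛 Ψ) : Constr 𝓡 ρ 𝓛 (fun g => Φ g + Ψ g)
  | sum {Γ : Type} {ρ : Γ → X} {𝓛 : Set (Γ → ℤ)} {Φ : Γ → ℤ → ENNReal}
      (h : Constr 𝓡 (fun q : Γ × ℤ => ρ q.1) (lift 𝓛) (fun q => Φ q.1 q.2)) :
      Constr 𝓡 ρ 𝓛 (fun g => ∑' z, Φ g z)

lemma Constr.congr {X Γ : Type} {𝓡 : Set (X → ℚ_[p])} {ρ : Γ → X} {𝓛 : Set (Γ → ℤ)} {Φ Ψ : Γ → ENNReal}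
    (h : Constr 𝓡 ρ 𝓛 Φ) (he : ∀ g, Ψ g = Φ g) : Constr 𝓡 ρ 𝓛 Ψ := by
  have : Ψ = Φ := funext he
  rwa [this]

lemma Constr.fsum {X Γ : Type} {𝓡 : Set (X → ℚ_[p])} {ρ : Γ → X} {𝓛 : Set (Γ → ℤ)} {ι : Type}
    (s : Finset ι) {Φ : ι → Γ → ENNReal}
    (h : ∀ i, Constr 𝓡 ρ 𝓛 (Φ i)) : Constr 𝓡 ρ 𝓛 (fun g => ∑ i ∈ s, Φ i g) := by
  classical
  induction s using Finset.induction_on with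
  | empty => exact (Constr.base (Tame.const False) (Lin.const 0)).congr fun g => by simp
  | insert a s ha ih => exact ((h a).add ih).congr fun g => by rw [Finset.sum_insert ha]

lemma lin_ext {Γ Δ : Type} {𝓛 : Set (Δ → ℤ)} {𝓛' : Set (Γ → ℤ)} {φ : Γ → ℚ_[p] → Δ}
      (H : ∀ ℓ ∈ 𝓛, ∃ ℓ₀, Lin 𝓛' ℓ₀ ∧ ∀ g t, ℓ (φ g t) = ℓ₀ g) {ℓ} (h : Lin 𝓛 ℓ) :
      ∃ ℓ₀, Lin 𝓛' ℓ₀ ∧ ∀ g t, ℓ (φ g t) = ℓ₀ g := by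
  unfold Lin at h
  induction h using AddSubgroup.closure_induction with
  | mem x hx =>
    rcases hx with rfl | hx
    · exact ⟨_, Lin.const 1, fun _ _ => rfl⟩
    · exact H _ hx
  | zero => exact ⟨_, Lin.const 0, fun _ _ => rfl⟩
  | add x y _ _ hx hy =>
    obtain ⟨x', hx', h1⟩ := hx
    obtain ⟨y', hy', h2⟩ := hy
    exact ⟨_, hx'.add hy', fun g t => by simp [h1, h2]⟩
  | neg x _ hx =>
    obtain ⟨x', hx', h1⟩ := hx
    exact ⟨_, hx'.neg, fun g t => by simp [h1]⟩

theorem integration {X Δ : Type} {𝓡 : Subring (X → ℚ_[p])} {ρ : Δ → X × ℚ_[p]} {𝓛 : Set (Δ → ℤ)}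
    {Φ : Δ → ENNReal} (h : Constr (ext 𝓡 : Set (X × ℚ_[p] → ℚ_[p])) ρ 𝓛 Φ) :
    ∀ {Γ : Type} (σ : Γ → X) (𝓛' : Set (Γ → ℤ))
    (φ : Γ → ℚ_[p] → Δ) (hρ : ∀ g t, ρ (φ g t) = (σ g, t))
    (h𝓛 : ∀ ℓ ∈ 𝓛, ∃ ℓ₀, Lin 𝓛' ℓ₀ ∧ ∀ g t, ℓ (φ g t) = ℓ₀ g),
    Constr (𝓡 : Set (X → ℚ_[p])) σ 𝓛' (fun g => ∫⁻ t, Φ (φ g t) ∂(nu p)) ∧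
      ∀ g, AEMeasurable (fun t => Φ (φ g t)) (nu p) := by
  classical
  obtain ⟨𝓡', hle, hcl, hgood⟩ := exists_closed 𝓡
  induction h with
  | @base Δ ρ 𝓛 R ℓ h hl =>
    intro Γ σ 𝓛' φ hρ h𝓛
    obtain ⟨ℓ₀, hℓ₀, hℓ⟩ := lin_ext h𝓛 hl
    have hR : Tame (lin 𝓡') ρ 𝓛 R := h.trans fun r hr => ext_good hle hcl hr
    have h2 : Good (lin 𝓡') (fun w : X × ℚ_[p] => w.2) :=
      ext_good (𝓡 := 𝓡') le_rfl hcl ext_snd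
    have hR' : Tame (lin 𝓡') ρ 𝓛 (fun d => R d ∧ ‖(ρ d).2‖ ≤ (p : ℝ) ^ (-(0 : ℤ))) :=
      hR.and (h2.tame_le (Lin.const 0))
    obtain ⟨ι₁, _, L₁, S₁, hS₁, hmeas⟩ := meas_tame hR σ 𝓛' φ hρ h𝓛
    obtain ⟨ι, _, L, S, hS, hS'⟩ := meas_tame hR' σ 𝓛' φ hρ h𝓛
    have hset : ∀ g, {t | R (φ g t) ∧ ‖(ρ (φ g t)).2‖ ≤ (p : ℝ) ^ (-(0 : ℤ))} = {t | R (φ g t)} ∩ Bl p 0 0 := by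
      intro g; ext t; simp [Bl, hρ]
    have hfun : ∀ g, (fun t => if R (φ g t) then (p : ENNReal) ^ (-(ℓ (φ g t))) else 0) =
        Set.indicator {t | R (φ g t)} (fun _ => (p : ENNReal) ^ (-(ℓ₀ g))) := by
      intro g; ext t; simp [Set.indicator, hℓ]
    constructor
    · have hC : Constr (𝓡 : Set (X → ℚ_[p])) σ 𝓛' (fun g => ∑ i, ∑' γ : ℤ,
          if S i g γ then (p : ENNReal) ^ (-(ℓ₀ g + (γ + L))) else 0) := by
        refine Constr.fsum _ fun i => Constr.sum
          (Φ := fun g γ => if S i g γ then (p : ENNReal) ^ (-(ℓ₀ g + (γ + L))) else 0) ?_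
        exact Constr.base (R := fun q : Γ × ℤ => S i q.1 q.2) (ℓ := fun q : Γ × ℤ => ℓ₀ q.1 + (q.2 + L))
          ((hS i).trans hgood) (hℓ₀.fst.add (Lin.snd.add (Lin.const _)))
      refine hC.congr fun g => ?_
      rw [hfun, lintegral_indicator_const (hmeas g).1, nu, Measure.restrict_apply (hmeas g).1,
        ← hset, (hS' g).2, Finset.mul_sum]
      refine Finset.sum_congr rfl fun i _ => ?_
      rw [← ENNReal.tsum_mul_left]
      refine tsum_congr fun γ => ?_
      split_ifs
      · rw [← pE_add]; congr 1; ring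
      · simp
    · intro g
      rw [hfun]
      exact (measurable_const.indicator (hmeas g).1).aemeasurable
  | add h h' ih ih' =>
    intro Γ σ 𝓛' φ hρ h𝓛
    obtain ⟨h1, h2⟩ := ih σ 𝓛' φ hρ h𝓛
    obtain ⟨h1', h2'⟩ := ih' σ 𝓛' φ hρ h𝓛
    exact ⟨(h1.add h1').congr fun g => lintegral_add_left' (h2 g) _, fun g => (h2 g).add (h2' g)⟩
  | @sum Δ ρ 𝓛 Φ h ih =>
    intro Γ σ 𝓛' φ hρ h𝓛
    obtain ⟨h1, h2⟩ := ih (fun q : Γ × ℤ => σ q.1) (lift 𝓛') (fun q t => (φ q.1 t, q.2))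
      (fun q t => hρ q.1 t) (by
        rintro ℓ (rfl | ⟨ℓ, hℓ, rfl⟩)
        · exact ⟨fun q => q.2, Lin.snd, fun _ _ => rfl⟩
        · obtain ⟨ℓ₀, hl, he⟩ := h𝓛 ℓ hℓ
          exact ⟨fun q => ℓ₀ q.1, hl.fst, fun g t => he g.1 t⟩)
    refine ⟨(Constr.sum (Φ := fun g z => ∫⁻ t, Φ (φ g t) z ∂(nu p)) h1).congr fun g => ?_, fun g => ?_⟩
    · exact lintegral_tsum fun z => h2 (g, z)
    · exact AEMeasurable.tsum fun z => h2 (g, z)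

end PIg

namespace PIg
open Set MeasureTheory

variable {p : ℕ} [hp : Fact p.Prime]
set_option linter.unusedVariables false
set_option linter.unusedSectionVars false

/-- iterated products -/
def Xs (p : ℕ) [Fact p.Prime] : ℕ → Type
  | 0 => Unit
  | m + 1 => Xs p m × ℚ_[p]

/-- polynomial functions -/
noncomputable def PR (p : ℕ) [Fact p.Prime] : ∀ m, Subring (Xs p m → ℚ_[p])
  | 0 => ⊤
  | m + 1 => ext (PR p m)

/-- coordinates -/
def tf (p : ℕ) [Fact p.Prime] : ∀ m, Xs p m → Fin m → ℚ_[p]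
  | 0, _ => fun i => i.elim0
  | m + 1, w => Fin.snoc (α := fun _ => ℚ_[p]) (tf p m w.1) w.2

/-- iterated integral -/
noncomputable def It (p : ℕ) [Fact p.Prime] : ∀ m, (Xs p m → ENNReal) → ENNReal
  | 0, Φ => Φ ()
  | m + 1, Φ => It p m (fun w => ∫⁻ t, Φ (w, t) ∂(nu p))

lemma tf_mem (m : ℕ) (i : Fin m) : (fun w => tf p m w i) ∈ PR p m := by
  induction m with
  | zero => exact i.elim0
  | succ m ih =>
    refine Fin.lastCases ?_ (fun i => ?_) i
    · have : (fun w => tf p (m + 1) w (Fin.last m)) = (fun w : Xs p m × ℚ_[p] => w.2) := by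
        ext w; simp [tf]
      rw [this]; exact ext_snd
    · have : (fun w => tf p (m + 1) w i.castSucc) = (fun w : Xs p m × ℚ_[p] => tf p m w.1 i) := by
        ext w; simp [tf]
      rw [this]; exact ext_fst (ih i)

lemma poly_mem {m : ℕ} (f : MvPolynomial (Fin m) ℤ) :
    (fun w => aeval (tf p m w) f) ∈ PR p m := by
  induction f using MvPolynomial.induction_on with
  | C a =>
    have : (fun w => aeval (tf p m w) (C a : MvPolynomial (Fin m) ℤ)) = ((a : ℤ) : Xs p m → ℚ_[p]) := by
      ext w; simp
    rw [this]; exact intCast_mem _ a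
  | add f g hf hg =>
    have : (fun w => aeval (tf p m w) (f + g)) = (fun w => aeval (tf p m w) f) + (fun w => aeval (tf p m w) g) := by
      ext w; simp
    rw [this]; exact Subring.add_mem _ hf hg
  | mul_X f i hf =>
    have : (fun w => aeval (tf p m w) (f * X i)) = (fun w => aeval (tf p m w) f) * (fun w => tf p m w i) := by
      ext w; simp
    rw [this]; exact Subring.mul_mem _ hf (tf_mem m i)

lemma It_constr (m : ℕ) {Φ : Xs p m × ℤ → ENNReal}
    (h : Constr (PR p m : Set (Xs p m → ℚ_[p])) (fun q : Xs p m × ℤ => q.1) {fun q => q.2} Φ) :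
    Constr (PR p 0 : Set (Xs p 0 → ℚ_[p])) (fun q : Xs p 0 × ℤ => q.1) {fun q => q.2}
      (fun q => It p m (fun w => Φ (w, q.2))) := by
  induction m with
  | zero => exact h
  | succ m ih =>
    have h1 := (integration (X := Xs p m) (𝓡 := PR p m) h (fun q : Xs p m × ℤ => q.1) {fun q => q.2}
      (fun q t => ((q.1, t), q.2)) (fun _ _ => rfl) (by
        rintro _ rfl
        exact ⟨fun q => q.2, Lin.of_mem rfl, fun _ _ => rfl⟩)).1
    exact ih h1

lemma int_count (i : ℕ) {F : ℚ_[p] → ENNReal} {ψ : Fin (p ^ i) → ENNReal}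
    (h : ∀ t (j : Fin (p ^ i)), E t 0 i ((j : ℕ) : ℤ) → F t = ψ j) :
    ∫⁻ t, F t ∂(nu p) = (p : ENNReal) ^ (-(i : ℤ)) * ∑ j, ψ j := by
  rw [nu, Bl_union 0 0 i, lintegral_iUnion (fun _ => Bl_meas _ _) (Bl_disj _ _ _), tsum_fintype,
    Finset.mul_sum]
  refine Finset.sum_congr rfl fun j _ => ?_
  rw [setLIntegral_congr_fun (g := fun _ => ψ j) (Bl_meas _ _), setLIntegral_const, haar_Bl, zero_add, mul_comm]
  intro t ht
  rw [← mem_Bl_iff, sub_zero] at ht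
  exact h t j ht

/-- splitting off the last coordinate -/
def snocE (m : ℕ) (A : Type) : (Fin m → A) × A ≃ (Fin (m + 1) → A) where
  toFun q := Fin.snoc (α := fun _ => A) q.1 q.2
  invFun v := (fun k => v k.castSucc, v (Fin.last m))
  left_inv q := by simp
  right_inv v := by
    ext k
    refine Fin.lastCases ?_ (fun k => ?_) k <;> simp

lemma It_count (i m : ℕ) {Φ : Xs p m → ENNReal} {ψ : (Fin m → Fin (p ^ i)) → ENNReal}
    (h : ∀ w v, (∀ k, E (tf p m w k) 0 i ((v k : ℕ) : ℤ)) → Φ w = ψ v) :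
    It p m Φ = (p : ENNReal) ^ (-((m * i : ℕ) : ℤ)) * ∑ v, ψ v := by
  induction m with
  | zero =>
    simp [It]
    exact h _ _ (fun k => k.elim0)
  | succ m ih =>
    rw [It, ih (ψ := fun v => (p : ENNReal) ^ (-(i : ℤ)) * ∑ j, ψ (Fin.snoc (α := fun _ => Fin (p ^ i)) v j))]
    · rw [← Finset.mul_sum, ← mul_assoc, ← pE_add]
      congr 1
      · congr 1; push_cast; ring
      · rw [← Fintype.sum_prod_type']
        exact Fintype.sum_equiv (snocE m _) _ _ fun q => rfl
    · intro w v hw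
      refine int_count i fun t j hj => h _ _ fun k => ?_
      refine Fin.lastCases ?_ (fun k => ?_) k
      · simpa [tf] using hj
      · simpa [tf] using hw k

lemma poly_congr {m : ℕ} (f : MvPolynomial (Fin m) ℤ) (i : ℕ) {w : Fin m → ℚ_[p]} {v : Fin m → ℤ}
    (h : ∀ k, ‖w k - v k‖ ≤ (p : ℝ) ^ (-(i : ℤ))) :
    ‖aeval w f‖ ≤ 1 ∧ ‖aeval w f - ((eval v f : ℤ) : ℚ_[p])‖ ≤ (p : ℝ) ^ (-(i : ℤ)) := by
  have hp1 : (p : ℝ) ^ (-(i : ℤ)) ≤ 1 := by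
    have := (zpow_le' (p := p) (m := -(i : ℤ)) (n := 0)).2 (by omega)
    simpa using this
  have hw : ∀ k, ‖w k‖ ≤ 1 := by
    intro k
    have := norm_add_le ((h k).trans hp1) (Padic.norm_int_le_one (p := p) (v k))
    simpa using this
  induction f using MvPolynomial.induction_on with
  | C a =>
    simp only [algHom_C, eval_C]
    refine ⟨?_, ?_⟩
    · simpa using Padic.norm_int_le_one (p := p) a
    · simp
  | add f g hf hg =>
    simp only [map_add]
    refine ⟨norm_add_le hf.1 hg.1, ?_⟩
    push_cast
    rw [add_sub_add_comm]
    exact norm_add_le hf.2 hg.2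
  | mul_X f k hf =>
    simp only [map_mul, aeval_X, eval_X]
    refine ⟨?_, ?_⟩
    · rw [norm_mul]; exact mul_le_one₀ hf.1 (norm_nonneg _) (hw k)
    · push_cast
      have e : aeval w f * w k - ((eval v f : ℤ) : ℚ_[p]) * (v k : ℚ_[p]) =
        (aeval w f - ((eval v f : ℤ) : ℚ_[p])) * w k + ((eval v f : ℤ) : ℚ_[p]) * (w k - v k) := by ring
      rw [e]
      refine norm_add_le ?_ ?_
      · rw [norm_mul]
        exact (mul_le_of_le_one_right (norm_nonneg _) (hw k)).trans hf.2
      · rw [norm_mul]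
        exact (mul_le_of_le_one_left (norm_nonneg _) (Padic.norm_int_le_one _)).trans (h k)

/-- residues -/
def resE (N : ℕ) [NeZero N] : Fin N ≃ ZMod N where
  toFun j := ((j : ℕ) : ZMod N)
  invFun a := ⟨a.val, ZMod.val_lt a⟩
  left_inv j := Fin.ext (ZMod.val_cast_of_lt j.2)
  right_inv a := ZMod.natCast_zmod_val a

open scoped Classical in
lemma card_count {n : ℕ} (f : MvPolynomial (Fin n) ℤ) (i : ℕ) :
    ∑ v : Fin n → Fin (p ^ i), (if (p ^ i : ℤ) ∣ eval (fun k => ((v k : ℕ) : ℤ)) f then (1 : ENNReal) else 0) =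
      (Nat.card {a : Fin n → ZMod (p ^ i) // eval a (map (Int.castRingHom (ZMod (p ^ i))) f) = 0} : ENNReal) := by
  have : NeZero (p ^ i) := ⟨pow_ne_zero _ hp.1.ne_zero⟩
  rw [Finset.sum_boole, Nat.card_eq_fintype_card, Fintype.card_subtype]
  congr 1
  refine Finset.card_equiv (Equiv.piCongrRight fun _ => resE (p ^ i)) fun v => ?_
  simp only [Finset.mem_filter, Finset.mem_univ, true_and]
  have h1 : eval ((Equiv.piCongrRight fun _ => resE (p ^ i)) v) (map (Int.castRingHom (ZMod (p ^ i))) f) =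
      ((eval (fun k => ((v k : ℕ) : ℤ)) f : ℤ) : ZMod (p ^ i)) := by
    rw [eval_map, ← eq_intCast (Int.castRingHom (ZMod (p ^ i))), eval₂_comp]
    congr 1
    ext k
    simp [resE]
  rw [h1, ZMod.intCast_zmod_eq_zero_iff_dvd]
  push_cast
  rfl

theorem constr_main {n : ℕ} (f : MvPolynomial (Fin n) ℤ) :
    ∃ Φ : Unit × ℤ → ENNReal, Constr (Set.univ : Set (Unit → ℚ_[p])) (fun q : Unit × ℤ => q.1) {fun q => q.2} Φ ∧
      ∀ i : ℕ, Φ ((), i) = (p : ENNReal) ^ (-((n * i : ℕ) : ℤ)) *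
        (Nat.card {a : Fin n → ZMod (p ^ i) // eval a (map (Int.castRingHom (ZMod (p ^ i))) f) = 0} : ENNReal) := by
  classical
  have hT : Tame (PR p n : Set (Xs p n → ℚ_[p])) (fun q : Xs p n × ℤ => q.1) {fun q => q.2}
      (fun q => ‖aeval (tf p n q.1) f‖ ≤ (p : ℝ) ^ (-(q.2))) :=
    (Good.of_mem (poly_mem f)).tame_le (ρ := fun q : Xs p n × ℤ => q.1) Lin.var
  have h := It_constr n (Constr.base hT (Lin.const 0))
  refine ⟨_, h, fun i => ?_⟩
  rw [← card_count]
  refine It_count i n fun w v hwv => ?_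
  have hc := (poly_congr f i (w := tf p n w) (v := fun k => ((v k : ℕ) : ℤ)) (fun k => by
    have := hwv k
    unfold E at this
    simpa using this)).2
  have : ‖aeval (tf p n w) f‖ ≤ (p : ℝ) ^ (-(i : ℤ)) ↔ (p ^ i : ℤ) ∣ eval (fun k => ((v k : ℕ) : ℤ)) f := by
    rw [← norm_int_le_iff]
    constructor
    · intro h1
      have := norm_sub_le h1 hc
      simpa using this
    · intro h1
      have := norm_add_le h1 hc
      simpa using this
  simp only [this]
  simp

end PIg

namespace PIg
open Set MeasureTheory

variable {p : ℕ} [hp : Fact p.Prime]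
set_option linter.unusedVariables false
set_option linter.unusedSectionVars false

/-- affine functions -/
def Aff {V : Type} [AddCommGroup V] (f : V → ℤ) : Prop := ∃ (φ : V →+ ℤ) (c : ℤ), ∀ v, f v = φ v + c

section
variable {V : Type} [AddCommGroup V]

lemma Aff.const (c : ℤ) : Aff (fun _ : V => c) := ⟨0, c, fun v => by simp⟩
lemma Aff.add {f g : V → ℤ} (hf : Aff f) (hg : Aff g) : Aff (fun v => f v + g v) := by
  obtain ⟨φ, c, h⟩ := hf
  obtain ⟨ψ, d, h'⟩ := hg
  exact ⟨φ + ψ, c + d, fun v => by simp [h, h']; ring⟩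
lemma Aff.neg {f : V → ℤ} (hf : Aff f) : Aff (fun v => - f v) := by
  obtain ⟨φ, c, h⟩ := hf
  exact ⟨-φ, -c, fun v => by simp [h]; ring⟩
lemma Aff.fst {f : V → ℤ} (hf : Aff f) : Aff (fun v : V × ℤ => f v.1) := by
  obtain ⟨φ, c, h⟩ := hf
  exact ⟨φ.comp (AddMonoidHom.fst V ℤ), c, fun v => by simp [h]⟩
lemma Aff.snd : Aff (fun v : V × ℤ => v.2) := ⟨AddMonoidHom.snd V ℤ, 0, fun v => by simp⟩

lemma Aff.of_lin {Γ : Type} {𝓛 : Set (Γ → ℤ)} {θ : V → Γ} (hθ : ∀ ℓ ∈ 𝓛, Aff (fun v => ℓ (θ v)))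
    {ℓ : Γ → ℤ} (h : Lin 𝓛 ℓ) : Aff (fun v => ℓ (θ v)) := by
  unfold Lin at h
  induction h using AddSubgroup.closure_induction with
  | mem x hx =>
    rcases hx with rfl | hx
    · exact Aff.const 1
    · exact hθ _ hx
  | zero => exact Aff.const 0
  | add x y _ _ hx hy => exact hx.add hy
  | neg x _ hx => exact hx.neg

lemma Aff.lift {Γ : Type} {𝓛 : Set (Γ → ℤ)} {θ : V → Γ} (hθ : ∀ ℓ ∈ 𝓛, Aff (fun v => ℓ (θ v))) :
    ∀ ℓ ∈ PIg.lift 𝓛, Aff (fun v : V × ℤ => ℓ (θ v.1, v.2)) := by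
  rintro ℓ (rfl | ⟨ℓ, hℓ, rfl⟩)
  · exact Aff.snd
  · exact (hθ ℓ hℓ).fst

open Pointwise in
lemma semi_aff [AddMonoid.FG V] {f : V → ℤ} (hf : Aff f) {T : Set ℤ} (hT : IsSemilinearSet T) :
    IsSemilinearSet {v | f v ∈ T} := by
  obtain ⟨φ, c, h⟩ := hf
  have := (hT.vadd (-c)).preimage φ
  convert this using 1
  ext v
  rw [mem_preimage, Set.mem_vadd_set_iff_neg_vadd_mem]
  simp [h, add_comm]
end

open Pointwise in
lemma semi_Ici (c : ℤ) : IsSemilinearSet (Set.Ici c) := by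
  refine IsLinearSet.isSemilinearSet ⟨c, {1}, by simp, ?_⟩
  ext z
  rw [Set.mem_vadd_set_iff_neg_vadd_mem]
  simp only [mem_Ici, vadd_eq_add, SetLike.mem_coe, AddSubmonoid.mem_closure_singleton]
  constructor
  · intro h; exact ⟨(z - c).toNat, by simp; omega⟩
  · rintro ⟨n, hn⟩; simp at hn; omega

lemma semi_Iic (c : ℤ) : IsSemilinearSet (Set.Iic c) := by
  have := (semi_Ici (c + 1)).compl
  convert this using 1
  ext z; simp

lemma semi_const {M : Type} [AddCommMonoid M] [AddMonoid.FG M] (P : Prop) : IsSemilinearSet {_z : M | P} := by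
  by_cases h : P
  · simp [h]
  · simp [h]

lemma semi_E (y : ℚ_[p]) (L : ℕ) (k : ℤ) : IsSemilinearSet {z : ℤ | E y z L k} := by
  by_cases hy : y = 0
  · subst hy
    have : {z : ℤ | E (0 : ℚ_[p]) z L k} = {z : ℤ | (p ^ L : ℤ) ∣ k} := by
      ext z; simp [E_zero_left]
    rw [this]; exact semi_const _
  · obtain ⟨n, hn⟩ := exists_norm_eq hy
    have : {z : ℤ | E y z L k} = ({z : ℤ | E y z L k} ∩ Set.Icc (n - L) n) ∪ ({z | (p ^ L : ℤ) ∣ k} ∩ Set.Iic (n - L)) := by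
      ext z
      have h1 : E y z L k → z ≤ n := by
        intro h
        have := h.le
        rw [hn, zpow_le'] at this
        omega
      have h2 : z ≤ n - L → (E y z L k ↔ (p ^ L : ℤ) ∣ k) := by
        intro h
        rw [← E_zero_left (p := p) (σ := z)]
        apply E_congr
        rw [sub_zero, hn, zpow_le']
        omega
      simp only [mem_union, mem_inter_iff, mem_Icc, mem_Iic]
      rcases le_total z (n - L) with h | h
      · have := h2 h
        simp only [mem_ofPred_eq]
        tauto
      · simp only [mem_ofPred_eq]
        constructor
        · intro hE; exact Or.inl ⟨hE, h, h1 hE⟩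
        · rintro (⟨hE, -⟩ | ⟨hd, hz⟩)
          · exact hE
          · exact (h2 hz).2 hd
    rw [this]
    exact (IsSemilinearSet.of_finite ((Set.finite_Icc _ _).subset inter_subset_right)).union
      ((semi_const _).inter (semi_Iic _))

theorem semi_tame {Γ : Type} {𝓡 : Set (Unit → ℚ_[p])} {ρ : Γ → Unit} {𝓛 : Set (Γ → ℤ)} {R : Γ → Prop}
    (h : Tame 𝓡 ρ 𝓛 R) : ∀ {V : Type} [AddCommGroup V] [AddMonoid.FG V] (θ : V → Γ)
      (_ : ∀ ℓ ∈ 𝓛, Aff (fun v => ℓ (θ v))), IsSemilinearSet {v | R (θ v)} := by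
  induction h with
  | le0 h =>
    intro V _ _ θ hθ
    exact semi_aff (Aff.of_lin hθ h) (semi_Ici 0)
  | @atom Γ ρ 𝓛 r ℓ L k hr h =>
    intro V _ _ θ hθ
    exact semi_aff (Aff.of_lin hθ h) (semi_E (r ()) L k)
  | not h ih =>
    intro V _ _ θ hθ
    exact (ih θ hθ).compl
  | and h h' ih ih' =>
    intro V _ _ θ hθ
    exact (ih θ hθ).inter (ih' θ hθ)
  | @ex Γ ρ 𝓛 R h ih =>
    intro V _ _ θ hθ
    have := (ih (V := V × ℤ) (fun v => (θ v.1, v.2)) (Aff.lift hθ)).image (AddMonoidHom.fst V ℤ)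
    convert this using 1
    ext v
    simp

end PIg

namespace PIg
open Set MeasureTheory

variable {p : ℕ} [hp : Fact p.Prime]
set_option linter.unusedVariables false
set_option linter.unusedSectionVars false

/-- rational real power series with rational denominator -/
def RatPS (P : PowerSeries ℝ) : Prop :=
  ∃ B : Polynomial ℚ, B ≠ 0 ∧ ∃ A : Polynomial ℝ,
    ((B.map (algebraMap ℚ ℝ) : Polynomial ℝ) : PowerSeries ℝ) * P = A

lemma RatPS.add {P Q : PowerSeries ℝ} (h : RatPS P) (h' : RatPS Q) : RatPS (P + Q) := by
  obtain ⟨B, hB, A, h⟩ := h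
  obtain ⟨B', hB', A', h'⟩ := h'
  refine ⟨B * B', mul_ne_zero hB hB', B'.map (algebraMap ℚ ℝ) * A + B.map (algebraMap ℚ ℝ) * A', ?_⟩
  rw [Polynomial.map_mul]
  push_cast
  rw [← h, ← h']; ring

lemma RatPS.sub {P Q : PowerSeries ℝ} (h : RatPS P) (h' : RatPS Q) : RatPS (P - Q) := by
  obtain ⟨B, hB, A, h⟩ := h
  obtain ⟨B', hB', A', h'⟩ := h'
  refine ⟨B * B', mul_ne_zero hB hB', B'.map (algebraMap ℚ ℝ) * A - B.map (algebraMap ℚ ℝ) * A', ?_⟩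
  rw [Polynomial.map_mul]
  push_cast
  rw [← h, ← h']; ring

lemma RatPS.of_mul {P : PowerSeries ℝ} {Q : Polynomial ℚ} (hQ : Q ≠ 0)
    (h : RatPS (((Q.map (algebraMap ℚ ℝ) : Polynomial ℝ) : PowerSeries ℝ) * P)) : RatPS P := by
  obtain ⟨B, hB, A, h⟩ := h
  refine ⟨B * Q, mul_ne_zero hB hQ, A, ?_⟩
  rw [Polynomial.map_mul]
  push_cast
  rw [← h]; ring

lemma RatPS.of_eventually_zero {P : PowerSeries ℝ} (M : ℕ) (h : ∀ m, M ≤ m → PowerSeries.coeff m P = 0) :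
    RatPS P := by
  refine ⟨1, one_ne_zero, P.trunc M, ?_⟩
  ext m
  simp only [Polynomial.map_one, Polynomial.coe_one, one_mul, Polynomial.coeff_coe, PowerSeries.coeff_trunc]
  split_ifs with hm
  · rfl
  · exact h m (by omega)

section
variable {Y : Type}

/-- coefficients of the generating function -/
noncomputable def gf (ω : Y → ENNReal) (τ : Y → ℤ) (S : Set Y) (m : ℕ) : ENNReal :=
  ∑' y, S.indicator (fun y => if τ y = m then ω y else 0) y

/-- rationality of the generating function -/
def RatS (ω : Y → ENNReal) (τ : Y → ℤ) (S : Set Y) : Prop :=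
  (∀ m, gf ω τ S m ≠ ⊤) → RatPS (PowerSeries.mk fun m => (gf ω τ S m).toReal)

variable {ω : Y → ENNReal} {τ : Y → ℤ}

lemma gf_mono {S S' : Set Y} (h : S ⊆ S') (m : ℕ) : gf ω τ S m ≤ gf ω τ S' m :=
  ENNReal.tsum_le_tsum fun y => Set.indicator_le_indicator_of_subset h (fun _ => zero_le) y

lemma gf_modular (S S' : Set Y) (m : ℕ) :
    gf ω τ (S ∪ S') m + gf ω τ (S ∩ S') m = gf ω τ S m + gf ω τ S' m := by
  unfold gf
  rw [← ENNReal.tsum_add, ← ENNReal.tsum_add]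
  congr 1
  ext y
  have := congrFun (Set.indicator_union_add_inter (fun y => if τ y = m then ω y else 0) S S') y
  simpa using this

lemma gf_empty (m : ℕ) : gf ω τ ∅ m = 0 := by simp [gf]

lemma RatS.empty : RatS ω τ ∅ := fun _ => RatPS.of_eventually_zero 0 fun m _ => by simp [gf_empty]

lemma RatS.finite {S : Set Y} (hS : S.Finite) : RatS ω τ S := by
  intro _
  obtain ⟨M, hM⟩ := (hS.image τ).bddAbove
  refine RatPS.of_eventually_zero (M.toNat + 1) fun m hm => ?_
  have : gf ω τ S m = 0 := by
    unfold gf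
    rw [ENNReal.tsum_eq_zero]
    intro y
    by_cases hy : y ∈ S
    · rw [Set.indicator_of_mem hy, if_neg]
      intro h
      have := hM (Set.mem_image_of_mem τ hy)
      omega
    · rw [Set.indicator_of_notMem hy]
  simp [this]

lemma RatS.union {S S' : Set Y} (h : RatS ω τ S) (h' : RatS ω τ S') (hi : RatS ω τ (S ∩ S')) :
    RatS ω τ (S ∪ S') := by
  intro hf
  have f1 : ∀ m, gf ω τ S m ≠ ⊤ := fun m => ne_top_of_le_ne_top (hf m) (gf_mono subset_union_left m)
  have f2 : ∀ m, gf ω τ S' m ≠ ⊤ := fun m => ne_top_of_le_ne_top (hf m) (gf_mono subset_union_right m)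
  have f3 : ∀ m, gf ω τ (S ∩ S') m ≠ ⊤ := fun m => ne_top_of_le_ne_top (f1 m) (gf_mono inter_subset_left m)
  convert ((h f1).add (h' f2)).sub (hi f3) using 1
  ext m
  have := congrArg ENNReal.toReal (gf_modular (ω := ω) (τ := τ) S S' m)
  rw [ENNReal.toReal_add (hf m) (f3 m), ENNReal.toReal_add (f1 m) (f2 m)] at this
  simp only [PowerSeries.coeff_mk, map_add, map_sub]
  linarith

lemma RatS.iUnion {𝒟 : Set (Set Y)} (hI : ∀ S ∈ 𝒟, ∀ S' ∈ 𝒟, S ∩ S' ∈ 𝒟)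
    (hr : ∀ S ∈ 𝒟, RatS ω τ S) {κ : Type} (s : Finset κ) :
    ∀ (F : κ → Set Y) (_ : ∀ i ∈ s, F i ∈ 𝒟), RatS ω τ (⋃ i ∈ s, F i) := by
  classical
  induction s using Finset.induction_on with
  | empty => intro F _; simpa using RatS.empty
  | insert a s ha ih =>
    intro F hF
    rw [Finset.set_biUnion_insert]
    refine RatS.union (hr _ (hF a (by simp))) (ih F fun i hi => hF i (by simp [hi])) ?_
    have := ih (fun i => F a ∩ F i) fun i hi => hI _ (hF a (by simp)) _ (hF i (by simp [hi]))
    convert this using 1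
    simp only [inter_iUnion]

lemma gf_image {Z : Type} {φ : Z → Y} {N : Set Z} (hφ : InjOn φ N) (m : ℕ) :
    gf ω τ (φ '' N) m = gf (fun z => ω (φ z)) (fun z => τ (φ z)) N m := by
  unfold gf
  rw [← tsum_subtype, ← tsum_subtype, tsum_image (fun y => if τ y = m then ω y else 0) hφ]

lemma RatS.image {Z : Type} {φ : Z → Y} {N : Set Z} (hφ : InjOn φ N)
    (h : RatS (fun z => ω (φ z)) (fun z => τ (φ z)) N) : RatS ω τ (φ '' N) := by
  intro hf
  have : gf ω τ (φ '' N) = gf (fun z => ω (φ z)) (fun z => τ (φ z)) N := funext (gf_image hφ)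
  rw [this] at hf ⊢
  exact h hf
end

lemma toReal_pE (m : ℤ) : ((p : ENNReal) ^ m).toReal = (p : ℝ) ^ m := by
  obtain ⟨k, rfl | rfl⟩ := m.eq_nat_or_neg
  · simp
  · rw [ENNReal.zpow_neg]
    simp

lemma one_sub_ne {q : ℚ} {t : ℕ} (h : t = 0 → q ≠ 1) :
    (1 - Polynomial.C q * Polynomial.X ^ t : Polynomial ℚ) ≠ 0 := by
  intro h0
  have := congrArg (fun P => Polynomial.coeff P 0) h0
  rcases Nat.eq_zero_or_pos t with rfl | ht
  · simp at this
    exact h rfl (by linarith)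
  · simp [Polynomial.coeff_X_pow, ht.ne] at this

section
variable {ι : Type} [Fintype ι] {W : Type} [AddCommGroup W]

/-- the slices used in the induction -/
def slices (ψ : (ι → ℕ) →+ W) (u : W) (k : ℕ) : Set (Set (ι → ℕ)) :=
  {U | U = ∅ ∨ ∃ (I : Finset ι) (n0 : ι → ℕ), k ≤ I.card ∧ ψ n0 = u ∧
    U = {n | ψ n = u ∧ ∀ i ∈ I, n i = n0 i}}

lemma slices_inter (ψ : (ι → ℕ) →+ W) (u : W) (k : ℕ) :
    ∀ S ∈ slices ψ u k, ∀ S' ∈ slices ψ u k, S ∩ S' ∈ slices ψ u k := by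
  classical
  rintro S hS S' hS'
  rcases Set.eq_empty_or_nonempty (S ∩ S') with h | ⟨m, hm, hm'⟩
  · exact Or.inl h
  · rcases hS with rfl | ⟨I, n0, hI, h0, rfl⟩
    · exact absurd hm (by simp)
    rcases hS' with rfl | ⟨I', n0', hI', h0', rfl⟩
    · exact absurd hm' (by simp)
    refine Or.inr ⟨I ∪ I', m, hI.trans (Finset.card_le_card Finset.subset_union_left), hm.1, ?_⟩
    ext n
    have h1 := hm.2
    have h2 := hm'.2
    constructor
    · rintro ⟨⟨a, b⟩, -, d⟩
      refine ⟨a, fun i hi => ?_⟩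
      rcases Finset.mem_union.1 hi with hi | hi
      · rw [b i hi, h1 i hi]
      · rw [d i hi, h2 i hi]
    · rintro ⟨a, b⟩
      exact ⟨⟨a, fun i hi => by rw [b i (Finset.mem_union_left _ hi), h1 i hi]⟩,
        ⟨a, fun i hi => by rw [b i (Finset.mem_union_right _ hi), h2 i hi]⟩⟩

lemma ratN_aux (ψ : (ι → ℕ) →+ W) (u : W) (w τ : (ι → ℕ) →+ ℤ) (hτ : ∀ n, ψ n = u → 0 ≤ τ n) (j : ℕ) :
    ∀ k, Fintype.card ι ≤ k + j → ∀ U ∈ slices ψ u k, RatS (fun n => (p : ENNReal) ^ (-(w n))) τ U := by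
  classical
  induction j with
  | zero => ?_
  | succ j ih => ?_
  all_goals
    intro k hk U hU
    rcases hU with rfl | ⟨I, n0, hI, h0, hU⟩
    · exact RatS.empty
    by_cases hv : ∃ v, v ≠ 0 ∧ ψ v = 0 ∧ ∀ i ∈ I, v i = 0
    swap
    · apply RatS.finite
      have hanti : IsAntichain (· ≤ ·) U := by
        intro n hn n' hn' hne hle
        rw [hU] at hn hn'
        apply hv
        refine ⟨n' - n, ?_, ?_, ?_⟩
        · intro h
          apply hne
          ext i
          have := congrFun h i
          have h2 : n i ≤ n' i := hle i
          simp at this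
          omega
        · have : ψ (n' - n) + ψ n = ψ n' := by rw [← map_add, tsub_add_cancel_of_le hle]
          rw [hn.1, hn'.1] at this
          simpa using this
        · intro i hi
          simp [hn.2 i hi, hn'.2 i hi]
      exact hanti.finite_of_partiallyWellOrderedOn (Set.isPWO_of_wellQuasiOrderedLE U)
    obtain ⟨v, hv0, hψv, hvI⟩ := hv
  · exfalso
    apply hv0
    ext i
    have : I = Finset.univ := by
      rw [← Finset.card_eq_iff_eq_univ]
      exact le_antisymm (Finset.card_le_univ _) (by omega)
    exact hvI i (by simp [this])
  have hadd : ∀ n ∈ U, n + v ∈ U := by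
    intro n hn
    rw [hU] at hn ⊢
    exact ⟨by rw [map_add, hψv, add_zero, hn.1], fun i hi => by simp [hvI i hi, hn.2 i hi]⟩
  have hU0 : n0 ∈ U := by rw [hU]; exact ⟨h0, fun _ _ => rfl⟩
  have hUτ : ∀ n ∈ U, 0 ≤ τ n := by
    intro n hn
    rw [hU] at hn
    exact hτ n hn.1
  have ht0 : 0 ≤ τ v := by
    by_contra hneg
    have hk : ∀ k : ℕ, n0 + k • v ∈ U := by
      intro k
      induction k with
      | zero => simpa using hU0
      | succ k ihk => rw [succ_nsmul, ← add_assoc]; exact hadd _ ihk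
    have := hUτ _ (hk ((τ n0).toNat + 1))
    rw [map_add, map_nsmul] at this
    have h1 := hUτ _ hU0
    simp at this
    nlinarith [max_eq_left h1]
  obtain ⟨t, ht⟩ := Int.eq_ofNat_of_zero_le ht0
  set U' : Set (ι → ℕ) := {n | n ∈ U ∧ ∃ i, n i < v i} with hU'
  have hsub : ∀ n ∈ U, n ∉ U' → v ≤ n ∧ n - v ∈ U := by
    intro n hn hn'
    have hle : v ≤ n := by
      intro i
      by_contra hlt
      exact hn' ⟨hn, i, Nat.lt_of_not_le hlt⟩
    refine ⟨hle, ?_⟩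
    have : ψ (n - v) + ψ v = ψ n := by rw [← map_add, tsub_add_cancel_of_le hle]
    rw [hU] at hn ⊢
    exact ⟨by rw [← hn.1, ← this, hψv, add_zero], fun i hi => by simp [hvI i hi, hn.2 i hi]⟩
  have hRU' : RatS (fun n => (p : ENNReal) ^ (-(w n))) τ U' := by
    have := RatS.iUnion (slices_inter ψ u (k + 1)) (ih (k + 1) (by omega))
      ((Finset.univ : Finset ι).sigma fun i => Finset.range (v i)) (fun x => {n | n ∈ U ∧ n x.1 = x.2}) ?_
    · convert this using 1
      ext n
      simp only [hU', mem_ofPred_eq, mem_iUnion, Finset.mem_sigma, Finset.mem_univ, true_and, Finset.mem_range,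
        exists_prop, Sigma.exists]
      constructor
      · rintro ⟨hn, i, hi⟩
        exact ⟨i, n i, hi, hn, rfl⟩
      · rintro ⟨i, b, hb, hn, rfl⟩
        exact ⟨hn, i, hb⟩
    · rintro ⟨i, b⟩ hib
      simp only [Finset.mem_sigma, Finset.mem_univ, true_and, Finset.mem_range] at hib
      have hiI : i ∉ I := fun h => by rw [hvI i h] at hib; omega
      rcases Set.eq_empty_or_nonempty {n | n ∈ U ∧ n i = b} with h | ⟨n1, hn1, hn1b⟩
      · exact Or.inl h
      · refine Or.inr ⟨insert i I, n1, ?_, ?_, ?_⟩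
        · rw [Finset.card_insert_of_notMem hiI]; omega
        · rw [hU] at hn1; exact hn1.1
        · ext n
          rw [hU] at hn1
          simp only [hU, mem_ofPred_eq, Finset.mem_insert, forall_eq_or_imp, hn1b]
          constructor
          · rintro ⟨⟨a, b⟩, c⟩
            exact ⟨a, c, fun i hi => by rw [b i hi, hn1.2 i hi]⟩
          · rintro ⟨a, c, b⟩
            exact ⟨⟨a, fun i hi => by rw [b i hi, hn1.2 i hi]⟩, c⟩
  set ω : (ι → ℕ) → ENNReal := fun n => (p : ENNReal) ^ (-(w n)) with hω
  have hrec : ∀ m : ℕ, gf ω τ U m = gf ω τ U' m +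
      (if t ≤ m then (p : ENNReal) ^ (-(w v)) * gf ω τ U (m - t) else 0) := by
    intro m
    have hunion : U = U' ∪ (fun n => n + v) '' U := by
      ext n
      constructor
      · intro hn
        by_cases h : n ∈ U'
        · exact Or.inl h
        · obtain ⟨a, b⟩ := hsub n hn h
          exact Or.inr ⟨n - v, b, by simp [tsub_add_cancel_of_le a]⟩
      · rintro (h | ⟨n, hn, rfl⟩)
        · exact h.1
        · exact hadd n hn
    have hdisj : U' ∩ (fun n => n + v) '' U = ∅ := by
      ext n
      simp only [mem_inter_iff, mem_image, mem_empty_iff_false, iff_false]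
      rintro ⟨⟨_, i, hi⟩, n, hn, rfl⟩
      simp at hi
    have hmod := gf_modular (ω := ω) (τ := τ) U' ((fun n => n + v) '' U) m
    rw [hdisj, gf_empty, add_zero, ← hunion] at hmod
    rw [hmod, gf_image (fun a _ b _ h => by simpa using h)]
    congr 1
    split_ifs with htm
    · unfold gf
      rw [← ENNReal.tsum_mul_left]
      congr 1
      ext n
      by_cases hn : n ∈ U
      · rw [Set.indicator_of_mem hn, Set.indicator_of_mem hn]
        simp only [map_add, ht]
        have : (τ n + (t : ℤ) = m) ↔ τ n = ((m - t : ℕ) : ℤ) := by omega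
        rw [mul_ite, mul_zero, hω]
        refine if_congr this ?_ rfl
        simp only [map_add]
        rw [← pE_add]
        congr 1
        ring
      · rw [Set.indicator_of_notMem hn, Set.indicator_of_notMem hn, mul_zero]
    · unfold gf
      rw [ENNReal.tsum_eq_zero]
      intro n
      by_cases hn : n ∈ U
      · rw [Set.indicator_of_mem hn, if_neg]
        have := hUτ n hn
        simp only [map_add, ht]
        omega
      · rw [Set.indicator_of_notMem hn]
  intro hf
  have hf' : ∀ m, gf ω τ U' m ≠ ⊤ := fun m => ne_top_of_le_ne_top (hf m) (gf_mono (fun n hn => hn.1) m)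
  have hR := hRU' hf'
  by_cases hdeg : t = 0 ∧ w v = 0
  · exfalso
    have hz : ∀ m, gf ω τ U' m = 0 := by
      intro m
      have := hrec m
      rw [hdeg.1, hdeg.2] at this
      simp only [zero_le, if_true, neg_zero, zpow_zero, one_mul, Nat.sub_zero] at this
      rw [← zero_add (gf ω τ U m)] at this
      nth_rewrite 2 [zero_add] at this
      exact ((ENNReal.add_left_inj (hf m)).1 this).symm
    have hmin : ∃ y, y ∈ U' := by
      obtain ⟨y, hy, hmin⟩ := WellFounded.has_min (measure fun n : ι → ℕ => ∑ i, n i).wf U ⟨n0, hU0⟩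
      refine ⟨y, ?_⟩
      by_contra hy'
      obtain ⟨a, b⟩ := hsub y hy hy'
      apply hmin _ b
      show ∑ i, (y - v) i < ∑ i, y i
      obtain ⟨i, hi⟩ := Function.ne_iff.1 hv0
      refine Finset.sum_lt_sum (fun i _ => by simp) ⟨i, Finset.mem_univ _, ?_⟩
      have : v i ≤ y i := a i
      simp at hi ⊢
      omega
    obtain ⟨y, hy⟩ := hmin
    have h1 := hUτ y hy.1
    obtain ⟨m, hm⟩ := Int.eq_ofNat_of_zero_le h1
    have h2 := hz m
    unfold gf at h2
    rw [ENNReal.tsum_eq_zero] at h2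
    have h3 := h2 y
    rw [Set.indicator_of_mem hy, if_pos hm] at h3
    exact pE_ne' _ h3
  · refine RatPS.of_mul (Q := 1 - Polynomial.C ((p : ℚ) ^ (-(w v))) * Polynomial.X ^ t) (one_sub_ne ?_) ?_
    · intro h1 h2
      apply hdeg
      refine ⟨h1, ?_⟩
      have hp1 : (1 : ℚ) < p := by exact_mod_cast hp.out.one_lt
      have := (zpow_eq_one_iff_right₀ (by linarith) hp1.ne').1 h2
      omega
    · convert hR using 1
      ext m
      simp only [Polynomial.map_sub, Polynomial.map_one, Polynomial.map_mul, Polynomial.map_C, Polynomial.map_pow,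
        Polynomial.map_X, Polynomial.coe_sub, Polynomial.coe_one, Polynomial.coe_mul, Polynomial.coe_C,
        Polynomial.coe_pow, Polynomial.coe_X, sub_mul, one_mul, map_sub, PowerSeries.coeff_mk, mul_assoc,
        PowerSeries.coeff_C_mul, PowerSeries.coeff_X_pow_mul']
      rw [hrec m, ENNReal.toReal_add (hf' m) (by
        split_ifs
        · exact ENNReal.mul_ne_top (pE_top' _) (hf _)
        · simp)]
      split_ifs
      · rw [ENNReal.toReal_mul, toReal_pE]
        simp
      · simp

theorem ratN (ψ : (ι → ℕ) →+ W) (u : W) (w τ : (ι → ℕ) →+ ℤ) (hτ : ∀ n, ψ n = u → 0 ≤ τ n) :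
    RatS (fun n => (p : ENNReal) ^ (-(w n))) τ {n | ψ n = u} := by
  rcases Set.eq_empty_or_nonempty {n | ψ n = u} with h | ⟨n0, hn0⟩
  · rw [h]; exact RatS.empty
  · refine ratN_aux ψ u w τ hτ (Fintype.card ι) 0 (by simp) _ (Or.inr ⟨∅, n0, by simp, hn0, by simp⟩)
end

end PIg

namespace PIg
open Set MeasureTheory

variable {p : ℕ} [hp : Fact p.Prime]
set_option linter.unusedVariables false
set_option linter.unusedSectionVars false

section
variable {M : Type} [AddCommGroup M]

/-- injectively parametrized sets -/
def parsets (τ : M →+ ℤ) : Set (Set M) :=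
  {S | (∀ x ∈ S, 0 ≤ τ x) ∧ ∃ (ι : Type) (_ : Fintype ι) (W : Type) (_ : AddCommGroup W)
    (ψ : (ι → ℕ) →+ W) (u : W) (φ : (ι → ℕ) →+ M), InjOn φ {n | ψ n = u} ∧ S = φ '' {n | ψ n = u}}

/-- restriction of coordinates -/
def restr {ι κ : Type} (g : ι → κ) : (κ → ℕ) →+ (ι → ℕ) where
  toFun n := fun i => n (g i)
  map_zero' := rfl
  map_add' _ _ := rfl

lemma parsets_inter (τ : M →+ ℤ) : ∀ S ∈ parsets τ, ∀ S' ∈ parsets τ, S ∩ S' ∈ parsets τ := by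
  rintro S ⟨hp, ι, _, W, _, ψ, u, φ, hi, rfl⟩ S' ⟨-, ι', _, W', _, ψ', u', φ', hi', rfl⟩
  refine ⟨fun x hx => hp x hx.1, ι ⊕ ι', inferInstance, W × W' × M, inferInstance,
    (ψ.comp (restr Sum.inl)).prod ((ψ'.comp (restr Sum.inr)).prod
      (φ.comp (restr Sum.inl) - φ'.comp (restr Sum.inr))), (u, u', 0), φ.comp (restr Sum.inl), ?_, ?_⟩
  · intro a ha b hb hab
    simp only [mem_ofPred_eq, AddMonoidHom.prod_apply, Prod.mk.injEq, AddMonoidHom.comp_apply,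
      AddMonoidHom.sub_apply, sub_eq_zero] at ha hb hab
    have h1 := hi ha.1 hb.1 hab
    have h2 := hi' ha.2.1 hb.2.1 (by rw [← ha.2.2, ← hb.2.2, hab])
    ext (i | i)
    · exact congrFun h1 i
    · exact congrFun h2 i
  · ext x
    simp only [mem_inter_iff, mem_image, mem_ofPred_eq, AddMonoidHom.prod_apply, Prod.mk.injEq,
      AddMonoidHom.comp_apply, AddMonoidHom.sub_apply, sub_eq_zero]
    constructor
    · rintro ⟨⟨n, hn, rfl⟩, n', hn', h⟩
      exact ⟨Sum.elim n n', ⟨hn, hn', h.symm⟩, rfl⟩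
    · rintro ⟨n, ⟨h1, h2, h3⟩, rfl⟩
      exact ⟨⟨_, h1, rfl⟩, _, h2, h3.symm⟩

lemma parsets_rat (τ w : M →+ ℤ) : ∀ S ∈ parsets τ, RatS (fun x => (p : ENNReal) ^ (-(w x))) τ S := by
  rintro S ⟨hp, ι, _, W, _, ψ, u, φ, hi, rfl⟩
  refine RatS.image hi ?_
  exact ratN ψ u (w.comp φ) (τ.comp φ) fun n hn => hp _ ⟨n, hn, rfl⟩

open Pointwise in
lemma parsets_linear (τ : M →+ ℤ) {S : Set M} (hS : IsProperLinearSet S) (h0 : ∀ x ∈ S, 0 ≤ τ x) :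
    S ∈ parsets τ := by
  classical
  obtain ⟨a, t, hli, rfl⟩ := isProperLinearSet_iff.1 hS
  refine ⟨h0, Option t, inferInstance, ℤ, inferInstance,
    (Nat.castAddMonoidHom ℤ).comp (Pi.evalAddMonoidHom (fun _ : Option t => ℕ) none), 1,
    (Fintype.linearCombination ℕ (fun o : Option t => o.elim a (fun x => (x : M)))).toAddMonoidHom, ?_, ?_⟩
  · intro n hn n' hn' h
    simp only [mem_ofPred_eq, AddMonoidHom.comp_apply, Pi.evalAddMonoidHom_apply, Nat.coe_castAddMonoidHom] at hn hn'
    have hn1 : n none = 1 := by exact_mod_cast hn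
    have hn1' : n' none = 1 := by exact_mod_cast hn'
    simp only [LinearMap.toAddMonoidHom_coe, Fintype.linearCombination_apply, Fintype.sum_option, Option.elim,
      hn1, hn1', add_right_inj] at h
    have hinj := linearIndependent_iff_injective_fintypeLinearCombination.1 hli
    have := @hinj (fun x => n (some x)) (fun x => n' (some x)) (by
      rw [Fintype.linearCombination_apply, Fintype.linearCombination_apply]; exact h)
    ext (_ | x)
    · rw [hn1, hn1']
    · exact congrFun this x
  · ext x
    rw [Set.mem_vadd_set]
    simp only [mem_image, mem_ofPred_eq, AddMonoidHom.comp_apply, Pi.evalAddMonoidHom_apply,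
      Nat.coe_castAddMonoidHom, LinearMap.toAddMonoidHom_coe, Fintype.linearCombination_apply,
      Fintype.sum_option, Option.elim, vadd_eq_add, SetLike.mem_coe]
    constructor
    · rintro ⟨y, hy, rfl⟩
      rw [← Submodule.span_nat_eq_addSubmonoidClosure, Submodule.mem_toAddSubmonoid,
        Submodule.mem_span_finset] at hy
      obtain ⟨c, -, rfl⟩ := hy
      refine ⟨fun o => o.elim 1 (fun x => c x), by simp, ?_⟩
      simp only [Option.elim, one_smul]
      congr 1
      exact Finset.sum_coe_sort t (fun x => c x • x)
    · rintro ⟨n, hn, rfl⟩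
      have hn1 : n none = 1 := by exact_mod_cast hn
      refine ⟨∑ x : t, n (some x) • (x : M), ?_, by rw [hn1, one_smul]⟩
      exact sum_mem fun x _ => nsmul_mem (AddSubmonoid.subset_closure x.2) _

lemma rat_semilinear (τ w : M →+ ℤ) {S : Set M} (hS : IsSemilinearSet S) (h0 : ∀ x ∈ S, 0 ≤ τ x) :
    RatS (fun x => (p : ENNReal) ^ (-(w x))) τ S := by
  obtain ⟨F, hF, rfl⟩ := isProperSemilinearSet_iff.1 hS.isProperSemilinearSet
  have := RatS.iUnion (parsets_inter τ) (parsets_rat (p := p) τ w) F id fun s hs =>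
    parsets_linear τ (hF s hs) fun x hx => h0 x ⟨s, by simpa using hs, hx⟩
  convert this using 1
  ext x
  simp
end

lemma rat_base {V : Type} [AddCommGroup V] [AddMonoid.FG V] {w τ : V → ℤ} (hw : Aff w) (hτ : Aff τ)
    {S : Set V} (hS : IsSemilinearSet S) : RatS (fun v => (p : ENNReal) ^ (-(w v))) τ S := by
  classical
  obtain ⟨τh, c, hτh⟩ := id hτ
  obtain ⟨wh, d, hwh⟩ := id hw
  set τ' : V × ℤ →+ ℤ := τh.comp (AddMonoidHom.fst V ℤ) + c • (AddMonoidHom.snd V ℤ) with hτ'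
  set w' : V × ℤ →+ ℤ := wh.comp (AddMonoidHom.fst V ℤ) + d • (AddMonoidHom.snd V ℤ) with hw'
  set S' : Set (V × ℤ) := {x | x.1 ∈ S} ∩ ({x | τ x.1 ∈ Set.Ici 0} ∩ {x | x.2 ∈ ({1} : Set ℤ)}) with hS'
  have hsemi : IsSemilinearSet S' :=
    (hS.preimage (AddMonoidHom.fst V ℤ)).inter ((semi_aff hτ.fst (semi_Ici 0)).inter
      (semi_aff Aff.snd (IsSemilinearSet.of_finite (Set.finite_singleton 1))))
  have e1 : ∀ x ∈ S', τ' x = τ x.1 := by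
    rintro ⟨v, e⟩ ⟨h1, h2, h3⟩
    have h3 : e = 1 := h3
    simp [hτ', hτh, h3]
  have e2 : ∀ x ∈ S', w' x = w x.1 := by
    rintro ⟨v, e⟩ ⟨h1, h2, h3⟩
    have h3 : e = 1 := h3
    simp [hw', hwh, h3]
  have h := rat_semilinear (p := p) τ' w' hsemi fun x hx => by rw [e1 x hx]; exact hx.2.1
  have key : gf (fun v => (p : ENNReal) ^ (-(w v))) τ S = gf (fun x => (p : ENNReal) ^ (-(w' x))) τ' S' := by
    ext m
    have hinj : InjOn Prod.fst S' := by
      rintro ⟨v, e⟩ ⟨-, -, h3⟩ ⟨v', e'⟩ ⟨-, -, h3'⟩ h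
      have h3 : e = 1 := h3
      have h3' : e' = 1 := h3'
      have h : v = v' := h
      rw [h3, h3', h]
    have a1 : gf (fun v => (p : ENNReal) ^ (-(w v))) τ S m =
        gf (fun v => (p : ENNReal) ^ (-(w v))) τ (Prod.fst '' S') m := by
      unfold gf
      congr 1
      ext v
      by_cases hv : v ∈ S
      · by_cases hp : 0 ≤ τ v
        · rw [Set.indicator_of_mem hv, Set.indicator_of_mem]
          exact ⟨(v, 1), ⟨hv, hp, rfl⟩, rfl⟩
        · have hne : ¬ τ v = m := by omega
          rw [Set.indicator_apply, Set.indicator_apply, if_neg hne, ite_self, ite_self]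
      · rw [Set.indicator_of_notMem hv, Set.indicator_of_notMem]
        rintro ⟨x, hx, rfl⟩
        exact hv hx.1
    rw [a1, gf_image hinj]
    unfold gf
    congr 1
    ext x
    by_cases hx : x ∈ S'
    · rw [Set.indicator_of_mem hx, Set.indicator_of_mem hx]
      simp only [e1 x hx, e2 x hx]
    · rw [Set.indicator_of_notMem hx, Set.indicator_of_notMem hx]
  unfold RatS
  rw [key]
  exact h

theorem rat_constr {Γ : Type} {𝓡 : Set (Unit → ℚ_[p])} {ρ : Γ → Unit} {𝓛 : Set (Γ → ℤ)} {Φ : Γ → ENNReal}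
    (h : Constr 𝓡 ρ 𝓛 Φ) : ∀ {V : Type} [AddCommGroup V] [AddMonoid.FG V] (θ : V → Γ)
      (_ : ∀ ℓ ∈ 𝓛, Aff (fun v => ℓ (θ v))) (τ : V → ℤ) (_ : Aff τ),
      RatS (fun v => Φ (θ v)) τ Set.univ := by
  classical
  induction h with
  | @base Γ ρ 𝓛 R ℓ hR hl =>
    intro V _ _ θ hθ τ hτ
    have := rat_base (p := p) (Aff.of_lin hθ hl) hτ (semi_tame hR θ hθ)
    have e : gf (fun v => if R (θ v) then (p : ENNReal) ^ (-(ℓ (θ v))) else 0) τ Set.univ =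
        gf (fun v => (p : ENNReal) ^ (-(ℓ (θ v)))) τ {v | R (θ v)} := by
      ext m
      unfold gf
      congr 1
      ext v
      by_cases h1 : R (θ v) <;> simp [h1]
    unfold RatS at this ⊢
    rw [← e] at this
    convert this using 6
  | @add Γ ρ 𝓛 Φ Ψ h h' ih ih' =>
    intro V _ _ θ hθ τ hτ
    have e : ∀ m, gf (fun v => Φ (θ v) + Ψ (θ v)) τ Set.univ m =
        gf (fun v => Φ (θ v)) τ Set.univ m + gf (fun v => Ψ (θ v)) τ Set.univ m := by
      intro m
      unfold gf
      rw [← ENNReal.tsum_add]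
      congr 1
      ext v
      simp only [Set.indicator_univ]
      split_ifs <;> simp
    intro hf
    have f1 : ∀ m, gf (fun v => Φ (θ v)) τ Set.univ m ≠ ⊤ := fun m =>
      ne_top_of_le_ne_top (hf m) (by rw [e m]; exact le_self_add)
    have f2 : ∀ m, gf (fun v => Ψ (θ v)) τ Set.univ m ≠ ⊤ := fun m =>
      ne_top_of_le_ne_top (hf m) (by rw [e m]; exact le_add_self)
    convert (ih θ hθ τ hτ f1).add (ih' θ hθ τ hτ f2) using 1
    ext m
    rw [map_add, PowerSeries.coeff_mk, PowerSeries.coeff_mk, PowerSeries.coeff_mk, e m,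
      ENNReal.toReal_add (f1 m) (f2 m)]
  | @sum Γ ρ 𝓛 Φ h ih =>
    intro V _ _ θ hθ τ hτ
    have := ih (V := V × ℤ) (fun v => (θ v.1, v.2)) (Aff.lift hθ) (fun v => τ v.1) hτ.fst
    have e : gf (fun v => ∑' z, Φ (θ v) z) τ Set.univ =
        gf (fun v : V × ℤ => Φ (θ v.1) v.2) (fun v => τ v.1) Set.univ := by
      ext m
      unfold gf
      rw [ENNReal.tsum_prod']
      congr 1
      ext v
      simp only [Set.indicator_univ]
      split_ifs <;> simp
    unfold RatS at this ⊢
    rw [e]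
    exact this

theorem rat_main {n : ℕ} (f : MvPolynomial (Fin n) ℤ) :
    RatPS (PowerSeries.mk fun i : ℕ =>
      (Nat.card {a : Fin n → ZMod (p ^ i) // eval a (map (Int.castRingHom (ZMod (p ^ i))) f) = 0} : ℝ)
        * ((p : ℝ) ^ (n * i))⁻¹) := by
  obtain ⟨Φ, hΦ, hc⟩ := constr_main (p := p) f
  have h := rat_constr hΦ (V := ℤ) (fun z => ((), z)) (by
    rintro ℓ rfl
    exact ⟨AddMonoidHom.id ℤ, 0, fun v => by simp⟩) (fun z => z) ⟨AddMonoidHom.id ℤ, 0, fun v => by simp⟩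
  have e : ∀ m, gf (fun z : ℤ => Φ ((), z)) (fun z => z) Set.univ m = Φ ((), (m : ℤ)) := by
    intro m
    unfold gf
    simp only [Set.indicator_univ]
    rw [tsum_eq_single (m : ℤ) (fun b hb => if_neg hb), if_pos rfl]
  have := h (fun m => by
    rw [e m, hc]
    exact ENNReal.mul_ne_top (pE_top' _) (ENNReal.natCast_ne_top _))
  convert this using 2
  ext m
  rw [e m, hc, ENNReal.toReal_mul, toReal_pE, ENNReal.toReal_natCast, zpow_neg, zpow_natCast, mul_comm]

theorem final {P : PowerSeries ℚ} (h : RatPS (PowerSeries.map (algebraMap ℚ ℝ) P)) :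
    ∃ A B : Polynomial ℚ, B ≠ 0 ∧
      (PowerSeries.mk fun i => B.coeff i) * P = PowerSeries.mk fun i => A.coeff i := by
  obtain ⟨B, hB, A, h⟩ := h
  have hc : ∀ Q : Polynomial ℚ, (PowerSeries.mk fun i => Q.coeff i) = (Q : PowerSeries ℚ) := by
    intro Q; ext i; simp
  refine ⟨((B : PowerSeries ℚ) * P).trunc (A.natDegree + 1), B, hB, ?_⟩
  rw [hc, hc]
  ext m
  rw [Polynomial.coeff_coe, PowerSeries.coeff_trunc]
  split_ifs with hm
  · rfl
  · have h1 := congrArg (PowerSeries.coeff m) h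
    rw [Polynomial.coeff_coe, Polynomial.coeff_eq_zero_of_natDegree_lt (by omega),
      Polynomial.polynomial_map_coe, ← map_mul, PowerSeries.coeff_map] at h1
    exact (algebraMap ℚ ℝ).injective (by rw [h1, map_zero])

end PIg

theorem stmt12 (p : ℕ) [Fact p.Prime] {n : ℕ}
    (f : MvPolynomial (Fin n) ℤ) (hf : 0 < f.totalDegree) :
    ∃ A B : Polynomial ℚ, B ≠ 0 ∧
      (PowerSeries.mk fun i => B.coeff i) * poincareSeries p f =
        PowerSeries.mk fun i => A.coeff i := by
  refine PIg.final ?_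
  convert PIg.rat_main (p := p) f using 1
  ext i
  simp only [poincareSeries, PowerSeries.coeff_map, PowerSeries.coeff_mk]
  rcases Nat.eq_zero_or_pos i with rfl | hi
  · haveI : Subsingleton (ZMod (p ^ 0)) := by rw [pow_zero]; infer_instance
    haveI : Inhabited {a : Fin n → ZMod (p ^ 0) //
        eval a (MvPolynomial.map (Int.castRingHom (ZMod (p ^ 0))) f) = 0} :=
      ⟨⟨fun _ => 0, Subsingleton.elim _ _⟩⟩
    rw [Nat.card_unique]
    simp
  · rw [if_neg hi.ne']
    simp [zeroCount]
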